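/- Let n ≥ 2 and let A, B ⊂ ℂⁿ be compact sets such that cl(A \ B) ∩ cl(B \ A) = ∅ and such that each of A, B, A ∪ B and C := A ∩ B has a Stein neighborhood basis. Let P be a compact metric space. Then for every open set C̃ ⊇ C there exist open sets A' ⊇ A, B' ⊇ B and C' with C ⊆ C' ⊆ A' ∩ B' ⊆ C̃ such that: for every μ > 0 there exists ε > 0 with the property that for every family (γ_ζ)_{ζ∈P} of injective holomorphic maps γ_ζ : C̃ → ℂⁿ, depending continuously on ζ (uniformly on compacts), with sup_{ζ∈P, z∈C̃} ‖γ_ζ(z) − z‖ < ε, there exist families (α_ζ)_{ζ∈P} and (β_ζ)_{ζ∈P}, depending continuously on ζ, of injective holomorphic maps α_ζ : A' → ℂⁿ and β_ζ : B' → ℂⁿ with sup_{ζ,A'} ‖α_ζ − id‖ < μ and sup_{ζ,B'} ‖β_ζ − id‖ < μ, such that γ_ζ = β_ζ ∘ α_ζ^{-1} on C' for every ζ ∈ P. -/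

import Mathlib

open Metric Set Filter Asymptotics
open scoped Manifold Topology

noncomputable section

/-- ℂⁿ with its Hermitian (Euclidean) structure. -/
abbrev CSp (n : ℕ) := EuclideanSpace ℂ (Fin n)

/-- A bounded domain: open, connected and bounded. -/
def IsBoundedDomain {n : ℕ} (Ω : Set (CSp n)) : Prop :=
  IsOpen Ω ∧ IsConnected Ω ∧ Bornology.IsBounded Ω

/-- A holomorphically convex (Stein) open subset of ℂⁿ: for every compact `K ⊆ U`
the holomorphically convex hull of `K` in `U` is compact. -/
def IsSteinOpen {n : ℕ} (U : Set (CSp n)) : Prop :=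
  IsOpen U ∧ ∀ K : Set (CSp n), K ⊆ U → IsCompact K →
    IsCompact {z ∈ U | ∀ g : CSp n → ℂ, DifferentiableOn ℂ g U →
      ‖g z‖ ≤ sSup ((fun w => ‖g w‖) '' K)}

/-- A set `L` has a Stein neighborhood basis. -/
def HasSteinNbhdBasis {n : ℕ} (L : Set (CSp n)) : Prop :=
  ∀ U : Set (CSp n), IsOpen U → L ⊆ U → ∃ V, IsSteinOpen V ∧ L ⊆ V ∧ V ⊆ U

set_option linter.unusedSectionVars false

section foundations

/-- Cauchy estimate for the derivative. -/
lemma cauchy_fderiv {X G : Type*} [NormedAddCommGroup X] [NormedSpace ℂ X]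
    [NormedAddCommGroup G] [NormedSpace ℂ G] {f : X → G} {x : X} {r C : ℝ} (hr : 0 < r)
    (hf : DifferentiableOn ℂ f (ball x r)) (hb : ∀ z ∈ ball x r, ‖f z‖ ≤ C) :
    ‖fderiv ℂ f x‖ ≤ 2 * C / r := by
  apply Complex.norm_fderiv_le_div_of_mapsTo_ball hf _ hr
  intro z hz
  rw [mem_closedBall, dist_eq_norm]
  have h1 := hb z hz
  have h3 := hb x (mem_ball_self hr)
  calc ‖f z - f x‖ ≤ ‖f z‖ + ‖f x‖ := norm_sub_le _ _
    _ ≤ 2 * C := by linarith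

/-- Several variable Weierstrass. -/
lemma weierstrass {X G : Type*} [NormedAddCommGroup X] [NormedSpace ℂ X]
    [NormedAddCommGroup G] [NormedSpace ℂ G] [CompleteSpace G]
    {F : ℕ → X → G} {f : X → G} {U : Set X} (hU : IsOpen U)
    (hF : ∀ n, DifferentiableOn ℂ (F n) U) (h : TendstoUniformlyOn F f atTop U) :
    DifferentiableOn ℂ f U := by
  intro x hx
  obtain ⟨r, hr, hrU⟩ := Metric.isOpen_iff.1 hU x hx
  have hr2 : (0:ℝ) < r / 2 := by positivity
  have hsub : ∀ y ∈ ball x (r/2), ball y (r/2) ⊆ U := fun y hy =>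
    (ball_subset_ball' (by rw [mem_ball] at hy; linarith)).trans hrU
  have hdn : ∀ k, ∀ y ∈ ball x (r/2), DifferentiableAt ℂ (F k) y := fun k y hy =>
      (hF k).differentiableAt (hU.mem_nhds (hsub y hy (mem_ball_self hr2)))
  have hc := h.uniformCauchySeqOn
  have hd : UniformCauchySeqOn (fun n => fderiv ℂ (F n)) atTop (ball x (r/2)) := by
    rw [Metric.uniformCauchySeqOn_iff] at *
    intro ε hε
    obtain ⟨N, hN⟩ := hc (ε * r / 8) (by positivity)
    refine ⟨N, fun m hm n hn y hy => ?_⟩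
    rw [dist_eq_norm, ← fderiv_sub (hdn _ y hy) (hdn _ y hy)]
    have : ‖fderiv ℂ (F m - F n) y‖ ≤ 2 * (ε * r / 8) / (r/2) := by
      apply cauchy_fderiv hr2
      · exact ((hF _).sub (hF _)).mono (hsub y hy)
      · intro z hz
        have := hN m hm n hn z (hsub y hy hz)
        rw [dist_eq_norm] at this
        exact this.le
    refine this.trans_lt ?_
    field_simp
    linarith
  have hlim : ∀ y ∈ ball x (r/2), ∃ L, Tendsto (fun n => fderiv ℂ (F n) y) atTop (𝓝 L) :=
    fun y hy => cauchySeq_tendsto_of_complete (hd.cauchySeq hy)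
  choose! g' hg' using hlim
  have := hasFDerivAt_of_tendstoUniformlyOn isOpen_ball (hd.tendstoUniformlyOn_of_tendsto hg')
    (fun n y hy => (hdn n y hy).hasFDerivAt)
    (fun y hy => h.tendsto_at (hsub y hy (mem_ball_self hr2))) (mem_ball_self hr2)
  exact this.differentiableAt.differentiableWithinAt

/-- Derivatives depend continuously on parameters. -/
lemma fderiv_param_cont {T X G : Type*} [MetricSpace T] [NormedAddCommGroup X] [NormedSpace ℂ X]
    [ProperSpace X] [NormedAddCommGroup G] [NormedSpace ℂ G] {φ : T → X → G} {S : Set T}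
    (hS : IsCompact S) {U : Set X} (hU : IsOpen U)
    (hc : ContinuousOn (fun q : T × X => φ q.1 q.2) (S ×ˢ U))
    (hd : ∀ t ∈ S, DifferentiableOn ℂ (φ t) U) {x : X} (hx : x ∈ U) :
    ContinuousOn (fun t => fderiv ℂ (φ t) x) S := by
  obtain ⟨r, hr, hrU⟩ := Metric.nhds_basis_closedBall.mem_iff.1 (hU.mem_nhds hx)
  have hu := (hS.prod (isCompact_closedBall x r)).uniformContinuousOn_of_continuous
    (hc.mono (prod_mono_right hrU))
  rw [Metric.uniformContinuousOn_iff] at hu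
  rw [Metric.continuousOn_iff]
  intro t ht ε hε
  obtain ⟨δ, hδ, h⟩ := hu (ε * r / 4) (by positivity)
  refine ⟨δ, hδ, fun s hs hst => ?_⟩
  have hxx := hU.mem_nhds hx
  rw [dist_eq_norm, ← fderiv_sub ((hd s hs).differentiableAt hxx) ((hd t ht).differentiableAt hxx)]
  have : ‖fderiv ℂ (φ s - φ t) x‖ ≤ 2 * (ε * r / 4) / r := by
    apply cauchy_fderiv hr
    · exact ((hd s hs).sub (hd t ht)).mono (ball_subset_closedBall.trans hrU)
    · intro z hz
      have hz' := ball_subset_closedBall hz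
      have := h (s, z) ⟨hs, hz'⟩ (t, z) ⟨ht, hz'⟩ (by simpa [Prod.dist_eq] using hst)
      rw [dist_eq_norm] at this
      exact this.le
  refine this.trans_lt ?_
  field_simp
  linarith

/-- Holomorphy of parametric integrals. -/
lemma diffOn_integral {X G : Type*} [NormedAddCommGroup X] [NormedSpace ℂ X]
    [ProperSpace X] [NormedAddCommGroup G] [NormedSpace ℂ G] [CompleteSpace G]
    {φ : ℝ → X → G} {a b : ℝ} {U : Set X} (hU : IsOpen U)
    (hc : ContinuousOn (fun q : ℝ × X => φ q.1 q.2) (uIcc a b ×ˢ U))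
    (hd : ∀ t ∈ uIcc a b, DifferentiableOn ℂ (φ t) U) :
    DifferentiableOn ℂ (fun z => ∫ t in a..b, φ t z) U := by
  intro x hx
  obtain ⟨r, hr, hrU⟩ := Metric.nhds_basis_closedBall.mem_iff.1 (hU.mem_nhds hx)
  have hr2 : (0:ℝ) < r / 2 := by positivity
  have hsub : ∀ y ∈ ball x (r/2), ball y (r/2) ⊆ closedBall x r := fun y hy =>
    (ball_subset_ball' (by rw [mem_ball] at hy; linarith)).trans ball_subset_closedBall
  have hcomp := (isCompact_uIcc (a := a) (b := b)).prod (isCompact_closedBall x r)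
  obtain ⟨C, hC⟩ := hcomp.exists_bound_of_continuousOn (hc.mono (prod_mono_right hrU))
  have hct : ∀ y ∈ U, ContinuousOn (fun t => φ t y) (uIcc a b) := fun y hy =>
    hc.comp (f := fun t => (t, y)) (by fun_prop) (fun t ht => ⟨ht, hy⟩)
  have hIoc : uIoc a b ⊆ uIcc a b := uIoc_subset_uIcc
  have key := intervalIntegral.hasFDerivAt_integral_of_dominated_of_fderiv_le
    (μ := MeasureTheory.volume) (𝕜 := ℂ)
    (F := fun z t => φ t z) (F' := fun z t => fderiv ℂ (φ t) z) (x₀ := x) (a := a) (b := b)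
    (bound := fun _ => 2 * C / (r/2)) (ball_mem_nhds x hr2) ?_ ?_ ?_ ?_ ?_ ?_
  · exact key.differentiableAt.differentiableWithinAt
  · filter_upwards [hU.mem_nhds hx] with y hy
    exact ((hct y hy).mono hIoc).aestronglyMeasurable measurableSet_uIoc
  · exact (hct x hx).intervalIntegrable
  · exact ((fderiv_param_cont isCompact_uIcc hU hc hd hx).mono hIoc).aestronglyMeasurable
      measurableSet_uIoc
  · refine Eventually.of_forall fun t ht y hy => ?_
    apply cauchy_fderiv hr2
    · exact (hd t (hIoc ht)).mono ((hsub y hy).trans hrU)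
    · intro z hz
      exact hC (t, z) ⟨hIoc ht, hsub y hy hz⟩
  · simp
  · refine Eventually.of_forall fun t ht y hy => ?_
    exact ((hd t (hIoc ht)).differentiableAt
      (hU.mem_nhds (hrU (hsub y hy (mem_ball_self hr2))))).hasFDerivAt

/-- Bounded functions with the sup norm. -/
abbrev BF (T G : Type*) [NormedAddCommGroup G] := lp (fun _ : T => G) ⊤

lemma BF.le {T G : Type*} [NormedAddCommGroup G] (f : BF T G) (t : T) : ‖f t‖ ≤ ‖f‖ :=
  lp.norm_apply_le_norm (by simp) f t

def BF.of {T G : Type*} [NormedAddCommGroup G] (f : T → G) (h : ∃ C, ∀ t, ‖f t‖ ≤ C) : BF T G :=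
  ⟨f, memℓp_infty_iff.2 (by obtain ⟨C, hC⟩ := h; exact ⟨C, by rintro _ ⟨t, rfl⟩; exact hC t⟩)⟩

@[simp] lemma BF.of_apply {T G : Type*} [NormedAddCommGroup G] (f : T → G)
    (h : ∃ C, ∀ t, ‖f t‖ ≤ C) (t : T) : BF.of f h t = f t := rfl

lemma BF.cont_apply {T G : Type*} [NormedAddCommGroup G] (t : T) :
    Continuous (fun f : BF T G => f t) := by
  refine LipschitzWith.continuous (K := 1) (LipschitzWith.of_dist_le_mul fun f g => ?_)
  rw [dist_eq_norm, dist_eq_norm]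
  simpa using BF.le (f - g) t

lemma BF.unif {T G : Type*} [NormedAddCommGroup G] {f : ℕ → BF T G} {f0 : BF T G}
    (h : Tendsto f atTop (𝓝 f0)) :
    TendstoUniformly (fun n t => f n t) (fun t => f0 t) atTop := by
  rw [Metric.tendstoUniformly_iff]
  intro ε hε
  filter_upwards [Metric.tendsto_nhds.1 h ε hε] with n hn t
  rw [dist_eq_norm] at hn
  rw [dist_comm, dist_eq_norm]
  exact (by simpa using BF.le (f n - f0) t : _ ≤ _).trans_lt hn

lemma BF.isClosed_diffOn {T X G : Type*} [NormedAddCommGroup X] [NormedSpace ℂ X]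
    [NormedAddCommGroup G] [NormedSpace ℂ G] [CompleteSpace G] (s : X → T) {U : Set X}
    (hU : IsOpen U) : IsClosed {f : BF T G | DifferentiableOn ℂ (fun z => f (s z)) U} := by
  refine IsSeqClosed.isClosed fun f f0 hf h0 => ?_
  refine weierstrass hU hf ?_
  have := (BF.unif h0).comp s
  exact this.tendstoUniformlyOn

lemma BF.isClosed_contOn {T Y G : Type*} [TopologicalSpace Y]
    [NormedAddCommGroup G] (s : Y → T) {U : Set Y} :
    IsClosed {f : BF T G | ContinuousOn (fun z => f (s z)) U} := by
  refine IsSeqClosed.isClosed fun f f0 hf h0 => ?_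
  have := ((BF.unif h0).comp s).tendstoUniformlyOn (s := U)
  exact this.continuousOn (Eventually.of_forall hf).frequently

/-- iteration lemma -/
lemma iterate_surj {X Y : Type*} [NormedAddCommGroup X] [NormedSpace ℂ X] [CompleteSpace X]
    [NormedAddCommGroup Y] [NormedSpace ℂ Y] (T : X →L[ℂ] Y) (C : ℝ) (hC : 0 ≤ C)
    (h : ∀ y, ∃ x, ‖x‖ ≤ C * ‖y‖ ∧ ‖y - T x‖ ≤ ‖y‖ / 2) (y : Y) :
    ∃ x, T x = y ∧ ‖x‖ ≤ 2 * C * ‖y‖ := by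
  choose g hg1 hg2 using h
  let R : ℕ → Y := fun n => Nat.rec y (fun _ r => r - T (g r)) n
  have hR : ∀ n, ‖R n‖ ≤ ‖y‖ * (1/2)^n := by
    intro n
    induction n with
    | zero => simp [R]
    | succ k ih =>
      have : R (k+1) = R k - T (g (R k)) := rfl
      rw [this]
      refine (hg2 _).trans ?_
      rw [pow_succ]; linarith
  have hx : ∀ n, ‖g (R n)‖ ≤ C * ‖y‖ * (1/2)^n := fun n =>
    (hg1 _).trans (by rw [mul_assoc]; exact mul_le_mul_of_nonneg_left (hR n) hC)
  have hs : HasSum (fun n : ℕ => C * ‖y‖ * (1/2:ℝ)^n) (C * ‖y‖ * 2) :=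
    (hasSum_geometric_two).mul_left _
  have hsum : Summable (fun n => g (R n)) := Summable.of_norm_bounded hs.summable hx
  refine ⟨∑' n, g (R n), ?_, ?_⟩
  · have hp : ∀ n, ∑ k ∈ Finset.range n, T (g (R k)) = y - R n := by
      intro n
      induction n with
      | zero => simp [R]
      | succ k ih =>
        have : R (k+1) = R k - T (g (R k)) := rfl
        rw [Finset.sum_range_succ, ih, this]; abel
    have h1 := (hsum.hasSum.mapL T).tendsto_sum_nat
    have h2 : Tendsto R atTop (𝓝 0) := by
      apply squeeze_zero_norm hR
      have := (tendsto_pow_atTop_nhds_zero_of_lt_one (r := (1/2:ℝ)) (by norm_num)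
        (by norm_num)).const_mul ‖y‖
      simpa using this
    have h3 : Tendsto (fun n => y - R n) atTop (𝓝 (y - 0)) := tendsto_const_nhds.sub h2
    simp only [hp] at h1
    rw [sub_zero] at h3
    exact tendsto_nhds_unique h1 h3
  · have := tsum_of_norm_bounded hs hx
    linarith

/-- open mapping in relation form -/
lemma om_rel {Y1 Y2 : Type*} [NormedAddCommGroup Y1] [NormedSpace ℂ Y1] [CompleteSpace Y1]
    [NormedAddCommGroup Y2] [NormedSpace ℂ Y2] [CompleteSpace Y2]
    (E : Submodule ℂ (Y1 × Y2)) (hE : IsClosed (E : Set (Y1 × Y2))) (F : Submodule ℂ Y1)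
    (hF : IsClosed (F : Set Y1)) (hsub : ∀ p ∈ E, p.1 ∈ F) (hs : ∀ y ∈ F, ∃ p ∈ E, p.1 = y) :
    ∃ C > 0, ∀ y ∈ F, ∃ p ∈ E, p.1 = y ∧ ‖p‖ ≤ C * ‖y‖ := by
  have : CompleteSpace E := hE.completeSpace_coe
  have : CompleteSpace F := hF.completeSpace_coe
  let T : E →L[ℂ] F :=
    ((ContinuousLinearMap.fst ℂ Y1 Y2).comp E.subtypeL).codRestrict F (fun p => hsub p.1 p.2)
  have hsurj : Function.Surjective T := by
    rintro ⟨y, hy⟩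
    obtain ⟨p, hp, rfl⟩ := hs y hy
    exact ⟨⟨p, hp⟩, rfl⟩
  obtain ⟨C, hC, h⟩ := T.exists_preimage_norm_le hsurj
  refine ⟨C, hC, fun y hy => ?_⟩
  obtain ⟨p, hp, hn⟩ := h ⟨y, hy⟩
  exact ⟨p.1, p.2, congrArg Subtype.val hp, hn⟩

/-- shrinking -/
lemma shrink2 {X : Type*} [MetricSpace X] {K1 K2 N : Set X} (h1 : IsCompact K1)
    (h2 : IsCompact K2) (hN : IsOpen N) (h : K1 ∩ K2 ⊆ N) :
    ∃ V1 V2, IsOpen V1 ∧ IsOpen V2 ∧ K1 ⊆ V1 ∧ K2 ⊆ V2 ∧ V1 ∩ V2 ⊆ N := by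
  have hd : Disjoint (K1 \ N) (K2 \ N) := by
    rw [Set.disjoint_left]
    rintro x ⟨a, b⟩ ⟨c, d⟩
    exact b (h ⟨a, c⟩)
  obtain ⟨V1, V2, o1, o2, s1, s2, dd⟩ :=
    SeparatedNhds.of_isCompact_isCompact (h1.diff hN) (h2.diff hN) hd
  refine ⟨V1 ∪ N, V2 ∪ N, o1.union hN, o2.union hN, ?_, ?_, ?_⟩
  · intro x hx; by_cases hxN : x ∈ N
    · exact Or.inr hxN
    · exact Or.inl (s1 ⟨hx, hxN⟩)
  · intro x hx; by_cases hxN : x ∈ N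
    · exact Or.inr hxN
    · exact Or.inl (s2 ⟨hx, hxN⟩)
  · rintro x ⟨a | a, b | b⟩
    · exact absurd b (Set.disjoint_left.1 dd a)
    all_goals assumption

/-- local criterion -/
lemma diffOn_of_local {X G : Type*} [NormedAddCommGroup X] [NormedSpace ℂ X]
    [NormedAddCommGroup G] [NormedSpace ℂ G] {f : X → G} {D : Set X}
    (h : ∀ x ∈ D, ∃ W g, IsOpen W ∧ x ∈ W ∧ DifferentiableOn ℂ g W ∧ ∀ z ∈ W, f z = g z) :
    DifferentiableOn ℂ f D := by
  intro x hx
  obtain ⟨W, g, hW, hxW, hg, he⟩ := h x hx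
  have : DifferentiableAt ℂ g x := hg.differentiableAt (hW.mem_nhds hxW)
  refine (this.congr_of_eventuallyEq ?_).differentiableWithinAt
  filter_upwards [hW.mem_nhds hxW] with z hz using he z hz

end foundations

section rect
open Complex intervalIntegral

lemma log_I_mul' {q : ℂ} (h : 0 < q.re) : Complex.log (I * q) = Complex.log q + Real.pi / 2 * I := by
  have hq : q ≠ 0 := by rintro rfl; simp at h
  rw [(Complex.log_mul_eq_add_log_iff I_ne_zero hq).2, Complex.log_I, add_comm]
  have := abs_lt.1 (Complex.abs_arg_lt_pi_div_two_iff.2 (Or.inl h))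
  rw [Complex.arg_I]
  constructor <;> linarith [Real.pi_pos]

lemma side_log (u p q z : ℂ) (a b : ℝ) (h : ∀ t ∈ uIcc a b, 0 < (u * (p + t * q - z)).re) :
    ∫ t in a..b, q / (p + t * q - z) =
      Complex.log (u * (p + b * q - z)) - Complex.log (u * (p + a * q - z)) := by
  have hne : ∀ t ∈ uIcc a b, u * (p + t * q - z) ≠ 0 := by
    intro t ht h0
    have := h t ht
    rw [h0] at this; simp at this
  rw [intervalIntegral.integral_eq_sub_of_hasDerivAt
    (f := fun t : ℝ => Complex.log (u * (p + t * q - z)))]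
  · intro t ht
    have h1 : HasDerivAt (fun t : ℝ => u * (p + t * q - z)) (u * q) t := by
      have h0 : HasDerivAt (fun t : ℝ => (t : ℂ)) 1 t := Complex.ofRealCLM.hasDerivAt
      simpa using (((h0.mul_const q).const_add p).sub_const z).const_mul u
    have h2 := h1.clog_real (Or.inl (h t ht))
    have h3 := hne t ht
    have h4 : u ≠ 0 := left_ne_zero_of_mul h3
    rw [mul_div_mul_left _ _ h4] at h2
    exact h2
  · apply ContinuousOn.intervalIntegrable
    apply ContinuousOn.div (by fun_prop) (by fun_prop)
    intro t ht
    exact right_ne_zero_of_mul (hne t ht)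

def rectInt (f : ℂ → ℂ) (x0 x1 y0 y1 : ℝ) : ℂ :=
  (∫ x : ℝ in x0..x1, f (x + y0 * I)) - (∫ x : ℝ in x0..x1, f (x + y1 * I)) +
   I * (∫ y : ℝ in y0..y1, f (x1 + y * I)) - I * (∫ y : ℝ in y0..y1, f (x0 + y * I))

lemma rect_winding {x0 x1 y0 y1 : ℝ} {z : ℂ} (h0 : x0 < z.re) (h1 : z.re < x1)
    (h2 : y0 < z.im) (h3 : z.im < y1) :
    rectInt (fun w => 1 / (w - z)) x0 x1 y0 y1 = 2 * Real.pi * I := by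
  unfold rectInt
  have e1 := side_log I (y0 * I) 1 z x0 x1 (by intro t _; simp; linarith)
  have e2 := side_log (-I) (y1 * I) 1 z x0 x1 (by intro t _; simp; linarith)
  have e3 := side_log 1 x1 I z y0 y1 (by intro t _; simp; linarith)
  have e4 := side_log (-1) x0 I z y0 y1 (by intro t _; simp; linarith)
  have c1 : ∫ x : ℝ in x0..x1, 1 / ((x:ℂ) + y0 * I - z) = ∫ t : ℝ in x0..x1, 1 / (y0 * I + t * 1 - z) := by
    congr 1; ext t; ring_nf
  have c2 : ∫ x : ℝ in x0..x1, 1 / ((x:ℂ) + y1 * I - z) = ∫ t : ℝ in x0..x1, 1 / (y1 * I + t * 1 - z) := by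
    congr 1; ext t; ring_nf
  have c3 : I * ∫ y : ℝ in y0..y1, 1 / ((x1:ℂ) + y * I - z) = ∫ t : ℝ in y0..y1, I / (x1 + t * I - z) := by
    rw [← intervalIntegral.integral_const_mul]; congr 1; ext t; ring_nf
  have c4 : I * ∫ y : ℝ in y0..y1, 1 / ((x0:ℂ) + y * I - z) = ∫ t : ℝ in y0..y1, I / (x0 + t * I - z) := by
    rw [← intervalIntegral.integral_const_mul]; congr 1; ext t; ring_nf
  rw [c1, c2, c3, c4, e1, e2, e3, e4]
  have d1 := log_I_mul' (q := 1 * (x1 + y0 * I - z)) (by simp; linarith)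
  have d2 := log_I_mul' (q := (-I) * (x1 + y1 * I - z)) (by simp; linarith)
  have d3 := log_I_mul' (q := (-1) * (x0 + y1 * I - z)) (by simp; linarith)
  have d4 := log_I_mul' (q := I * (x0 + y0 * I - z)) (by simp; linarith)
  have f1 : I * (y0 * I + x1 * 1 - z) = I * (1 * (x1 + y0 * I - z)) := by ring
  have f2 : 1 * (x1 + y1 * I - z) = I * (-I * (x1 + y1 * I - z)) := by
    linear_combination ((x1 + y1 * I - z)) * Complex.I_mul_I
  have f3 : -I * (y1 * I + x0 * 1 - z) = I * (-1 * (x0 + y1 * I - z)) := by ring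
  have f4 : -1 * (x0 + y0 * I - z) = I * (I * (x0 + y0 * I - z)) := by
    linear_combination (-(x0 + y0 * I - z)) * Complex.I_mul_I
  have f5 : -I * (y1 * I + x1 * 1 - z) = -I * (x1 + y1 * I - z) := by ring
  have f6 : I * (y0 * I + x0 * 1 - z) = I * (x0 + y0 * I - z) := by ring
  rw [f1, f2, f3, f4, f5, f6, d1, d2, d3, d4]
  ring

lemma rect_cauchy {x0 x1 y0 y1 : ℝ} {z : ℂ} (h0 : x0 < z.re) (h1 : z.re < x1)
    (h2 : y0 < z.im) (h3 : z.im < y1) {f : ℂ → ℂ} {W : Set ℂ} (hW : IsOpen W)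
    (hf : DifferentiableOn ℂ f W) (hr : uIcc x0 x1 ×ℂ uIcc y0 y1 ⊆ W) :
    rectInt (fun w => f w / (w - z)) x0 x1 y0 y1 = 2 * Real.pi * I * f z := by
  have hx : x0 ≤ x1 := by linarith
  have hy : y0 ≤ y1 := by linarith
  have hzW : z ∈ W := hr (by simp only [mem_reProdIm, uIcc_of_le hx, uIcc_of_le hy, mem_Icc]; constructor <;> constructor <;> linarith)
  have hd : DifferentiableOn ℂ (dslope f z) W := (Complex.differentiableOn_dslope (hW.mem_nhds hzW)).2 hf
  have := Complex.integral_boundary_rect_eq_zero_of_differentiableOn (dslope f z)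
    (x0 + y0 * I) (x1 + y1 * I) (by simpa using hd.mono hr)
  simp at this
  have hw := rect_winding h0 h1 h2 h3
  have hsplit : ∀ (p q : ℂ) (a b : ℝ), (∀ t ∈ uIcc a b, p + t * q ≠ z) → 
      (∀ t ∈ uIcc a b, p + t * q ∈ W) →
      ∫ t in a..b, dslope f z (p + t * q) =
       (∫ t in a..b, f (p + t * q) / (p + t * q - z)) - f z * ∫ t in a..b, 1 / (p + t * q - z) := by
    intro p q a b hne hm
    have hne' : ∀ t ∈ uIcc a b, p + t * q - z ≠ 0 := fun t ht => sub_ne_zero.2 (hne t ht)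
    rw [← intervalIntegral.integral_const_mul, ← intervalIntegral.integral_sub]
    · apply intervalIntegral.integral_congr
      intro t ht
      simp only
      rw [dslope_of_ne _ (hne t ht), slope_def_field]
      ring
    · apply ContinuousOn.intervalIntegrable
      exact ContinuousOn.div (hf.continuousOn.comp (by fun_prop) hm) (by fun_prop) hne'
    · apply ContinuousOn.intervalIntegrable
      exact continuousOn_const.mul (ContinuousOn.div (by fun_prop) (by fun_prop) hne')
  have hsplit1 : ∀ y : ℝ, y ≠ z.im → y ∈ uIcc y0 y1 →  ∫ t in x0..x1, dslope f z (t + y * I) =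
       (∫ t in x0..x1, f (t + y * I) / (t + y * I - z)) - f z * ∫ t in x0..x1, 1 / (t + y * I - z) := by
    intro y hy1 hy2
    have := hsplit (y * I) 1 x0 x1 (by rintro t ht rfl; simp at hy1)
      (by intro t ht; apply hr; simpa [mem_reProdIm] using ⟨ht, hy2⟩)
    simpa only [mul_one, add_comm (y * I : ℂ)] using this
  have hsplit2 : ∀ x : ℝ, x ≠ z.re → x ∈ uIcc x0 x1 → ∫ t in y0..y1, dslope f z (x + t * I) =
       (∫ t in y0..y1, f (x + t * I) / (x + t * I - z)) - f z * ∫ t in y0..y1, 1 / (x + t * I - z) := by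
    intro y hy1 hy2
    exact hsplit y I y0 y1 (by rintro t ht rfl; simp at hy1)
      (by intro t ht; apply hr; simpa [mem_reProdIm] using ⟨hy2, ht⟩)
  rw [hsplit1 y0 h2.ne left_mem_uIcc, hsplit1 y1 h3.ne' right_mem_uIcc,
    hsplit2 x0 h0.ne left_mem_uIcc, hsplit2 x1 h1.ne' right_mem_uIcc] at this
  unfold rectInt at *
  linear_combination this + f z * hw
end rect

section H1defs
variable {X : Type*} [NormedAddCommGroup X] [NormedSpace ℂ X]

lemma diffOn_div {f g : X → ℂ} {s : Set X} (hf : DifferentiableOn ℂ f s)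
    (hg : DifferentiableOn ℂ g s) (h0 : ∀ x ∈ s, g x ≠ 0) :
    DifferentiableOn ℂ (fun x => f x / g x) s := by
  simp only [div_eq_mul_inv]
  exact hf.mul (hg.inv h0)

lemma diffOn_divc {f : X → ℂ} {s : Set X} {c : ℂ} (hf : DifferentiableOn ℂ f s) :
    DifferentiableOn ℂ (fun x => f x / c) s := by
  simp only [div_eq_mul_inv]
  exact hf.mul_const _

def IsCoc {ι : Type*} (U : ι → Set X) (g : ι → ι → X → ℂ) : Prop :=
  (∀ i j, DifferentiableOn ℂ (g i j) (U i ∩ U j)) ∧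
  ∀ i j k z, z ∈ U i → z ∈ U j → z ∈ U k → g i j z + g j k z = g i k z

def SplitsOn {ι : Type*} (U : ι → Set X) (g : ι → ι → X → ℂ) (V : Set X) : Prop :=
  ∃ h : ι → X → ℂ, (∀ i, DifferentiableOn ℂ (h i) (U i ∩ V)) ∧
    ∀ i j z, z ∈ U i → z ∈ U j → z ∈ V → g i j z = h i z - h j z

def SplitsNear {ι : Type*} (U : ι → Set X) (g : ι → ι → X → ℂ) (K : Set X) : Prop :=
  ∃ V, IsOpen V ∧ K ⊆ V ∧ SplitsOn U g V

def H1 (K : Set X) : Prop :=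
  ∀ (ι : Type) (U : ι → Set X) (g : ι → ι → X → ℂ), (∀ i, IsOpen (U i)) → K ⊆ ⋃ i, U i →
    IsCoc U g → SplitsNear U g K

def Cous (K1 K2 : Set X) : Prop :=
  ∀ (N : Set X) (c : X → ℂ), IsOpen N → K1 ∩ K2 ⊆ N → DifferentiableOn ℂ c N →
    ∃ N1 N2 g1 g2, IsOpen N1 ∧ IsOpen N2 ∧ K1 ⊆ N1 ∧ K2 ⊆ N2 ∧ N1 ∩ N2 ⊆ N ∧
      DifferentiableOn ℂ g1 N1 ∧ DifferentiableOn ℂ g2 N2 ∧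
      ∀ z ∈ N1 ∩ N2, c z = g1 z - g2 z

lemma H1_of_basis {K : Set X}
    (h : ∀ O, IsOpen O → K ⊆ O → ∃ K', K ⊆ K' ∧ K' ⊆ O ∧ H1 K') : H1 K := by
  intro ι U g hU hK hg
  obtain ⟨K', h1, h2, h3⟩ := h _ (isOpen_iUnion hU) hK
  obtain ⟨V, hV, hKV, hs⟩ := h3 ι U g hU h2 hg
  exact ⟨V, hV, h1.trans hKV, hs⟩

lemma IsCoc.splits_of_subset {ι : Type*} {U : ι → Set X} {g : ι → ι → X → ℂ} (hg : IsCoc U g)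
    (i0 : ι) {V : Set X} (hV : V ⊆ U i0) : SplitsOn U g V := by
  refine ⟨fun i => g i i0, fun i => (hg.1 i i0).mono (inter_subset_inter_right _ hV), ?_⟩
  intro i j z hi hj hz
  have h1 := hg.2 i j i0 z hi hj (hV hz)
  linear_combination h1

lemma MV {ι : Type*} {U : ι → Set X} (hU : ∀ i, IsOpen (U i)) {g : ι → ι → X → ℂ}
    {K1 K2 : Set X} (hK : K1 ∪ K2 ⊆ ⋃ i, U i)
    (h1 : SplitsNear U g K1) (h2 : SplitsNear U g K2) (hc : Cous K1 K2) :
    SplitsNear U g (K1 ∪ K2) := by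
  classical
  obtain ⟨V1, oV1, kV1, a1, da1, ea1⟩ := h1
  obtain ⟨V2, oV2, kV2, a2, da2, ea2⟩ := h2
  let c : X → ℂ := fun z => if h : ∃ i, z ∈ U i then a1 h.choose z - a2 h.choose z else 0
  have hcc : ∀ i z, z ∈ U i → z ∈ V1 → z ∈ V2 → c z = a1 i z - a2 i z := by
    intro i z hz h1 h2
    have h : ∃ i, z ∈ U i := ⟨i, hz⟩
    simp only [c, dif_pos h]
    have e1 := ea1 h.choose i z h.choose_spec hz h1
    have e2 := ea2 h.choose i z h.choose_spec hz h2
    rw [e1] at e2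
    linear_combination e2
  have oU := isOpen_iUnion hU
  obtain ⟨N1, N2, g1, g2, oN1, oN2, kN1, kN2, hN, dg1, dg2, eg⟩ :=
    hc (V1 ∩ V2 ∩ ⋃ i, U i) c ((oV1.inter oV2).inter oU)
      (fun z hz => ⟨⟨kV1 hz.1, kV2 hz.2⟩, hK (Or.inl hz.1)⟩)
      (diffOn_of_local (by
        rintro z ⟨⟨hz1, hz2⟩, hz⟩
        obtain ⟨i, hi⟩ := mem_iUnion.1 hz
        refine ⟨U i ∩ (V1 ∩ V2), fun z => a1 i z - a2 i z, (hU i).inter (oV1.inter oV2),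
          ⟨hi, hz1, hz2⟩, ?_, fun w hw => hcc i w hw.1 hw.2.1 hw.2.2⟩
        exact ((da1 i).mono (inter_subset_inter_right _ inter_subset_left)).sub
          ((da2 i).mono (inter_subset_inter_right _ inter_subset_right))))
  let h : ι → X → ℂ := fun i z => if z ∈ V1 ∩ N1 then a1 i z - g1 z else a2 i z - g2 z
  have hh1 : ∀ i z, z ∈ V1 ∩ N1 → h i z = a1 i z - g1 z := fun i z hz => if_pos hz
  have hh2 : ∀ i z, z ∈ U i → z ∈ V2 ∩ N2 → h i z = a2 i z - g2 z := by
    intro i z hi hz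
    by_cases h1 : z ∈ V1 ∩ N1
    · rw [hh1 i z h1]
      have e1 := eg z ⟨h1.2, hz.2⟩
      rw [hcc i z hi h1.1 hz.1] at e1
      linear_combination e1
    · exact if_neg h1
  refine ⟨(V1 ∩ N1) ∪ (V2 ∩ N2), (oV1.inter oN1).union (oV2.inter oN2), ?_, h, ?_, ?_⟩
  · rintro z (hz | hz)
    · exact Or.inl ⟨kV1 hz, kN1 hz⟩
    · exact Or.inr ⟨kV2 hz, kN2 hz⟩
  · intro i
    apply diffOn_of_local
    rintro z ⟨hzi, hz | hz⟩
    · exact ⟨U i ∩ (V1 ∩ N1), _, (hU i).inter (oV1.inter oN1), ⟨hzi, hz⟩,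
        ((da1 i).mono (inter_subset_inter_right _ inter_subset_left)).sub
          (dg1.mono (fun w hw => hw.2.2)), fun w hw => hh1 i w hw.2⟩
    · exact ⟨U i ∩ (V2 ∩ N2), _, (hU i).inter (oV2.inter oN2), ⟨hzi, hz⟩,
        ((da2 i).mono (inter_subset_inter_right _ inter_subset_left)).sub
          (dg2.mono (fun w hw => hw.2.2)), fun w hw => hh2 i w hw.1 hw.2⟩
  · rintro i j z hi hj (hz | hz)
    · rw [hh1 i z hz, hh1 j z hz, ea1 i j z hi hj hz.1]; ring
    · rw [hh2 i z hi hz, hh2 j z hj hz, ea2 i j z hi hj hz.1]; ring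

lemma Cous_of_H1 {K1 K2 : Set X} (h1 : IsCompact K1) (h2 : IsCompact K2) (h : H1 (K1 ∪ K2)) :
    Cous K1 K2 := by
  intro N c oN hN hc
  obtain ⟨V1, V2, o1, o2, k1, k2, hV⟩ := shrink2 h1 h2 oN hN
  let U : Bool → Set X := fun b => if b then V1 else V2
  let g : Bool → Bool → X → ℂ := fun b b' z =>
    if b = b' then 0 else if b then c z else - c z
  have hU : ∀ b, IsOpen (U b) := by rintro (_|_) <;> simpa [U]
  have hcov : K1 ∪ K2 ⊆ ⋃ i, U i := by
    rintro z (hz | hz)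
    · exact mem_iUnion.2 ⟨true, k1 hz⟩
    · exact mem_iUnion.2 ⟨false, k2 hz⟩
  have hcoc : IsCoc U g := by
    constructor
    · rintro (_|_) (_|_)
      · simp [g]
      · simpa [g, U] using (hc.mono (by rw [inter_comm]; exact hV)).neg
      · simpa [g, U] using (hc.mono hV)
      · simp [g]
    · rintro (_|_) (_|_) (_|_) z _ _ _ <;> simp [g]
  obtain ⟨V, oV, kV, a, da, ea⟩ := h Bool U g hU hcov hcoc
  refine ⟨V1 ∩ V, V2 ∩ V, a true, a false, o1.inter oV, o2.inter oV,
    fun z hz => ⟨k1 hz, kV (Or.inl hz)⟩, fun z hz => ⟨k2 hz, kV (Or.inr hz)⟩,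
    fun z hz => hV ⟨hz.1.1, hz.2.1⟩, da true, da false, ?_⟩
  rintro z ⟨hz1, hz2⟩
  simpa [g] using ea true false z hz1.1 hz2.1 hz1.2

lemma Cous_of_empty_left {K1 K2 : Set X} (h : K1 = ∅) : Cous K1 K2 := by
  intro N c _ _ _
  exact ⟨∅, univ, 0, 0, isOpen_empty, isOpen_univ, by rw [h], subset_univ _, by simp,
    by simp, differentiableOn_const _, by simp⟩

lemma Cous_of_empty_right {K1 K2 : Set X} (h : K2 = ∅) : Cous K1 K2 := by
  intro N c _ _ _
  exact ⟨univ, ∅, 0, 0, isOpen_univ, isOpen_empty, subset_univ _, by rw [h], by simp,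
    differentiableOn_const _, by simp, by simp⟩
end H1defs

section boxes
variable {κ : Type*} 

def lc (i : κ × Bool) (z : κ → ℂ) : ℝ := if i.2 then (z i.1).re else (z i.1).im

@[simp] lemma lc_true (k : κ) (z : κ → ℂ) : lc (k, true) z = (z k).re := rfl
@[simp] lemma lc_false (k : κ) (z : κ → ℂ) : lc (k, false) z = (z k).im := rfl

@[fun_prop]
lemma continuous_lc (i : κ × Bool) : Continuous (lc i) := by
  obtain ⟨k, b⟩ := i
  cases b
  · exact Complex.continuous_im.comp (continuous_apply k)
  · exact Complex.continuous_re.comp (continuous_apply k)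

def box (lo hi : κ × Bool → ℝ) : Set (κ → ℂ) := {z | ∀ i, lo i ≤ lc i z ∧ lc i z ≤ hi i}

lemma isClosed_box (lo hi : κ × Bool → ℝ) : IsClosed (box lo hi) := by
  have : box lo hi = ⋂ i, {z | lo i ≤ lc i z} ∩ {z | lc i z ≤ hi i} := by
    ext z; simp [box]
  rw [this]
  exact isClosed_iInter fun i => (isClosed_le continuous_const (continuous_lc i)).inter
    (isClosed_le (continuous_lc i) continuous_const)

lemma isCompact_box (lo hi : κ × Bool → ℝ) : IsCompact (box lo hi) := by
  have : box lo hi ⊆ Set.pi univ (fun k => Icc (lo (k,true)) (hi (k,true)) ×ℂ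
      Icc (lo (k,false)) (hi (k,false))) := by
    intro z hz k _
    exact ⟨hz (k, true), hz (k, false)⟩
  exact (isCompact_univ_pi fun k => isCompact_Icc.reProdIm isCompact_Icc).of_isClosed_subset
    (isClosed_box _ _) this

lemma box_fat [Finite κ] {lo hi : κ × Bool → ℝ} {N : Set (κ → ℂ)} (hN : IsOpen N) (h : box lo hi ⊆ N) :
    ∃ η > 0, box (fun i => lo i - η) (fun i => hi i + η) ⊆ N := by
  let V : ℕ → Set (κ → ℂ) := fun n => box (fun i => lo i - 1/((n:ℝ)+1)) (fun i => hi i + 1/((n:ℝ)+1))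
  have hanti : Antitone V := by
    intro m n hmn z hz i
    have h1 := hz i
    have h2 : 1/((n:ℝ)+1) ≤ 1/((m:ℝ)+1) := Nat.one_div_le_one_div hmn
    constructor <;> linarith
  obtain ⟨n, hn⟩ := exists_subset_nhds_of_isCompact' (V := V) hanti.directed_ge
    (fun n => isCompact_box _ _) (fun n => isClosed_box _ _) (U := N) (by
      intro z hz
      apply hN.mem_nhds
      apply h
      intro i
      have h1 : ∀ n : ℕ, lo i - 1/((n:ℝ)+1) ≤ lc i z ∧ lc i z ≤ hi i + 1/((n:ℝ)+1) := fun n =>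
        mem_iInter.1 hz n i
      have hl := tendsto_one_div_add_atTop_nhds_zero_nat (𝕜 := ℝ)
      constructor
      · have := hl.const_sub (lo i)
        rw [sub_zero] at this
        exact le_of_tendsto' this (fun n => (h1 n).1)
      · have := hl.const_add (hi i)
        rw [add_zero] at this
        exact ge_of_tendsto' this (fun n => (h1 n).2))
  exact ⟨1/((n:ℝ)+1), by positivity, hn⟩

variable [Fintype κ] [DecidableEq κ]

lemma side_diff {N O : Set (κ → ℂ)} (hO : IsOpen O) {c : (κ → ℂ) → ℂ}
    (hc : DifferentiableOn ℂ c N) (k : κ) (p q : ℂ) (a b : ℝ)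
    (h1 : ∀ z ∈ O, ∀ t ∈ uIcc a b, Function.update z k (p + t * q) ∈ N)
    (h2 : ∀ z ∈ O, ∀ t ∈ uIcc a b, p + t * q ≠ z k) :
    DifferentiableOn ℂ (fun z => ∫ t in a..b,
      c (Function.update z k (p + t * q)) / (p + t * q - z k)) O := by
  apply diffOn_integral hO
  · apply ContinuousOn.div
    · refine hc.continuousOn.comp (t := N) ?_ (fun x hx => h1 x.2 hx.2 x.1 hx.1)
      apply Continuous.continuousOn
      exact continuous_snd.update k (by fun_prop)
    · fun_prop
    · intro x hx
      exact sub_ne_zero.2 (h2 x.2 hx.2 x.1 hx.1)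
  · intro t ht
    apply diffOn_div
    · refine hc.comp (t := N) ?_ (fun x hx => h1 x hx t ht)
      apply Differentiable.differentiableOn
      rw [differentiable_pi]
      intro j
      by_cases hj : j = k
      · subst hj; simp
      · simp only [Function.update_of_ne hj]; fun_prop
    · fun_prop
    · intro x hx
      exact sub_ne_zero.2 (h2 x hx t ht)

set_option maxHeartbeats 1000000 in
open Complex in
lemma rect_Cous (lo hi : κ × Bool → ℝ) (i : κ × Bool) (a : ℝ) :
    Cous (box lo hi ∩ {z | lc i z ≤ a}) (box lo hi ∩ {z | a ≤ lc i z}) := by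
  by_cases ha1 : a < lo i
  · apply Cous_of_empty_left
    ext z
    simp only [mem_inter_iff, mem_ofPred_eq, mem_empty_iff_false, iff_false, not_and, not_le]
    intro hz; exact ha1.trans_le (hz i).1
  by_cases ha2 : hi i < a
  · apply Cous_of_empty_right
    ext z
    simp only [mem_inter_iff, mem_ofPred_eq, mem_empty_iff_false, iff_false, not_and, not_le]
    intro hz; exact (hz i).2.trans_lt ha2
  push Not at ha1 ha2
  intro N c oN hN hc
  have hsub : box (Function.update lo i a) (Function.update hi i a) ⊆ N := by
    refine Subset.trans ?_ hN
    intro z hz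
    have h1 := hz i
    simp only [Function.update_self] at h1
    have hb : z ∈ box lo hi := by
      intro j
      by_cases hj : j = i
      · subst hj; constructor <;> linarith
      · have := hz j
        simpa only [Function.update_of_ne hj] using this
    exact ⟨⟨hb, h1.2⟩, ⟨hb, h1.1⟩⟩
  obtain ⟨η, hη, hfat⟩ := box_fat oN hsub
  set lo' : κ × Bool → ℝ := fun j => Function.update lo i a j - η with hlo'
  set hi' : κ × Bool → ℝ := fun j => Function.update hi i a j + η with hhi'
  have elo : lo' i = a - η := by simp [hlo']
  have ehi : hi' i = a + η := by simp [hhi']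
  have elo' : ∀ j, j ≠ i → lo' j = lo j - η := fun j hj => by simp [hlo', Function.update_of_ne hj]
  have ehi' : ∀ j, j ≠ i → hi' j = hi j + η := fun j hj => by simp [hhi', Function.update_of_ne hj]
  obtain ⟨k, b⟩ := i
  set x0 := lo' (k, true)
  set x1 := hi' (k, true)
  set y0 := lo' (k, false)
  set y1 := hi' (k, false)
  let D : Set (κ → ℂ) := {z | ∀ j : κ × Bool, j.1 ≠ k → lo' j < lc j z ∧ lc j z < hi' j}
  have oD : IsOpen D := by
    have : D = ⋂ j : κ × Bool, {z | j.1 ≠ k → lo' j < lc j z ∧ lc j z < hi' j} := by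
      ext z; simp [D]
    rw [this]
    refine isOpen_iInter_of_finite fun j => ?_
    by_cases hj : j.1 = k
    · simp [hj]
    · simp only [ne_eq, hj, not_false_eq_true, forall_const]
      exact (isOpen_lt continuous_const (continuous_lc j)).inter
        (isOpen_lt (continuous_lc j) continuous_const)
  have hDN : ∀ z ∈ D, ∀ w : ℂ, x0 ≤ w.re → w.re ≤ x1 → y0 ≤ w.im → w.im ≤ y1 →
      Function.update z k w ∈ N := by
    intro z hz w h1 h2 h3 h4
    apply hfat
    rintro ⟨j, b'⟩
    by_cases hj : j = k
    · subst hj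
      cases b'
      · simpa using ⟨h3, h4⟩
      · simpa using ⟨h1, h2⟩
    · have := hz (j, b') hj
      cases b'
      · simp only [lc_false, Function.update_of_ne hj] at this ⊢
        exact ⟨this.1.le, this.2.le⟩
      · simp only [lc_true, Function.update_of_ne hj] at this ⊢
        exact ⟨this.1.le, this.2.le⟩
  have oRe : ∀ r : ℝ, IsOpen {z : κ → ℂ | r < (z k).re} := fun r => isOpen_lt continuous_const (by fun_prop)
  have oRe' : ∀ r : ℝ, IsOpen {z : κ → ℂ | (z k).re < r} := fun r => isOpen_lt (by fun_prop) continuous_const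
  have oIm : ∀ r : ℝ, IsOpen {z : κ → ℂ | r < (z k).im} := fun r => isOpen_lt continuous_const (by fun_prop)
  have oIm' : ∀ r : ℝ, IsOpen {z : κ → ℂ | (z k).im < r} := fun r => isOpen_lt (by fun_prop) continuous_const
  let J : ℂ → ℂ → ℝ → ℝ → (κ → ℂ) → ℂ := fun p q a b z => ∫ t in a..b,
      c (Function.update z k (p + t * q)) / (p + t * q - z k)
  have hJ : x0 ≤ x1 → y0 ≤ y1 → 
      DifferentiableOn ℂ (J (y0 * I) 1 x0 x1) (D ∩ {z | y0 < (z k).im}) ∧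
      DifferentiableOn ℂ (J (y1 * I) 1 x0 x1) (D ∩ {z | (z k).im < y1}) ∧
      DifferentiableOn ℂ (J x1 I y0 y1) (D ∩ {z | (z k).re < x1}) ∧
      DifferentiableOn ℂ (J x0 I y0 y1) (D ∩ {z | x0 < (z k).re}) := by
    intro hx hy
    refine ⟨?_, ?_, ?_, ?_⟩
    · apply side_diff (oD.inter (oIm _)) hc
      · intro z hz t ht
        rw [uIcc_of_le hx] at ht
        apply hDN z hz.1 <;> simp <;> linarith [ht.1, ht.2]
      · intro z hz t ht h
        have := congrArg Complex.im h
        simp at this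
        exact absurd this hz.2.ne
    · apply side_diff (oD.inter (oIm' _)) hc
      · intro z hz t ht
        rw [uIcc_of_le hx] at ht
        apply hDN z hz.1 <;> simp <;> linarith [ht.1, ht.2]
      · intro z hz t ht h
        have := congrArg Complex.im h
        simp at this
        exact absurd this hz.2.ne'
    · apply side_diff (oD.inter (oRe' _)) hc
      · intro z hz t ht
        rw [uIcc_of_le hy] at ht
        apply hDN z hz.1 <;> simp <;> linarith [ht.1, ht.2]
      · intro z hz t ht h
        have := congrArg Complex.re h
        simp at this
        exact absurd this hz.2.ne'
    · apply side_diff (oD.inter (oRe _)) hc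
      · intro z hz t ht
        rw [uIcc_of_le hy] at ht
        apply hDN z hz.1 <;> simp <;> linarith [ht.1, ht.2]
      · intro z hz t ht h
        have := congrArg Complex.re h
        simp at this
        exact absurd this hz.2.ne
  have hCau : ∀ z ∈ D, x0 < (z k).re → (z k).re < x1 → y0 < (z k).im → (z k).im < y1 →
      c z = (J (y0 * I) 1 x0 x1 z - J (y1 * I) 1 x0 x1 z + I * J x1 I y0 y1 z
        - I * J x0 I y0 y1 z) / (2 * Real.pi * I) := by
    intro z hz h0 h1 h2 h3
    have hx : x0 ≤ x1 := by linarith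
    have hy : y0 ≤ y1 := by linarith
    have hupd : Continuous (fun w : ℂ => Function.update z k w) := by fun_prop
    have hdu : Differentiable ℂ (fun w : ℂ => Function.update z k w) := by
      rw [differentiable_pi]
      intro j
      by_cases hj : j = k
      · subst hj; simp
      · simp [Function.update_of_ne hj]
    have := rect_cauchy h0 h1 h2 h3 (f := fun w => c (Function.update z k w))
      (W := (fun w : ℂ => Function.update z k w) ⁻¹' N) (oN.preimage hupd)
      (hc.comp hdu.differentiableOn (fun w hw => hw)) (by
        intro w hw
        rw [uIcc_of_le hx, uIcc_of_le hy] at hw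
        exact hDN z hz w hw.1.1 hw.1.2 hw.2.1 hw.2.2)
    simp only [Function.update_eq_self] at this
    have h2pi : (2 * Real.pi * I : ℂ) ≠ 0 := Complex.two_pi_I_ne_zero
    rw [eq_div_iff h2pi, mul_comm, ← this]
    simp only [rectInt, J, mul_one, add_comm ((y0:ℂ) * I), add_comm ((y1:ℂ) * I)]
  have hbx : ∀ z ∈ D, x0 < (z k).re → (z k).re < x1 → y0 < (z k).im → (z k).im < y1 → z ∈ N := by
    intro z hz h0 h1 h2 h3
    have := hDN z hz (z k) h0.le h1.le h2.le h3.le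
    simpa using this
  have hKD : box lo hi ⊆ D := by
    intro z hz j hj
    have hji : j ≠ (k, b) := by rintro rfl; exact hj rfl
    rw [elo' j hji, ehi' j hji]
    have := hz j
    constructor <;> linarith
  have hemp : ¬ (x0 ≤ x1 ∧ y0 ≤ y1) → box lo hi = ∅ := by
    intro h
    by_contra hne
    obtain ⟨z, hz⟩ := nonempty_iff_ne_empty.2 hne
    apply h
    have h1 := hz (k, true)
    have h2 := hz (k, false)
    cases b
    · have e1 := elo' (k, true) (by simp)
      have e2 := ehi' (k, true) (by simp)
      constructor <;> linarith
    · have e1 := elo' (k, false) (by simp)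
      have e2 := ehi' (k, false) (by simp)
      constructor <;> linarith
  by_cases hxy : ¬ (x0 ≤ x1 ∧ y0 ≤ y1)
  · exact Cous_of_empty_left (by rw [hemp hxy]; simp) N c oN hN hc
  push Not at hxy
  obtain ⟨d1, d2, d3, d4⟩ := hJ hxy.1 hxy.2
  cases b
  · -- imaginary cut
    have e1 : y0 = a - η := elo
    have e2 : y1 = a + η := ehi
    have e3 : x0 = lo (k, true) - η := elo' _ (by simp)
    have e4 : x1 = hi (k, true) + η := ehi' _ (by simp)
    refine ⟨D ∩ ({z | x0 < (z k).re} ∩ {z | (z k).re < x1} ∩ {z | (z k).im < y1}),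
      D ∩ ({z | x0 < (z k).re} ∩ {z | (z k).re < x1} ∩ {z | y0 < (z k).im}), 
      fun z => (- J (y1 * I) 1 x0 x1 z + I * J x1 I y0 y1 z
        - I * J x0 I y0 y1 z) / (2 * Real.pi * I),
      fun z => (- J (y0 * I) 1 x0 x1 z) / (2 * Real.pi * I), 
      oD.inter (((oRe _).inter (oRe' _)).inter (oIm' _)),
      oD.inter (((oRe _).inter (oRe' _)).inter (oIm _)), ?_, ?_, ?_, ?_, ?_, ?_⟩
    · rintro z ⟨hz, hza⟩
      have := hz (k, true)
      simp only [mem_ofPred_eq, lc_false, lc_true] at hza this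
      refine ⟨hKD hz, ⟨?_, ?_⟩, ?_⟩ <;> simp only [mem_ofPred_eq] <;> linarith
    · rintro z ⟨hz, hza⟩
      have := hz (k, true)
      simp only [mem_ofPred_eq, lc_false, lc_true] at hza this
      refine ⟨hKD hz, ⟨?_, ?_⟩, ?_⟩ <;> simp only [mem_ofPred_eq] <;> linarith
    · rintro z ⟨⟨hz, ⟨h1, h2⟩, h3⟩, _, _, h4⟩
      exact hbx z hz h1 h2 h4 h3
    · apply diffOn_divc
      refine ((d2.mono ?_).neg.add ((d3.mono ?_).const_mul I)).sub ((d4.mono ?_).const_mul I)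
      · exact fun z hz => ⟨hz.1, hz.2.2⟩
      · exact fun z hz => ⟨hz.1, hz.2.1.2⟩
      · exact fun z hz => ⟨hz.1, hz.2.1.1⟩
    · apply diffOn_divc
      exact (d1.mono fun z hz => ⟨hz.1, hz.2.2⟩).neg
    · rintro z ⟨⟨hz, ⟨h1, h2⟩, h3⟩, _, _, h4⟩
      rw [hCau z hz h1 h2 h4 h3]; ring
  · have e1 : x0 = a - η := elo
    have e2 : x1 = a + η := ehi
    have e3 : y0 = lo (k, false) - η := elo' _ (by simp)
    have e4 : y1 = hi (k, false) + η := ehi' _ (by simp)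
    refine ⟨D ∩ ({z | y0 < (z k).im} ∩ {z | (z k).im < y1} ∩ {z | (z k).re < x1}),
      D ∩ ({z | y0 < (z k).im} ∩ {z | (z k).im < y1} ∩ {z | x0 < (z k).re}), 
      fun z => (J (y0 * I) 1 x0 x1 z - J (y1 * I) 1 x0 x1 z + I * J x1 I y0 y1 z)
        / (2 * Real.pi * I),
      fun z => (I * J x0 I y0 y1 z) / (2 * Real.pi * I), 
      oD.inter (((oIm _).inter (oIm' _)).inter (oRe' _)),
      oD.inter (((oIm _).inter (oIm' _)).inter (oRe _)), ?_, ?_, ?_, ?_, ?_, ?_⟩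
    · rintro z ⟨hz, hza⟩
      have := hz (k, false)
      simp only [mem_ofPred_eq, lc_false, lc_true] at hza this
      refine ⟨hKD hz, ⟨?_, ?_⟩, ?_⟩ <;> simp only [mem_ofPred_eq] <;> linarith
    · rintro z ⟨hz, hza⟩
      have := hz (k, false)
      simp only [mem_ofPred_eq, lc_false, lc_true] at hza this
      refine ⟨hKD hz, ⟨?_, ?_⟩, ?_⟩ <;> simp only [mem_ofPred_eq] <;> linarith
    · rintro z ⟨⟨hz, ⟨h1, h2⟩, h3⟩, _, _, h4⟩
      exact hbx z hz h4 h3 h1 h2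
    · apply diffOn_divc
      refine ((d1.mono ?_).sub (d2.mono ?_)).add ((d3.mono ?_).const_mul I)
      · exact fun z hz => ⟨hz.1, hz.2.1.1⟩
      · exact fun z hz => ⟨hz.1, hz.2.1.2⟩
      · exact fun z hz => ⟨hz.1, hz.2.2⟩
    · apply diffOn_divc
      exact (d4.mono fun z hz => ⟨hz.1, hz.2.2⟩).const_mul I
    · rintro z ⟨⟨hz, ⟨h1, h2⟩, h3⟩, _, _, h4⟩
      rw [hCau z hz h4 h3 h1 h2]; ring

end boxes

section poly

lemma box_induction {κ : Type*} [Finite κ] [DecidableEq κ]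
    (Pr : (κ × Bool → ℝ) → (κ × Bool → ℝ) → Prop) {δ : ℝ} (hδ : 0 < δ)
    (tiny : ∀ lo hi, (∀ i, hi i - lo i ≤ δ) → Pr lo hi)
    (glue : ∀ lo hi i a, lo i ≤ a → a ≤ hi i → Pr lo (Function.update hi i a) →
      Pr (Function.update lo i a) hi → Pr lo hi) : ∀ lo hi, Pr lo hi := by
  have := Fintype.ofFinite κ
  have key : ∀ s : Finset (κ × Bool), ∀ lo hi, (∀ i, i ∉ s → hi i - lo i ≤ δ) → Pr lo hi := by
    intro s
    induction s using Finset.induction_on with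
    | empty => intro lo hi h; exact tiny lo hi (fun i => h i (by simp))
    | insert i s his ih =>
      have h2 : ∀ n : ℕ, ∀ lo hi, (∀ j, j ∉ insert i s → hi j - lo j ≤ δ) →
          hi i - lo i ≤ 2 ^ n * δ → Pr lo hi := by
        intro n
        induction n with
        | zero =>
          intro lo hi h hn
          apply ih
          intro j hj
          by_cases hji : j = i
          · subst hji; simpa using hn
          · exact h j (by simp [hji, hj])
        | succ n ihn =>
          intro lo hi h hn
          by_cases hle : hi i - lo i ≤ δ
          · apply ih
            intro j hj
            by_cases hji : j = i
            · subst hji; exact hle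
            · exact h j (by simp [hji, hj])
          · push Not at hle
            rw [pow_succ] at hn
            apply glue lo hi i ((lo i + hi i)/2) (by linarith) (by linarith)
            · apply ihn
              · intro j hj
                have hji : j ≠ i := by rintro rfl; simp at hj
                rw [Function.update_of_ne hji]; exact h j hj
              · rw [Function.update_self]; linarith
            · apply ihn
              · intro j hj
                have hji : j ≠ i := by rintro rfl; simp at hj
                rw [Function.update_of_ne hji]; exact h j hj
              · rw [Function.update_self]; linarith
      intro lo hi h
      obtain ⟨n, hn⟩ := pow_unbounded_of_one_lt ((hi i - lo i)/δ) (one_lt_two)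
      exact h2 n lo hi h (by rw [div_lt_iff₀ hδ] at hn; exact hn.le)
  intro lo hi
  exact key Finset.univ lo hi (by simp)

lemma box_upd_hi {κ : Type*} [DecidableEq κ] {lo hi : κ × Bool → ℝ} {i : κ × Bool} {a : ℝ}
    (h : a ≤ hi i) : box lo (Function.update hi i a) = box lo hi ∩ {z | lc i z ≤ a} := by
  ext z
  constructor
  · intro hz
    have hi1 := hz i
    rw [Function.update_self] at hi1
    refine ⟨fun j => ?_, hi1.2⟩
    by_cases hj : j = i
    · subst hj; exact ⟨hi1.1, hi1.2.trans h⟩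
    · have := hz j; rwa [Function.update_of_ne hj] at this
  · rintro ⟨hz, hza⟩ j
    by_cases hj : j = i
    · subst hj; rw [Function.update_self]; exact ⟨(hz j).1, hza⟩
    · rw [Function.update_of_ne hj]; exact hz j

lemma box_upd_lo {κ : Type*} [DecidableEq κ] {lo hi : κ × Bool → ℝ} {i : κ × Bool} {a : ℝ}
    (h : lo i ≤ a) : box (Function.update lo i a) hi = box lo hi ∩ {z | a ≤ lc i z} := by
  ext z
  constructor
  · intro hz
    have hi1 := hz i
    rw [Function.update_self] at hi1
    refine ⟨fun j => ?_, hi1.1⟩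
    by_cases hj : j = i
    · subst hj; exact ⟨h.trans hi1.1, hi1.2⟩
    · have := hz j; rwa [Function.update_of_ne hj] at this
  · rintro ⟨hz, hza⟩ j
    by_cases hj : j = i
    · subst hj; rw [Function.update_self]; exact ⟨hza, (hz j).2⟩
    · rw [Function.update_of_ne hj]; exact hz j

lemma box_small {κ : Type*} [Fintype κ] {lo hi : κ × Bool → ℝ} {δ : ℝ} (hδ : 0 ≤ δ)
    (h : ∀ i, hi i - lo i ≤ δ) {z w : κ → ℂ} (hz : z ∈ box lo hi) (hw : w ∈ box lo hi) :
    dist z w ≤ 2 * δ := by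
  rw [dist_pi_le_iff (by positivity)]
  intro k
  rw [Complex.dist_eq]
  refine (Complex.norm_le_abs_re_add_abs_im _).trans ?_
  have h1 := hz (k, true)
  have h2 := hw (k, true)
  have h3 := hz (k, false)
  have h4 := hw (k, false)
  have h5 := h (k, true)
  have h6 := h (k, false)
  simp only [lc_true, lc_false] at *
  have a1 : |(z k - w k).re| ≤ δ := by rw [Complex.sub_re, abs_le]; constructor <;> linarith
  have a2 : |(z k - w k).im| ≤ δ := by rw [Complex.sub_im, abs_le]; constructor <;> linarith
  linarith

def Sq : Set ℂ := {w | |w.re| ≤ 1 ∧ |w.im| ≤ 1}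

lemma isClosed_Sq : IsClosed Sq :=
  (isClosed_le (Complex.continuous_re.abs) continuous_const).inter
    (isClosed_le (Complex.continuous_im.abs) continuous_const)

def PolyH1 (m : ℕ) : Prop := ∀ (κ : Type) [Fintype κ] [DecidableEq κ] (lo hi : κ × Bool → ℝ)
  (U : Set (κ → ℂ)) (f : Fin m → (κ → ℂ) → ℂ), IsOpen U → box lo hi ⊆ U →
  (∀ j, DifferentiableOn ℂ (f j) U) → H1 {z ∈ box lo hi | ∀ j, f j z ∈ Sq}

def CutCous (m : ℕ) : Prop := ∀ (κ : Type) [Fintype κ] [DecidableEq κ] (lo hi : κ × Bool → ℝ)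
  (U : Set (κ → ℂ)) (f : Fin m → (κ → ℂ) → ℂ), IsOpen U → box lo hi ⊆ U →
  (∀ j, DifferentiableOn ℂ (f j) U) → ∀ i a,
  Cous ({z ∈ box lo hi | ∀ j, f j z ∈ Sq} ∩ {z | lc i z ≤ a})
    ({z ∈ box lo hi | ∀ j, f j z ∈ Sq} ∩ {z | a ≤ lc i z})

lemma isCompact_poly {κ : Type*} [Fintype κ] {m : Type*} {lo hi : κ × Bool → ℝ}
    {U : Set (κ → ℂ)} {f : m → (κ → ℂ) → ℂ} (hU : box lo hi ⊆ U)
    (hf : ∀ j, DifferentiableOn ℂ (f j) U) : IsCompact {z ∈ box lo hi | ∀ j, f j z ∈ Sq} := by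
  have : {z ∈ box lo hi | ∀ j, f j z ∈ Sq} = box lo hi ∩ ⋂ j, (box lo hi ∩ f j ⁻¹' Sq) := by
    ext z; simp only [mem_inter_iff, mem_iInter, mem_preimage, mem_ofPred_eq]
    constructor
    · rintro ⟨h1, h2⟩; exact ⟨h1, fun j => ⟨h1, h2 j⟩⟩
    · rintro ⟨h1, h2⟩; exact ⟨h1, fun j => (h2 j).2⟩
  rw [this]
  apply (isCompact_box lo hi).inter_right
  exact isClosed_iInter fun j =>
    ((hf j).continuousOn.mono hU).preimage_isClosed_of_isClosed (isClosed_box _ _) isClosed_Sq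

lemma polyH1_of_cutCous {m : ℕ} (h : CutCous m) : PolyH1 m := by
  intro κ _ _ lo hi O f oO hO hf ι U g hU hK hg
  have hcomp := isCompact_poly hO hf
  obtain ⟨δ, hδ, hleb⟩ := lebesgue_number_lemma_of_metric hcomp hU hK
  have main := box_induction (κ := κ) (fun lo' hi' => box lo' hi' ⊆ box lo hi →
    SplitsNear U g {z ∈ box lo' hi' | ∀ j, f j z ∈ Sq}) (δ := δ/3) (by positivity) ?_ ?_ lo hi
    le_rfl
  · exact main
  · intro lo' hi' hsm hsub
    by_cases hne : {z ∈ box lo' hi' | ∀ j, f j z ∈ Sq} = ∅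
    · rw [hne]
      exact ⟨∅, isOpen_empty, le_rfl, fun _ _ => 0, by simp, by simp⟩
    · obtain ⟨z0, hz0⟩ := nonempty_iff_ne_empty.2 hne
      obtain ⟨i, hi⟩ := hleb z0 ⟨hsub hz0.1, hz0.2⟩
      refine ⟨U i, hU i, ?_, hg.splits_of_subset i le_rfl⟩
      intro z hz
      apply hi
      rw [mem_ball]
      have := box_small (by positivity) hsm hz.1 hz0.1
      linarith
  · intro lo' hi' i a hlo hhi h1 h2 hsub
    have e1 := box_upd_hi (lo := lo') hhi
    have e2 := box_upd_lo (hi := hi') hlo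
    have hun : {z ∈ box lo' hi' | ∀ j, f j z ∈ Sq} =
        ({z ∈ box lo' hi' | ∀ j, f j z ∈ Sq} ∩ {z | lc i z ≤ a}) ∪
        ({z ∈ box lo' hi' | ∀ j, f j z ∈ Sq} ∩ {z | a ≤ lc i z}) := by
      rw [← inter_union_distrib_left]
      symm
      apply inter_eq_left.2
      intro z _
      exact le_total (lc i z) a
    have h1' := h1 (by rw [e1]; exact inter_subset_left.trans hsub)
    have h2' := h2 (by rw [e2]; exact inter_subset_left.trans hsub)
    rw [e1] at h1'
    rw [e2] at h2'
    have t : ∀ A : Set (κ → ℂ), {z ∈ box lo' hi' ∩ A | ∀ j, f j z ∈ Sq} =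
      {z ∈ box lo' hi' | ∀ j, f j z ∈ Sq} ∩ A := by
      intro A; ext z; simp only [mem_inter_iff, mem_ofPred_eq]; tauto
    rw [t] at h1' h2'
    rw [hun]
    refine MV hU ?_ h1' h2' (h κ lo' hi' O f oO (hsub.trans hO) hf i a)
    rw [← hun]
    intro z hz
    exact hK ⟨hsub hz.1, hz.2⟩

lemma cutCous_zero : CutCous 0 := by
  intro κ _ _ lo hi O f oO hO hf i a
  have : {z ∈ box lo hi | ∀ j : Fin 0, f j z ∈ Sq} = box lo hi := by ext z; simp
  rw [this]
  exact rect_Cous lo hi i a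

def ins {κ : Type*} (z : κ → ℂ) (w : ℂ) : Option κ → ℂ := fun o => o.elim w z
def prj {κ : Type*} (z : Option κ → ℂ) : κ → ℂ := fun k => z (some k)

@[simp] lemma prj_ins {κ : Type*} (z : κ → ℂ) (w : ℂ) : prj (ins z w) = z := rfl
@[simp] lemma ins_none {κ : Type*} (z : κ → ℂ) (w : ℂ) : ins z w none = w := rfl
@[simp] lemma ins_some {κ : Type*} (z : κ → ℂ) (w : ℂ) (k : κ) : ins z w (some k) = z k := rfl

lemma differentiable_prj {κ : Type*} [Fintype κ] : Differentiable ℂ (prj : (Option κ → ℂ) → κ → ℂ) := by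
  unfold prj; fun_prop

lemma diffOn_ins {κ : Type*} [Fintype κ] {f : (κ → ℂ) → ℂ} {U} (hf : DifferentiableOn ℂ f U) :
    DifferentiableOn ℂ (fun z => ins z (f z)) U := by
  rw [differentiableOn_pi]
  rintro (_ | k)
  · simpa [ins] using hf
  · simp only [ins, Option.elim]; fun_prop

lemma oka_ext {κ : Type} [Fintype κ] {K U N : Set (κ → ℂ)} {f c : (κ → ℂ) → ℂ}
    (oU : IsOpen U) (hKU : K ⊆ U) (hf : DifferentiableOn ℂ f U)
    (hH : H1 {z : Option κ → ℂ | prj z ∈ K ∧ z none ∈ Sq}) (oN : IsOpen N)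
    (hN : ∀ z ∈ K, f z ∈ Sq → z ∈ N) (hc : DifferentiableOn ℂ c N) :
    ∃ (O : Set (Option κ → ℂ)) (G : (Option κ → ℂ) → ℂ), IsOpen O ∧
      {z : Option κ → ℂ | prj z ∈ K ∧ z none ∈ Sq} ⊆ O ∧ DifferentiableOn ℂ G O ∧
      ∀ z, ins z (f z) ∈ O → z ∈ N ∧ G (ins z (f z)) = c z := by
  have cprj := (differentiable_prj (κ := κ)).continuous
  let U1 : Set (Option κ → ℂ) := prj ⁻¹' (N ∩ U)
  let U2 : Set (Option κ → ℂ) := prj ⁻¹' U ∩ {z | z none - f (prj z) ≠ 0}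
  have dF : DifferentiableOn ℂ (fun z : Option κ → ℂ => z none - f (prj z)) (prj ⁻¹' U) := by
    apply DifferentiableOn.sub (by fun_prop)
    exact hf.comp differentiable_prj.differentiableOn (fun z hz => hz)
  have o1 : IsOpen U1 := (oN.inter oU).preimage cprj
  have o2 : IsOpen U2 := dF.continuousOn.isOpen_inter_preimage (oU.preimage cprj) isOpen_ne
  let C : (Option κ → ℂ) → ℂ := fun z => c (prj z) / (z none - f (prj z))
  have hC : DifferentiableOn ℂ C (U1 ∩ U2) := by
    apply diffOn_div
    · exact hc.comp differentiable_prj.differentiableOn (fun z hz => hz.1.1)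
    · exact dF.mono fun z hz => hz.2.1
    · exact fun z hz => hz.2.2
  let UU : Bool → Set (Option κ → ℂ) := fun b => if b then U1 else U2
  let g : Bool → Bool → (Option κ → ℂ) → ℂ := fun b b' z =>
    if b = b' then 0 else if b then C z else - C z
  have hU : ∀ b, IsOpen (UU b) := by rintro (_|_) <;> simpa [UU]
  have hcov : {z : Option κ → ℂ | prj z ∈ K ∧ z none ∈ Sq} ⊆ ⋃ i, UU i := by
    rintro z ⟨hz, hz2⟩
    by_cases h : z none - f (prj z) = 0
    · refine mem_iUnion.2 ⟨true, hN _ hz ?_, hKU hz⟩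
      rwa [← sub_eq_zero.1 h]
    · exact mem_iUnion.2 ⟨false, hKU hz, h⟩
  have hcoc : IsCoc UU g := by
    constructor
    · rintro (_|_) (_|_)
      · simp [g]
      · simpa [g, UU] using (hC.mono (by rw [inter_comm])).neg
      · simpa [g, UU] using hC
      · simp [g]
    · rintro (_|_) (_|_) (_|_) z _ _ _ <;> simp [g]
  obtain ⟨V, oV, kV, a, da, ea⟩ := hH Bool UU g hU hcov hcoc
  classical
  let G : (Option κ → ℂ) → ℂ := fun z =>
    if z ∈ U2 then - (z none - f (prj z)) * a false z else c (prj z) - (z none - f (prj z)) * a true z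
  have hG2 : ∀ z ∈ U2, G z = - (z none - f (prj z)) * a false z := fun z hz => if_pos hz
  have hG1 : ∀ z ∈ U1, z ∈ V → G z = c (prj z) - (z none - f (prj z)) * a true z := by
    intro z hz hV
    by_cases h : z ∈ U2
    · rw [hG2 z h]
      have := ea true false z hz h hV
      simp only [g, C, Bool.true_eq_false, if_true, if_false] at this
      rw [div_eq_iff h.2] at this
      linear_combination -this
    · exact if_neg h
  refine ⟨(U1 ∪ U2) ∩ V, G, (o1.union o2).inter oV, ?_, ?_, ?_⟩
  · intro z hz
    refine ⟨?_, kV hz⟩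
    obtain ⟨b, hb⟩ := mem_iUnion.1 (hcov hz)
    cases b
    · exact Or.inr hb
    · exact Or.inl hb
  · apply diffOn_of_local
    rintro z ⟨hz | hz, hzV⟩
    · refine ⟨U1 ∩ V, _, o1.inter oV, ⟨hz, hzV⟩, ?_, fun w hw => hG1 w hw.1 hw.2⟩
      apply DifferentiableOn.sub
      · exact hc.comp differentiable_prj.differentiableOn (fun z hz => hz.1.1)
      · exact (dF.mono fun z hz => hz.1.2).mul (da true)
    · refine ⟨U2 ∩ V, _, o2.inter oV, ⟨hz, hzV⟩, ?_, fun w hw => hG2 w hw.1⟩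
      exact (dF.mono fun z hz => hz.1.1).neg.mul (da false)
  · rintro z ⟨hz | hz, hzV⟩
    · refine ⟨hz.1, ?_⟩
      rw [hG1 _ hz hzV]
      simp
    · exact absurd (by simp) hz.2

def insLo {κ : Type*} (c : ℝ) (lo : κ × Bool → ℝ) : Option κ × Bool → ℝ := fun i =>
  match i with
  | (none, _) => c
  | (some k, b) => lo (k, b)

lemma mem_box_ins {κ : Type*} {lo hi : κ × Bool → ℝ} {z : Option κ → ℂ} :
    z ∈ box (insLo (-1) lo) (insLo 1 hi) ↔ prj z ∈ box lo hi ∧ z none ∈ Sq := by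
  constructor
  · intro h
    refine ⟨fun ⟨k, b⟩ => ?_, ?_, ?_⟩
    · have := h (some k, b)
      cases b <;> simpa [insLo, prj] using this
    · have := h (none, true); rw [abs_le]; simpa [insLo] using this
    · have := h (none, false); rw [abs_le]; simpa [insLo] using this
  · rintro ⟨h1, h2, h3⟩ ⟨_ | k, b⟩
    · rw [abs_le] at h2 h3
      cases b
      · simpa [insLo] using h3
      · simpa [insLo] using h2
    · have := h1 (k, b)
      cases b <;> simpa [insLo, prj] using this

lemma cutCous_succ {m : ℕ} (h : PolyH1 m) : CutCous (m + 1) := by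
  intro κ _ _ lo hi U f oU hU hf i a N c oN hN hc
  let Kof : (κ × Bool → ℝ) → (κ × Bool → ℝ) → Set (κ → ℂ) := fun lo hi =>
    {z ∈ box lo hi | ∀ j : Fin m, f j.succ z ∈ Sq}
  have cprj := (differentiable_prj (κ := κ)).continuous
  have hset : ∀ lo hi, {z : Option κ → ℂ | prj z ∈ Kof lo hi ∧ z none ∈ Sq} =
      {z ∈ box (insLo (-1) lo) (insLo 1 hi) | ∀ j : Fin m, f j.succ (prj z) ∈ Sq} := by
    intro lo hi
    ext z
    simp only [mem_ofPred_eq, mem_box_ins, Kof]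
    tauto
  have hsubU : ∀ lo' hi', box lo' hi' ⊆ box lo hi → 
      box (insLo (-1) lo') (insLo 1 hi') ⊆ prj ⁻¹' U := by
    intro lo' hi' hs z hz
    exact hU (hs (mem_box_ins.1 hz).1)
  have dfp : ∀ j : Fin m, DifferentiableOn ℂ (fun z : Option κ → ℂ => f j.succ (prj z)) (prj ⁻¹' U) :=
    fun j => (hf j.succ).comp differentiable_prj.differentiableOn (fun z hz => hz)
  have hHH : ∀ lo' hi', box lo' hi' ⊆ box lo hi →
      H1 {z : Option κ → ℂ | prj z ∈ Kof lo' hi' ∧ z none ∈ Sq} := by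
    intro lo' hi' hs
    rw [hset]
    exact h (Option κ) _ _ (prj ⁻¹' U) (fun j z => f j.succ (prj z)) (oU.preimage cprj)
      (hsubU _ _ hs) dfp
  set lo0 : κ × Bool → ℝ := Function.update lo i (max (lo i) a)
  set hi0 : κ × Bool → ℝ := Function.update hi i (min (hi i) a)
  have hbox0 : box lo0 hi0 = box lo hi ∩ {z | lc i z = a} := by
    ext z
    constructor
    · intro hz
      have h1 := hz i
      simp only [lo0, hi0, Function.update_self, max_le_iff, le_min_iff] at h1
      refine ⟨fun j => ?_, le_antisymm h1.2.2 h1.1.2⟩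
      by_cases hj : j = i
      · subst hj; exact ⟨h1.1.1, h1.2.1⟩
      · have := hz j
        simpa only [lo0, hi0, Function.update_of_ne hj] using this
    · rintro ⟨hz, hza⟩ j
      by_cases hj : j = i
      · subst hj
        have := hz j
        simp only [mem_ofPred_eq] at hza
        simp only [lo0, hi0, Function.update_self, max_le_iff, le_min_iff]
        exact ⟨⟨this.1, hza.ge⟩, this.2, hza.le⟩
      · simpa only [lo0, hi0, Function.update_of_ne hj] using hz j
  have hs0 : box lo0 hi0 ⊆ box lo hi := by rw [hbox0]; exact inter_subset_left
  obtain ⟨O, G, oO, hKO, dG, eG⟩ := oka_ext (K := Kof lo0 hi0) (f := f 0) oU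
    (fun z hz => hU (hs0 hz.1)) (hf 0) (hHH _ _ hs0) oN (by
      intro z hz hz0
      have hzb := hz.1
      rw [hbox0] at hzb
      have hall : ∀ j, f j z ∈ Sq := by
        intro j; refine Fin.cases hz0 (fun j => hz.2 j) j
      exact hN ⟨⟨⟨hzb.1, hall⟩, hzb.2.le⟩, ⟨⟨hzb.1, hall⟩, hzb.2.ge⟩⟩) hc
  set KK := {z : Option κ → ℂ | prj z ∈ Kof lo hi ∧ z none ∈ Sq} with hKK
  have hKKc : IsCompact KK := by
    rw [hKK, hset]
    exact isCompact_poly (hsubU _ _ le_rfl) dfp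
  have cl : Continuous fun z : Option κ → ℂ => lc i (prj z) := (continuous_lc i).comp cprj
  have hcous : Cous (KK ∩ {z | lc i (prj z) ≤ a}) (KK ∩ {z | a ≤ lc i (prj z)}) := by
    apply Cous_of_H1
    · exact hKKc.inter_right (isClosed_le cl continuous_const)
    · exact hKKc.inter_right (isClosed_le continuous_const cl)
    · rw [← inter_union_distrib_left]
      rw [inter_eq_left.2]
      · exact hHH _ _ le_rfl
      · intro z _; exact le_total (lc i (prj z)) a
  obtain ⟨N1, N2, g1, g2, oN1, oN2, kN1, kN2, hNN, dg1, dg2, eg⟩ := hcous O G oO (by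
    rintro z ⟨⟨hz, hza⟩, _, hzb⟩
    apply hKO
    refine ⟨⟨?_, hz.1.2⟩, hz.2⟩
    rw [hbox0]
    exact ⟨hz.1.1, le_antisymm hza hzb⟩) dG
  have dI := diffOn_ins (hf 0)
  have oI : ∀ M : Set (Option κ → ℂ), IsOpen M → IsOpen (U ∩ (fun z => ins z (f 0 z)) ⁻¹' M) :=
    fun M hM => dI.continuousOn.isOpen_inter_preimage oU hM
  have hin : ∀ z ∈ {z ∈ box lo hi | ∀ j, f j z ∈ Sq}, ins z (f 0 z) ∈ KK :=
    fun z hz => ⟨⟨hz.1, fun j => hz.2 j.succ⟩, hz.2 0⟩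
  refine ⟨U ∩ (fun z => ins z (f 0 z)) ⁻¹' N1, U ∩ (fun z => ins z (f 0 z)) ⁻¹' N2,
    fun z => g1 (ins z (f 0 z)), fun z => g2 (ins z (f 0 z)), oI _ oN1, oI _ oN2, ?_, ?_, ?_,
    dg1.comp (dI.mono inter_subset_left) (fun z hz => hz.2),
    dg2.comp (dI.mono inter_subset_left) (fun z hz => hz.2), ?_⟩
  · rintro z ⟨hz, hza⟩
    exact ⟨hU hz.1, kN1 ⟨hin z hz, hza⟩⟩
  · rintro z ⟨hz, hza⟩
    exact ⟨hU hz.1, kN2 ⟨hin z hz, hza⟩⟩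
  · rintro z ⟨⟨_, h1⟩, _, h2⟩
    exact (eG z (hNN ⟨h1, h2⟩)).1
  · rintro z ⟨⟨_, h1⟩, _, h2⟩
    rw [← (eG z (hNN ⟨h1, h2⟩)).2]
    exact eg _ ⟨h1, h2⟩

theorem polyH1_all (m : ℕ) : PolyH1 m := by
  induction m with
  | zero => exact polyH1_of_cutCous cutCous_zero
  | succ m ih => exact polyH1_of_cutCous (cutCous_succ ih)

end poly

section LL
variable {κ : Type} [Fintype κ] [DecidableEq κ]

lemma LL {lo hi : κ × Bool → ℝ} {U K : Set (κ → ℂ)} (oU : IsOpen U) (hQ : box lo hi ⊆ U)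
    (hK : K ⊆ box lo hi)
    (h : ∀ w ∈ box lo hi, w ∉ K → ∃ F : (κ → ℂ) → ℂ, DifferentiableOn ℂ F U ∧
      (∀ z ∈ K, (F z).re ≤ 0) ∧ 0 < (F w).re) : H1 K := by
  apply H1_of_basis
  intro O oO hO
  have cp : IsCompact (box lo hi \ O) := (isCompact_box lo hi).diff oO
  have h' : ∀ w ∈ box lo hi \ O, ∃ F : (κ → ℂ) → ℂ, DifferentiableOn ℂ F U ∧
      (∀ z ∈ K, (F z).re ≤ 0) ∧ 0 < (F w).re :=
    fun w hw => h w hw.1 (fun hh => hw.2 (hO hh))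
  choose! F dF F0 F1 using h'
  have cF : ∀ w ∈ box lo hi \ O, ContinuousOn (fun z => (F w z).re) U := fun w hw =>
    Complex.continuous_re.comp_continuousOn (dF w hw).continuousOn
  obtain ⟨t, hcov⟩ := cp.elim_nhds_subcover' (fun w _ => U ∩ {z | 0 < (F w z).re})
    (fun w hw => ((cF w hw).isOpen_inter_preimage oU isOpen_Ioi).mem_nhds ⟨hQ hw.1, F1 w hw⟩)
  have hbd : ∃ M > 0, ∀ w : t, ∀ z ∈ box lo hi, ‖F w.1 z‖ ≤ M := by
    have : ∀ w : t, ∃ M, ∀ z ∈ box lo hi, ‖F w.1 z‖ ≤ M := fun w =>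
      (isCompact_box lo hi).exists_bound_of_continuousOn ((dF w.1 w.1.2).continuousOn.mono hQ)
    choose M hM using this
    refine ⟨∑ w : t, |M w| + 1, by positivity, fun w z hz => (hM w z hz).trans ?_⟩
    have := Finset.single_le_sum (f := fun w => |M w|) (fun i _ => abs_nonneg _) (Finset.mem_univ w)
    have := le_abs_self (M w)
    linarith
  obtain ⟨M, M0, hM⟩ := hbd
  let e := t.equivFin
  let f : Fin t.card → (κ → ℂ) → ℂ := fun j z => 1 + F (e.symm j).1 z / M
  have hf : ∀ j, DifferentiableOn ℂ (f j) U := fun j =>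
    (differentiableOn_const _).add (diffOn_divc (dF _ (e.symm j).1.2))
  have key : ∀ j, ∀ z ∈ box lo hi, (f j z ∈ Sq ↔ (F (e.symm j).1 z).re ≤ 0) := by
    intro j z hz
    have hb := hM (e.symm j) z hz
    have h1 := Complex.abs_re_le_norm (F (e.symm j).1 z)
    have h2 := Complex.abs_im_le_norm (F (e.symm j).1 z)
    have re : (f j z).re = 1 + (F (e.symm j).1 z).re / M := by simp [f, Complex.div_ofReal_re]
    have im : (f j z).im = (F (e.symm j).1 z).im / M := by simp [f, Complex.div_ofReal_im]
    change (|(f j z).re| ≤ 1 ∧ |(f j z).im| ≤ 1) ↔ _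
    rw [re, im]
    rw [abs_le] at h1 h2
    have a1 : (F (e.symm j).1 z).im / M ≤ 1 := by rw [div_le_one M0]; linarith
    have a2 : -1 ≤ (F (e.symm j).1 z).im / M := by rw [le_div_iff₀ M0]; linarith
    have a3 : -1 ≤ (F (e.symm j).1 z).re / M := by rw [le_div_iff₀ M0]; linarith
    constructor
    · rintro ⟨q, _⟩
      rw [abs_le] at q
      have : (F (e.symm j).1 z).re / M ≤ 0 := by linarith
      by_contra hc
      push Not at hc
      have := div_pos hc M0
      linarith
    · intro q
      have : (F (e.symm j).1 z).re / M ≤ 0 := div_nonpos_of_nonpos_of_nonneg q M0.le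
      exact ⟨by rw [abs_le]; constructor <;> linarith, by rw [abs_le]; exact ⟨a2, a1⟩⟩
  refine ⟨{z ∈ box lo hi | ∀ j, f j z ∈ Sq}, ?_, ?_, polyH1_all _ κ lo hi U f oU hQ hf⟩
  · intro z hz
    refine ⟨hK hz, fun j => (key j z (hK hz)).2 (F0 _ (e.symm j).1.2 z hz)⟩
  · rintro z ⟨hz, hj⟩
    by_contra hzO
    have := hcov ⟨hz, hzO⟩
    simp only [mem_iUnion] at this
    obtain ⟨w, hw, _, hw2⟩ := this
    have := (key (e ⟨w, hw⟩) z hz).1 (hj _)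
    simp at this
    change 0 < (F w z).re at hw2
    linarith

/-- holomorphic lower supports -/
def LowerSup (U Q : Set (κ → ℂ)) (σ : (κ → ℂ) → ℝ) : Prop :=
  ∀ w ∈ Q, ∃ F : (κ → ℂ) → ℂ, DifferentiableOn ℂ F U ∧ (F w).re = σ w ∧ ∀ z ∈ Q, (F z).re ≤ σ z

lemma H1_of_lowerSup {lo hi : κ × Bool → ℝ} {U : Set (κ → ℂ)} {σ} (oU : IsOpen U)
    (hQ : box lo hi ⊆ U) (h : LowerSup U (box lo hi) σ) : H1 {z ∈ box lo hi | σ z ≤ 0} := by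
  apply LL oU hQ (fun z hz => hz.1)
  intro w hw hw2
  obtain ⟨F, dF, e, hF⟩ := h w hw
  refine ⟨F, dF, fun z hz => (hF z hz.1).trans hz.2, ?_⟩
  rw [e]
  by_contra hc
  exact hw2 ⟨hw, not_lt.1 hc⟩

def eu (z : κ → ℂ) : ℝ := ∑ k, ‖z k‖ ^ 2

def chi (R : ℝ) (p z : κ → ℂ) : ℝ := (max 0 (R ^ 2 - eu (z - p))) ^ 2

lemma chi_nonneg (R : ℝ) (p z : κ → ℂ) : 0 ≤ chi R p z := sq_nonneg _

lemma continuous_eu : Continuous (eu : (κ → ℂ) → ℝ) := by unfold eu; fun_prop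

lemma continuous_chi (R : ℝ) (p : κ → ℂ) : Continuous (chi R p) := by
  unfold chi
  exact (continuous_const.max (continuous_const.sub (continuous_eu.comp (continuous_id.sub continuous_const)))).pow 2

lemma sq_lower (a b : ℂ) : ‖a‖ ^ 2 = ‖b‖ ^ 2 + (2 * (starRingEnd ℂ b) * (a - b)).re + ‖a - b‖ ^ 2 := by
  rw [← Complex.normSq_eq_norm_sq, ← Complex.normSq_eq_norm_sq, ← Complex.normSq_eq_norm_sq]
  simp [Complex.normSq_apply]
  ring

lemma pos_sq (t t0 : ℝ) : (max 0 t) ^ 2 ≤ (max 0 t0) ^ 2 + 2 * max 0 t0 * (t - t0) + (t - t0) ^ 2 := by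
  rcases le_total 0 t with h | h <;> rcases le_total 0 t0 with h0 | h0 <;>
    simp only [max_eq_left, max_eq_right, h, h0] <;> nlinarith

lemma eu_expand (z w p : κ → ℂ) : eu (z - p) = eu (w - p) +
    (∑ k, 2 * (starRingEnd ℂ (w k - p k)) * (z k - w k)).re + eu (z - w) := by
  unfold eu
  rw [Complex.re_sum, ← Finset.sum_add_distrib, ← Finset.sum_add_distrib]
  apply Finset.sum_congr rfl
  intro k _
  have := sq_lower (z k - p k) (w k - p k)
  simp only [Pi.sub_apply]
  rw [this]
  have : z k - p k - (w k - p k) = z k - w k := by ring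
  rw [this]

lemma eu_nonneg (z : κ → ℂ) : 0 ≤ eu z := Finset.sum_nonneg fun _ _ => sq_nonneg _

/-- quadratic upper bound for `chi` with constant `B` -/
lemma chi_upper {R d : ℝ} {p w : κ → ℂ} (hw : eu (w - p) ≤ d) :
    ∃ A : (κ → ℂ) → ℂ, Differentiable ℂ A ∧ A w = 0 ∧
    ∀ z, eu (z - p) ≤ d → chi R p z ≤ chi R p w + (A z).re + 16 * d * eu (z - w) := by
  let t0 := R ^ 2 - eu (w - p)
  refine ⟨fun z => - (2 * ((max 0 t0 : ℝ) : ℂ)) * ∑ k, 2 * (starRingEnd ℂ (w k - p k)) * (z k - w k), ?_, ?_, ?_⟩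
  · fun_prop
  · simp
  · intro z hz
    have h1 := pos_sq (R ^ 2 - eu (z - p)) t0
    have h2 := eu_expand z w p
    set S := ∑ k, 2 * (starRingEnd ℂ (w k - p k)) * (z k - w k)
    have h3 : (-(2 * ((max 0 t0 : ℝ) : ℂ)) * S).re = -2 * max 0 t0 * S.re := by
      have : (-(2 * ((max 0 t0 : ℝ) : ℂ)) * S) = ((-2 * max 0 t0 : ℝ) : ℂ) * S := by
        push_cast; ring
      rw [this, Complex.re_ofReal_mul]
    have h4 : R ^ 2 - eu (z - p) - t0 = - S.re - eu (z - w) := by simp only [t0]; linarith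
    have hcs : S.re ^ 2 ≤ 4 * d * eu (z - w) := by
      have a1 : |S.re| ≤ ∑ k, 2 * ‖w k - p k‖ * ‖z k - w k‖ := by
        refine (Complex.abs_re_le_norm _).trans ((norm_sum_le _ _).trans (le_of_eq ?_))
        apply Finset.sum_congr rfl; intro k _
        rw [norm_mul, norm_mul, RCLike.norm_conj]; simp
      have a2 : (∑ k, (2 * ‖w k - p k‖) * ‖z k - w k‖) ^ 2 ≤ (∑ k, (2 * ‖w k - p k‖) ^ 2) * eu (z - w) :=
        Finset.sum_mul_sq_le_sq_mul_sq _ _ _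
      have a3 : ∑ k, (2 * ‖w k - p k‖) ^ 2 = 4 * eu (w - p) := by
        unfold eu; rw [Finset.mul_sum]; apply Finset.sum_congr rfl; intro k _
        simp only [Pi.sub_apply]; ring
      rw [a3] at a2
      have a4 : S.re ^ 2 ≤ (∑ k, 2 * ‖w k - p k‖ * ‖z k - w k‖) ^ 2 := by
        rw [← sq_abs]; gcongr
      have := eu_nonneg (z - w)
      nlinarith
    have e0 := eu_nonneg (z - w)
    have hzw : eu (z - w) ≤ 4 * d := by
      have a : ∀ k, ‖z k - w k‖ ^ 2 ≤ 2 * ‖z k - p k‖ ^ 2 + 2 * ‖w k - p k‖ ^ 2 := by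
        intro k
        have : ‖z k - w k‖ ≤ ‖z k - p k‖ + ‖w k - p k‖ := by
          rw [norm_sub_rev (w k)]; exact norm_sub_le_norm_sub_add_norm_sub _ _ _
        nlinarith [norm_nonneg (z k - w k), sq_nonneg (‖z k - p k‖ - ‖w k - p k‖)]
      have : eu (z - w) ≤ 2 * eu (z - p) + 2 * eu (w - p) := by
        unfold eu; rw [Finset.mul_sum, Finset.mul_sum, ← Finset.sum_add_distrib]
        exact Finset.sum_le_sum fun k _ => a k
      linarith
    have d0 : 0 ≤ d := (eu_nonneg _).trans hz
    have h5 : (S.re + eu (z - w)) ^ 2 ≤ 16 * d * eu (z - w) := by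
      nlinarith [sq_nonneg (S.re - eu (z - w))]
    have hm : 0 ≤ max 0 t0 := le_max_left _ _
    unfold chi
    change _ ≤ (max 0 t0) ^ 2 + (-(2 * ((max 0 t0 : ℝ) : ℂ)) * S).re + _
    rw [h3]
    rw [h4] at h1
    nlinarith [mul_nonneg hm e0]

/-- The support functions of `Σ|f_j|² - c - ε Σ χ`. -/
lemma lowerSup_main {m : ℕ} {U Q : Set (κ → ℂ)} {f : Fin m → (κ → ℂ) → ℂ} {τ c d ε R : ℝ}
    {I : Type*} {s : Finset I} {p : I → κ → ℂ}
    (hf : ∀ j, DifferentiableOn ℂ (f j) U)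
    (hτ : ∀ z ∈ Q, ∀ w ∈ Q, τ * eu (z - w) ≤ ∑ j, ‖f j z - f j w‖ ^ 2)
    (hd : ∀ z ∈ Q, ∀ i, eu (z - p i) ≤ d) (hε : 0 ≤ ε) (hεd : ε * (s.card * (16 * d)) ≤ τ) :
    LowerSup U Q (fun z => ∑ j, ‖f j z‖ ^ 2 - c - ε * ∑ i ∈ s, chi R (p i) z) := by
  intro w hw
  have := fun i => chi_upper (R := R) (hd w hw i)
  choose A dA A0 hA using this
  refine ⟨fun z => ((∑ j, ‖f j w‖ ^ 2 - c - ε * ∑ i ∈ s, chi R (p i) w : ℝ) : ℂ) +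
    ∑ j, 2 * (starRingEnd ℂ (f j w)) * (f j z - f j w) - ε * ∑ i ∈ s, A i z, ?_, ?_, ?_⟩
  · apply DifferentiableOn.sub
    · apply (differentiableOn_const _).add
      apply DifferentiableOn.fun_sum
      intro j _
      exact ((hf j).sub_const _).const_mul _
    · apply DifferentiableOn.const_mul
      apply DifferentiableOn.fun_sum
      intro j _
      exact (dA j).differentiableOn
  · simp only [sub_self, mul_zero, A0, Finset.sum_const_zero, add_zero, sub_zero, Complex.ofReal_re]
  · intro z hz
    simp only [Complex.add_re, Complex.sub_re, Complex.ofReal_re, Complex.re_ofReal_mul]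
    rw [Complex.re_sum, Complex.re_sum]
    have e1 : ∑ j, ‖f j z‖ ^ 2 = ∑ j, ‖f j w‖ ^ 2 +
        ∑ j, (2 * (starRingEnd ℂ (f j w)) * (f j z - f j w)).re + ∑ j, ‖f j z - f j w‖ ^ 2 := by
      rw [← Finset.sum_add_distrib, ← Finset.sum_add_distrib]
      exact Finset.sum_congr rfl fun j _ => sq_lower _ _
    have e2 : ∑ i ∈ s, chi R (p i) z ≤ ∑ i ∈ s, chi R (p i) w + ∑ i ∈ s, (A i z).re +
        s.card * (16 * d) * eu (z - w) := by
      have := Finset.sum_le_sum (s := s) fun i _ => hA i z (hd z hz i)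
      rw [Finset.sum_add_distrib, Finset.sum_add_distrib, Finset.sum_const, nsmul_eq_mul] at this
      linarith
    have e3 := hτ z hz w hw
    have e4 := eu_nonneg (z - w)
    have e5 := mul_le_mul_of_nonneg_left e2 hε
    have e6 := mul_le_mul_of_nonneg_right hεd e4
    rw [e1]
    nlinarith

end LL

section CExt
variable {X : Type*} [NormedAddCommGroup X] [NormedSpace ℂ X]

def CExt (K K' : Set X) : Prop :=
  ∀ (ι : Type) (U : ι → Set X) (g : ι → ι → X → ℂ), (∀ i, IsOpen (U i)) → K ⊆ ⋃ i, U i →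
    IsCoc U g → ∃ (ι' : Type) (U' : ι' → Set X) (g' : ι' → ι' → X → ℂ) (e : ι → ι') (N : Set X),
      IsOpen N ∧ K ⊆ N ∧ (∀ i, IsOpen (U' i)) ∧ K' ⊆ ⋃ i, U' i ∧ IsCoc U' g' ∧
      (∀ i, U' (e i) = U i ∩ N) ∧ ∀ i j, ∀ z ∈ N, z ∈ U i → z ∈ U j → g' (e i) (e j) z = g i j z

lemma CExt_refl (K : Set X) : CExt K K := by
  intro ι U g hU hK hg
  exact ⟨ι, U, g, id, univ, isOpen_univ, subset_univ _, hU, hK, hg, by simp, by simp⟩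

lemma CExt_trans {K1 K2 K3 : Set X} (h12 : K1 ⊆ K2) (h1 : CExt K1 K2) (h2 : CExt K2 K3) : CExt K1 K3 := by
  intro ι U g hU hK hg
  obtain ⟨ι', U', g', e, N, oN, kN, oU', kU', cg', eU, eg⟩ := h1 ι U g hU hK hg
  obtain ⟨ι2, U2, g2, e2, N2, oN2, kN2, oU2, kU2, cg2, eU2, eg2⟩ := h2 ι' U' g' oU' kU' cg'
  refine ⟨ι2, U2, g2, e2 ∘ e, N ∩ N2, oN.inter oN2, subset_inter kN (h12.trans kN2), oU2, kU2, cg2, ?_, ?_⟩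
  · intro i
    rw [Function.comp_apply, eU2, eU, inter_assoc]
  · intro i j z hz hi hj
    rw [Function.comp_apply, Function.comp_apply, eg2 _ _ z hz.2, eg _ _ z hz.1 hi hj]
    · rw [eU]; exact ⟨hi, hz.1⟩
    · rw [eU]; exact ⟨hj, hz.1⟩

lemma CExt_step {K L : Set X} (hK : IsCompact K) (hL : IsCompact L) (h : H1 (K ∩ L)) :
    CExt K (K ∪ L) := by
  intro ι U g hU hKU hg
  obtain ⟨V, oV, kV, k, dk, ek⟩ := h ι U g hU (inter_subset_left.trans hKU) hg
  obtain ⟨V1, V2, o1, o2, k1, k2, hV⟩ := shrink2 hK hL oV kV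
  let U' : Option ι → Set X := fun o => o.elim V2 (fun i => U i ∩ V1)
  let g' : Option ι → Option ι → X → ℂ := fun o o' z =>
    match o, o' with
    | none, none => 0
    | some i, none => k i z
    | none, some i => - k i z
    | some i, some j => g i j z
  refine ⟨Option ι, U', g', some, V1, o1, k1, ?_, ?_, ⟨?_, ?_⟩, fun i => rfl, fun i j z _ _ _ => rfl⟩
  · rintro (_ | i)
    · exact o2
    · exact (hU i).inter o1
  · rintro z (hz | hz)
    · obtain ⟨i, hi⟩ := mem_iUnion.1 (hKU hz)
      exact mem_iUnion.2 ⟨some i, hi, k1 hz⟩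
    · exact mem_iUnion.2 ⟨none, k2 hz⟩
  · rintro (_ | i) (_ | j)
    · exact differentiableOn_const _
    · exact ((dk j).mono (fun z hz => ⟨hz.2.1, hV ⟨hz.2.2, hz.1⟩⟩)).neg
    · exact ((dk i).mono (fun z hz => ⟨hz.1.1, hV ⟨hz.1.2, hz.2⟩⟩))
    · exact (hg.1 i j).mono fun z hz => ⟨hz.1.1, hz.2.1⟩
  · rintro (_ | i) (_ | j) (_ | l) z hi hj hl <;> simp only [g']
    · simp
    · simp
    · simp
    · have := ek j l z hj.1 hl.1 (hV ⟨hj.2, hi⟩)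
      rw [this]; ring
    · simp
    · have := ek i l z hi.1 hl.1 (hV ⟨hi.2, hj⟩)
      rw [this]; ring
    · have := ek i j z hi.1 hj.1 (hV ⟨hi.2, hl⟩)
      rw [this]; ring
    · exact hg.2 i j l z hi.1 hj.1 hl.1

/-- Leray: transfer to a cover by H1-sets. -/
lemma leray {K0 K : Set X} (hE : CExt K0 K) {I : Type} {O Q : I → Set X} {g : I → I → X → ℂ}
    (hO : ∀ i, IsOpen (O i)) (hK0 : K0 ⊆ ⋃ i, O i) (hg : IsCoc O g) (hQ : ∀ i, H1 (K ∩ Q i)) :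
    ∃ (V T : I → Set X) (z' : I → I → X → ℂ) (h : I → X → ℂ), (∀ i, IsOpen (V i)) ∧
      (∀ i, K ∩ Q i ⊆ V i) ∧ IsCoc V z' ∧ (∀ i, IsOpen (T i)) ∧ (∀ i, K0 ∩ K ∩ O i ∩ Q i ⊆ T i) ∧
      (∀ i, DifferentiableOn ℂ (h i) (T i)) ∧
      ∀ i j z, z ∈ T i → z ∈ T j → g i j z = z' i j z + h i z - h j z := by
  classical
  obtain ⟨ι', U', g', e, N, oN, kN, oU', kU', cg', eU, eg⟩ := hE I O g hO hK0 hg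
  have : ∀ i, SplitsNear U' g' (K ∩ Q i) := fun i => hQ i ι' U' g' oU' (inter_subset_left.trans kU') cg'
  choose V oV kV k dk ek using this
  let z' : I → I → X → ℂ := fun i j z =>
    if h : ∃ a, z ∈ U' a then -(k i h.choose z - k j h.choose z) else 0
  have key : ∀ i j a z, z ∈ V i → z ∈ V j → z ∈ U' a → z' i j z = -(k i a z - k j a z) := by
    intro i j a z hi hj ha
    have h : ∃ a, z ∈ U' a := ⟨a, ha⟩
    simp only [z', dif_pos h]
    have h1 := ek i a _ z ha h.choose_spec hi
    have h2 := ek j a _ z ha h.choose_spec hj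
    linear_combination h2 - h1
  refine ⟨fun i => V i ∩ ⋃ a, U' a, fun i => V i ∩ U' (e i), z', fun i => k i (e i),
    fun i => (oV i).inter (isOpen_iUnion oU'), fun i => subset_inter (kV i) (inter_subset_left.trans kU'),
    ⟨?_, ?_⟩, fun i => (oV i).inter (oU' _), ?_, ?_, ?_⟩
  · intro i j
    apply diffOn_of_local
    rintro z ⟨⟨hi, ha⟩, hj, -⟩
    obtain ⟨a, ha⟩ := mem_iUnion.1 ha
    refine ⟨V i ∩ V j ∩ U' a, _, ((oV i).inter (oV j)).inter (oU' a), ⟨⟨hi, hj⟩, ha⟩, ?_,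
      fun w hw => key i j a w hw.1.1 hw.1.2 hw.2⟩
    exact (((dk i a).mono fun w hw => ⟨hw.2, hw.1.1⟩).sub
      ((dk j a).mono fun w hw => ⟨hw.2, hw.1.2⟩)).neg
  · intro i j l z hi hj hl
    obtain ⟨a, ha⟩ := mem_iUnion.1 hi.2
    rw [key i j a z hi.1 hj.1 ha, key j l a z hj.1 hl.1 ha, key i l a z hi.1 hl.1 ha]
    ring
  · rintro i z ⟨⟨⟨h0, hk⟩, ho⟩, hq⟩
    refine ⟨kV i ⟨hk, hq⟩, ?_⟩
    rw [eU]; exact ⟨ho, kN h0⟩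
  · exact fun i => (dk i (e i)).mono fun z hz => ⟨hz.2, hz.1⟩
  · intro i j z hi hj
    have hi2 := hi.2
    have hj2 := hj.2
    rw [eU] at hi2 hj2
    rw [key i j (e i) z hi.1 hj.1 hi.2, ← eg i j z hi2.2 hi2.1 hj2.1, ek j (e i) (e j) z hi.2 hj.2 hj.1]
    ring
end CExt

section Schwartz
variable {I : Type} [Fintype I] {X : Type*} [NormedAddCommGroup X] [NormedSpace ℂ X]

/-- cocycles as a submodule -/
def cocM (B : I → Set X) : Submodule ℂ (I → I → X → ℂ) where
  carrier := {g | IsCoc B g}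
  zero_mem' := ⟨fun i j => differentiableOn_const _, fun i j k z _ _ _ => by simp⟩
  add_mem' := by
    rintro a b ⟨ha, ha'⟩ ⟨hb, hb'⟩
    refine ⟨fun i j => (ha i j).add (hb i j), fun i j k z hi hj hk => ?_⟩
    have := ha' i j k z hi hj hk
    have := hb' i j k z hi hj hk
    simp only [Pi.add_apply]
    linear_combination ha' i j k z hi hj hk + hb' i j k z hi hj hk
  smul_mem' := by
    rintro c a ⟨ha, ha'⟩
    refine ⟨fun i j => (ha i j).const_smul c, fun i j k z hi hj hk => ?_⟩
    simp only [Pi.smul_apply, smul_eq_mul]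
    linear_combination c * ha' i j k z hi hj hk

/-- `g = δ h` on `A`. -/
def Spl (A : I → Set X) (g : I → I → X → ℂ) : Prop :=
  ∃ h : I → X → ℂ, (∀ i, DifferentiableOn ℂ (h i) (A i)) ∧
    ∀ i j z, z ∈ A i → z ∈ A j → g i j z = h i z - h j z

def splM (A : I → Set X) : Submodule ℂ (I → I → X → ℂ) where
  carrier := {g | Spl A g}
  zero_mem' := ⟨0, fun i => differentiableOn_const _, fun i j z _ _ => by simp⟩
  add_mem' := by
    rintro a b ⟨h, dh, eh⟩ ⟨k, dk, ek⟩
    refine ⟨h + k, fun i => (dh i).add (dk i), fun i j z hi hj => ?_⟩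
    simp only [Pi.add_apply, eh i j z hi hj, ek i j z hi hj]
    ring
  smul_mem' := by
    rintro c a ⟨h, dh, eh⟩
    refine ⟨c • h, fun i => (dh i).const_smul c, fun i j z hi hj => ?_⟩
    simp only [Pi.smul_apply, smul_eq_mul, eh i j z hi hj]
    ring

lemma montel [ProperSpace X] {B C : Set X} (hB : Bornology.IsBounded B) {δ : ℝ} (hδ : 0 < δ)
    (hBC : ∀ z ∈ B, ball z δ ⊆ C) (M ε : ℝ) (hε : 0 < ε) :
    ∃ S : Finset X, (S : Set X) ⊆ B ∧ ∀ z ∈ B, ∃ w ∈ S, ∀ f : X → ℂ, DifferentiableOn ℂ f C →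
      (∀ z ∈ C, ‖f z‖ ≤ M) → ‖f z - f w‖ ≤ ε := by
  wlog hM : 0 ≤ M generalizing M
  · obtain ⟨S, hS, h⟩ := this 0 le_rfl
    exact ⟨S, hS, fun z hz => (h z hz).imp fun w hw => ⟨hw.1, fun f df bf => hw.2 f df
      fun y hy => (bf y hy).trans (not_le.1 hM).le⟩⟩
  let r := min (δ / 2) (ε * δ / (4 * M + 1))
  have hr : 0 < r := lt_min (by positivity) (by positivity)
  have tb : TotallyBounded B := (hB.isCompact_closure.totallyBounded).subset subset_closure
  obtain ⟨S, hS, fS, cS⟩ := (totallyBounded_iff_subset.1 tb) {p | dist p.1 p.2 < r} (dist_mem_uniformity hr)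
  refine ⟨fS.toFinset, by simpa using hS, ?_⟩
  intro z hz
  have := cS hz
  simp only [mem_iUnion] at this
  obtain ⟨w, hw, hzw⟩ := this
  refine ⟨w, by simpa using hw, ?_⟩
  intro f df bf
  have hzw : dist z w < r := hzw
  have hsub : ∀ x ∈ ball w (δ/2), ball x (δ/2) ⊆ C := fun x hx => by
    refine Subset.trans (ball_subset_ball' ?_) (hBC w (hS hw))
    have := mem_ball.1 hx
    linarith
  have hder : ∀ x ∈ ball w (δ/2), ‖fderiv ℂ f x‖ ≤ 2 * M / (δ/2) := fun x hx =>
    cauchy_fderiv (by positivity) (df.mono (hsub x hx)) fun y hy => bf y (hsub x hx hy)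
  have hdf : ∀ x ∈ ball w (δ/2), DifferentiableAt ℂ f x := fun x hx =>
    (df.mono (hsub x hx)).differentiableAt (ball_mem_nhds x (by positivity))
  have := Convex.norm_image_sub_le_of_norm_fderiv_le hdf hder (convex_ball w (δ/2))
    (mem_ball_self (by positivity)) (show z ∈ ball w (δ/2) from hzw.trans_le (min_le_left _ _))
  refine this.trans ?_
  rw [← dist_eq_norm]
  have h1 : dist z w ≤ ε * δ / (4 * M + 1) := hzw.le.trans (min_le_right _ _)
  calc 2 * M / (δ/2) * dist z w ≤ 2 * M / (δ/2) * (ε * δ / (4 * M + 1)) := by gcongr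
    _ = ε * (4 * M / (4 * M + 1)) := by field_simp; ring
    _ ≤ ε * 1 := by
      gcongr; rw [div_le_one (by positivity)]; linarith
    _ = ε := mul_one _


lemma BF.norm_le {T G : Type*} [NormedAddCommGroup G] {f : BF T G} {C : ℝ} (hC : 0 ≤ C)
    (h : ∀ t, ‖f t‖ ≤ C) : ‖f‖ ≤ C := lp.norm_le_of_forall_le hC h

/-- restriction (truncation) to a set -/
def BF.res {T : Type*} (s : Set T) : BF T ℂ →L[ℂ] BF T ℂ :=
  LinearMap.mkContinuous
    { toFun := fun f => BF.of (s.indicator f) ⟨‖f‖, fun t => by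
        by_cases h : t ∈ s
        · rw [indicator_of_mem h]; exact BF.le f t
        · rw [indicator_of_notMem h]; simp⟩
      map_add' := fun f g => by
        ext t; exact congrFun (indicator_add s f g) t
      map_smul' := fun c f => by
        ext t; exact congrFun (indicator_const_smul s c f) t } 1 (fun f => by
      rw [one_mul]
      refine BF.norm_le (norm_nonneg _) fun t => ?_
      change ‖s.indicator f t‖ ≤ _
      by_cases h : t ∈ s
      · rw [indicator_of_mem h]; exact BF.le f t
      · rw [indicator_of_notMem h]; simp)

lemma BF.res_mem {T : Type*} {s : Set T} {t : T} (h : t ∈ s) (f : BF T ℂ) : BF.res s f t = f t :=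
  indicator_of_mem h _

lemma BF.res_notMem {T : Type*} {s : Set T} {t : T} (h : t ∉ s) (f : BF T ℂ) : BF.res s f t = 0 :=
  indicator_of_notMem h _

/-- currying -/
def cur (f : BF (I × I × X) ℂ) : I → I → X → ℂ := fun i j z => f (i, j, z)

def curL : BF (I × I × X) ℂ →ₗ[ℂ] (I → I → X → ℂ) where
  toFun := cur
  map_add' := fun f g => by ext i j z; simp [cur]
  map_smul' := fun f g => by ext i j z; simp [cur]

def cocB (B : I → Set X) : Submodule ℂ (BF (I × I × X) ℂ) := (cocM B).comap curL

lemma mem_cocB {B : I → Set X} {f : BF (I × I × X) ℂ} : f ∈ cocB B ↔ IsCoc B (cur f) := Iff.rfl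

lemma isClosed_cocB {B : I → Set X} (hB : ∀ i, IsOpen (B i)) :
    IsClosed ((cocB B : Submodule ℂ (BF (I × I × X) ℂ)) : Set (BF (I × I × X) ℂ)) := by
  have : ((cocB B : Submodule ℂ (BF (I × I × X) ℂ)) : Set (BF (I × I × X) ℂ)) =
    (⋂ i, ⋂ j, {f : BF (I × I × X) ℂ | DifferentiableOn ℂ (fun z => f (i, j, z)) (B i ∩ B j)}) ∩
    ⋂ i, ⋂ j, ⋂ k, ⋂ z, ⋂ (_ : z ∈ B i), ⋂ (_ : z ∈ B j), ⋂ (_ : z ∈ B k),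
      {f : BF (I × I × X) ℂ | f (i, j, z) + f (j, k, z) = f (i, k, z)} := by
    ext f
    simp only [mem_inter_iff, mem_iInter, mem_ofPred_eq]
    rfl
  rw [this]
  apply IsClosed.inter
  · exact isClosed_iInter fun i => isClosed_iInter fun j =>
      BF.isClosed_diffOn (fun z => (i, j, z)) ((hB i).inter (hB j))
  · refine isClosed_iInter fun i => isClosed_iInter fun j => isClosed_iInter fun k =>
      isClosed_iInter fun z => isClosed_iInter fun _ => isClosed_iInter fun _ => isClosed_iInter fun _ => ?_
    exact isClosed_eq ((BF.cont_apply _).add (BF.cont_apply _)) (BF.cont_apply _)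

/-- the domain of definition of cocycles -/
def cdom (B : I → Set X) : Set (I × I × X) := {t | t.2.2 ∈ B t.1 ∧ t.2.2 ∈ B t.2.1}

lemma IsCoc.congr {B : I → Set X} {g g' : I → I → X → ℂ} (hg : IsCoc B g)
    (h : ∀ i j z, z ∈ B i → z ∈ B j → g' i j z = g i j z) : IsCoc B g' := by
  refine ⟨fun i j => (hg.1 i j).congr fun z hz => h i j z hz.1 hz.2, fun i j k z hi hj hk => ?_⟩
  rw [h i j z hi hj, h j k z hj hk, h i k z hi hk, hg.2 i j k z hi hj hk]

lemma IsCoc.mono {ι : Type*} {B C : ι → Set X} {g : ι → ι → X → ℂ} (hg : IsCoc C g)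
    (h : ∀ i, B i ⊆ C i) : IsCoc B g :=
  ⟨fun i j => (hg.1 i j).mono (inter_subset_inter (h i) (h j)),
   fun i j k z hi hj hk => hg.2 i j k z (h i hi) (h j hj) (h k hk)⟩

lemma res_mem_cocB {B C : I → Set X} (hBC : ∀ i, B i ⊆ C i) {f : BF (I × I × X) ℂ} (hf : f ∈ cocB C) :
    BF.res (cdom B) f ∈ cocB B :=
  ((mem_cocB.1 hf).mono hBC).congr fun _ _ _ hi hj => BF.res_mem (s := cdom B) ⟨hi, hj⟩ f

lemma tb_res [ProperSpace X] {B C : I → Set X} (hB : ∀ i, Bornology.IsBounded (B i)) {δ : ℝ} (hδ : 0 < δ)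
    (hBC : ∀ i, ∀ z ∈ B i, ball z δ ⊆ C i) (M : ℝ) :
    TotallyBounded (BF.res (cdom B) '' {f : BF (I × I × X) ℂ | f ∈ cocB C ∧ ‖f‖ ≤ M}) := by
  classical
  have key : ∀ ε > 0, ∃ S : Finset (I × I × X), ∀ t ∈ cdom B, ∃ u ∈ S, u ∈ cdom B ∧
      ∀ f ∈ cocB C, ‖f‖ ≤ M → ‖f t - f u‖ ≤ ε := by
    intro ε hε
    have : ∀ p : I × I, _ := fun p => montel (B := B p.1 ∩ B p.2) (C := C p.1 ∩ C p.2) ((hB p.1).subset inter_subset_left) hδ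
      (fun z hz => subset_inter (hBC _ z hz.1) (hBC _ z hz.2)) M ε hε
    choose S hS hS2 using this
    refine ⟨Finset.univ.biUnion fun p : I × I => (S p).image fun z => (p.1, p.2, z), ?_⟩
    rintro ⟨i, j, z⟩ ht
    obtain ⟨w, hw, h⟩ := hS2 (i, j) z ht
    refine ⟨(i, j, w), ?_, hS (i, j) hw, ?_⟩
    · simp only [Finset.mem_biUnion, Finset.mem_image, Finset.mem_univ, true_and]
      exact ⟨(i, j), w, hw, rfl⟩
    · intro f hf hfM
      exact h (fun z => f (i, j, z)) ((mem_cocB.1 hf).1 i j) fun z _ => (BF.le f _).trans hfM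
  refine Metric.totallyBounded_of_finite_discretization fun ε hε => ?_
  obtain ⟨S, hS⟩ := key (ε / 5) (by positivity)
  -- discretize the values
  have tb : TotallyBounded (closedBall (0 : S → ℂ) M) := (isCompact_closedBall _ _).totallyBounded
  obtain ⟨Z, -, fZ, cZ⟩ := totallyBounded_iff_subset.1 tb {p | dist p.1 p.2 < ε / 5}
    (dist_mem_uniformity (by positivity))
  have hM0 : ∀ f : BF (I × I × X) ℂ, ‖f‖ ≤ M → 0 ≤ M := fun f h => (norm_nonneg _).trans h
  have hval : ∀ x : BF.res (cdom B) '' {f : BF (I × I × X) ℂ | f ∈ cocB C ∧ ‖f‖ ≤ M},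
      ∃ y ∈ Z, dist (fun u : S => (x : BF (I × I × X) ℂ) u.1) y < ε / 5 := by
    rintro ⟨_, f, ⟨hf, hfM⟩, rfl⟩
    have : (fun u : S => (BF.res (cdom B) f) u.1) ∈ closedBall (0 : S → ℂ) M := by
      rw [mem_closedBall, dist_zero_right, pi_norm_le_iff_of_nonneg (hM0 f hfM)]
      intro u
      by_cases h : u.1 ∈ cdom B
      · rw [BF.res_mem h]; exact (BF.le f _).trans hfM
      · rw [BF.res_notMem h]; simpa using hM0 f hfM
    have := cZ this
    simp only [mem_iUnion] at this
    obtain ⟨y, hy, h⟩ := this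
    exact ⟨y, hy, h⟩
  choose y hy hy2 using hval
  have : Fintype Z := fZ.fintype
  refine ⟨ULift Z, inferInstance, fun x => ⟨⟨y x, hy x⟩⟩, ?_⟩
  intro x x' hxx
  have hxx : y x = y x' := by simpa using hxx
  have h1 := hy2 x
  have h2 := hy2 x'
  rw [hxx] at h1
  have hd : ∀ u : S, ‖(x : BF (I × I × X) ℂ) u.1 - (x' : BF (I × I × X) ℂ) u.1‖ ≤ 2 * ε / 5 := by
    intro u
    have := dist_le_pi_dist (fun u : S => (x : BF (I × I × X) ℂ) u.1) (fun u : S => (x' : BF (I × I × X) ℂ) u.1) u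
    have h3 := dist_triangle_right (fun u : S => (x : BF (I × I × X) ℂ) u.1) (fun u : S => (x' : BF (I × I × X) ℂ) u.1) (y x')
    rw [← dist_eq_norm]
    linarith
  obtain ⟨_, f, ⟨hf, hfM⟩, rfl⟩ := x
  obtain ⟨_, f', ⟨hf', hfM'⟩, rfl⟩ := x'
  change dist (BF.res (cdom B) f) (BF.res (cdom B) f') < ε
  rw [dist_eq_norm]
  refine lt_of_le_of_lt (BF.norm_le (C := 4 * ε / 5) (by positivity) fun t => ?_) (by linarith)
  simp only [lp.coeFn_sub, Pi.sub_apply]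
  by_cases ht : t ∈ cdom B
  · obtain ⟨u, hu, hu1, hu2⟩ := hS t ht
    have a : ‖(BF.res (cdom B) f) u - (BF.res (cdom B) f') u‖ ≤ 2 * ε / 5 := hd ⟨u, hu⟩
    rw [BF.res_mem hu1, BF.res_mem hu1] at a
    rw [BF.res_mem ht, BF.res_mem ht]
    have b := hu2 f hf hfM
    have c := hu2 f' hf' hfM'
    calc ‖f t - f' t‖ = ‖(f t - f u) + (f u - f' u) - (f' t - f' u)‖ := by congr 1; ring
      _ ≤ ‖(f t - f u)‖ + ‖(f u - f' u)‖ + ‖(f' t - f' u)‖ :=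
        (norm_sub_le _ _).trans (by gcongr; exact norm_add_le _ _)
      _ ≤ 4 * ε / 5 := by linarith
  · rw [BF.res_notMem ht, BF.res_notMem ht]
    simp; positivity


/-- The relation `g = z' + δh` on `A`. -/
def relE (A B C : I → Set X) : Submodule ℂ (BF (I × I × X) ℂ × (BF (I × I × X) ℂ × BF (I × X) ℂ)) where
  carrier := {p | p.1 ∈ cocB B ∧ p.2.1 ∈ cocB C ∧ (∀ i, DifferentiableOn ℂ (fun z => p.2.2 (i, z)) (A i)) ∧
    ∀ i j z, z ∈ A i → z ∈ A j → p.1 (i, j, z) = p.2.1 (i, j, z) + p.2.2 (i, z) - p.2.2 (j, z)}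
  zero_mem' := ⟨zero_mem _, zero_mem _, fun i => differentiableOn_const _, fun i j z _ _ => by simp⟩
  add_mem' := by
    rintro p q ⟨a1, a2, a3, a4⟩ ⟨b1, b2, b3, b4⟩
    refine ⟨add_mem a1 b1, add_mem a2 b2, fun i => (a3 i).add (b3 i), fun i j z hi hj => ?_⟩
    simp only [Prod.fst_add, Prod.snd_add, lp.coeFn_add, Pi.add_apply]
    linear_combination a4 i j z hi hj + b4 i j z hi hj
  smul_mem' := by
    rintro c p ⟨a1, a2, a3, a4⟩
    refine ⟨Submodule.smul_mem _ _ a1, Submodule.smul_mem _ _ a2, fun i => (a3 i).const_smul c, fun i j z hi hj => ?_⟩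
    simp only [Prod.smul_fst, Prod.smul_snd, lp.coeFn_smul, Pi.smul_apply, smul_eq_mul]
    linear_combination c * a4 i j z hi hj

lemma isClosed_relE {A B C : I → Set X} (hA : ∀ i, IsOpen (A i)) (hB : ∀ i, IsOpen (B i))
    (hC : ∀ i, IsOpen (C i)) : IsClosed (relE A B C : Set (BF (I × I × X) ℂ × (BF (I × I × X) ℂ × BF (I × X) ℂ))) := by
  have : (relE A B C : Set (BF (I × I × X) ℂ × (BF (I × I × X) ℂ × BF (I × X) ℂ))) =
    (fun p => p.1) ⁻¹' (cocB B : Set (BF (I × I × X) ℂ)) ∩ ((fun p => p.2.1) ⁻¹' (cocB C : Set (BF (I × I × X) ℂ)) ∩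
    ((⋂ i, (fun p => p.2.2) ⁻¹' {f : BF (I × X) ℂ | DifferentiableOn ℂ (fun z => f (i, z)) (A i)}) ∩
    ⋂ i, ⋂ j, ⋂ z, ⋂ (_ : z ∈ A i), ⋂ (_ : z ∈ A j),
      {p : BF (I × I × X) ℂ × (BF (I × I × X) ℂ × BF (I × X) ℂ) |
        p.1 (i, j, z) = p.2.1 (i, j, z) + p.2.2 (i, z) - p.2.2 (j, z)})) := by
    ext p
    simp only [mem_inter_iff, mem_iInter, mem_preimage, mem_ofPred_eq]
    rfl
  rw [this]
  refine ((isClosed_cocB hB).preimage continuous_fst).inter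
    (((isClosed_cocB hC).preimage (continuous_fst.comp continuous_snd)).inter (IsClosed.inter ?_ ?_))
  · exact isClosed_iInter fun i =>
      (BF.isClosed_diffOn (fun z => (i, z)) (hA i)).preimage (continuous_snd.comp continuous_snd)
  · refine isClosed_iInter fun i => isClosed_iInter fun j => isClosed_iInter fun z =>
      isClosed_iInter fun _ => isClosed_iInter fun _ => ?_
    have c1 := continuous_fst (X := BF (I × I × X) ℂ) (Y := BF (I × I × X) ℂ × BF (I × X) ℂ)
    have c2 := continuous_fst.comp (continuous_snd (X := BF (I × I × X) ℂ) (Y := BF (I × I × X) ℂ × BF (I × X) ℂ))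
    have c3 := continuous_snd.comp (continuous_snd (X := BF (I × I × X) ℂ) (Y := BF (I × I × X) ℂ × BF (I × X) ℂ))
    exact isClosed_eq ((BF.cont_apply _).comp c1) ((((BF.cont_apply _).comp c2).add
      ((BF.cont_apply _).comp c3)).sub ((BF.cont_apply _).comp c3))

/-- A standing hypothesis: solvability up to a cocycle on a larger set. -/
def Solv (A B C : I → Set X) : Prop := ∀ g : I → I → X → ℂ, IsCoc B g → ∃ (z' : I → I → X → ℂ) (h : I → X → ℂ) (M : ℝ),
  IsCoc C z' ∧ (∀ i j, ∀ z ∈ C i ∩ C j, ‖z' i j z‖ ≤ M) ∧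
  (∀ i, DifferentiableOn ℂ (h i) (A i)) ∧ (∀ i, ∀ z ∈ A i, ‖h i z‖ ≤ M) ∧
  ∀ i j z, z ∈ A i → z ∈ A j → g i j z = z' i j z + h i z - h j z

lemma exists_bf {C : I → Set X} {g : I → I → X → ℂ} {M : ℝ}
    (h : ∀ i j, ∀ z ∈ C i ∩ C j, ‖g i j z‖ ≤ M) :
    ∃ f : BF (I × I × X) ℂ, ∀ i j z, z ∈ C i → z ∈ C j → f (i, j, z) = g i j z := by
  refine ⟨BF.of ((cdom C).indicator fun t => g t.1 t.2.1 t.2.2) ⟨|M|, fun t => ?_⟩, fun i j z hi hj => ?_⟩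
  · by_cases ht : t ∈ cdom C
    · rw [indicator_of_mem ht]; exact (h _ _ _ ht).trans (le_abs_self _)
    · rw [indicator_of_notMem ht]; simp
  · rw [BF.of_apply]
    exact indicator_of_mem (s := cdom C) (show (i, j, z) ∈ cdom C from ⟨hi, hj⟩) _

lemma exists_bf1 {A : I → Set X} {h : I → X → ℂ} {M : ℝ}
    (hM : ∀ i, ∀ z ∈ A i, ‖h i z‖ ≤ M) :
    ∃ f : BF (I × X) ℂ, ∀ i z, z ∈ A i → f (i, z) = h i z := by
  refine ⟨BF.of (({t | t.2 ∈ A t.1} : Set (I × X)).indicator fun t => h t.1 t.2) ⟨|M|, fun t => ?_⟩, fun i z hi => ?_⟩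
  · by_cases ht : t ∈ ({t | t.2 ∈ A t.1} : Set (I × X))
    · rw [indicator_of_mem ht]; exact (hM _ _ ht).trans (le_abs_self _)
    · rw [indicator_of_notMem ht]; simp
  · rw [BF.of_apply]
    exact indicator_of_mem (show (i, z) ∈ ({t | t.2 ∈ A t.1} : Set (I × X)) from hi) _

lemma schwartz_rel {A B C : I → Set X} (hA : ∀ i, IsOpen (A i)) (hB : ∀ i, IsOpen (B i))
    (hC : ∀ i, IsOpen (C i)) (hAC : ∀ i, A i ⊆ C i) (hs : Solv A B C) :
    ∃ K > 0, ∀ g ∈ cocB B, ∃ p ∈ relE A B C, p.1 = g ∧ ‖p‖ ≤ K * ‖g‖ := by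
  refine om_rel _ (isClosed_relE hA hB hC) _ (isClosed_cocB hB) (fun p hp => hp.1) ?_
  intro g hg
  obtain ⟨z', h, M, hz, bz, dh, bh, e⟩ := hs _ (mem_cocB.1 hg)
  obtain ⟨f, hf⟩ := exists_bf bz
  obtain ⟨k, hk⟩ := exists_bf1 bh
  refine ⟨(g, (f, k)), ⟨hg, ?_, ?_, ?_⟩, rfl⟩
  · exact hz.congr hf
  · exact fun i => (dh i).congr fun z hz => hk i z hz
  · intro i j z hi hj
    simp only
    rw [hf i j z (hAC i hi) (hAC j hj), hk i z hi, hk j z hj]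
    exact e i j z hi hj

end Schwartz

section Schwartz2
variable {I : Type} [Fintype I] {X : Type*} [NormedAddCommGroup X] [NormedSpace ℂ X]

lemma schwartz_abs {Y1 Y2 : Type*} [NormedAddCommGroup Y1] [NormedSpace ℂ Y1] [CompleteSpace Y1]
    [NormedAddCommGroup Y2] [NormedSpace ℂ Y2] [CompleteSpace Y2]
    (E : Submodule ℂ (Y1 × Y2)) (hE : IsClosed (E : Set (Y1 × Y2))) (F : Submodule ℂ Y1)
    (R : Y2 →L[ℂ] Y1) (h1 : ∀ p ∈ E, p.1 ∈ F) (h2 : ∀ p ∈ E, R p.2 ∈ F) (K : ℝ) (K0 : 0 < K)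
    (hK : ∀ g ∈ F, ∃ p ∈ E, p.1 = g ∧ ‖p‖ ≤ K * ‖g‖) (S : Set Y1) (hS : ∀ p ∈ E, ‖p‖ ≤ K → R p.2 ∈ S)
    (hSF : S ⊆ F) (tb : TotallyBounded S) :
    ∃ Y : Finset Y1, (∀ y ∈ Y, y ∈ F) ∧ ∀ g ∈ F, ∃ p ∈ E, ∃ c : Y → ℂ,
      p.1 - R p.2 + ∑ y : Y, c y • y.1 = g := by
  classical
  obtain ⟨Z, hZ, fZ, cZ⟩ := totallyBounded_iff_subset.1 tb {p | dist p.1 p.2 < 1 / 2}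
    (dist_mem_uniformity (by positivity))
  have hZB : ∀ y ∈ fZ.toFinset, y ∈ F := fun y hy => hSF (hZ (fZ.mem_toFinset.1 hy))
  set Y := fZ.toFinset with hY
  refine ⟨Y, hZB, ?_⟩
  have : CompleteSpace E := hE.completeSpace_coe
  let P1 : (E × (Y → ℂ)) →L[ℂ] (Y1 × Y2) := E.subtypeL.comp (ContinuousLinearMap.fst ℂ E (Y → ℂ))
  let T0 : (E × (Y → ℂ)) →L[ℂ] Y1 :=
    (ContinuousLinearMap.fst ℂ Y1 Y2).comp P1 - R.comp ((ContinuousLinearMap.snd ℂ Y1 Y2).comp P1) +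
    ∑ y : Y, ((ContinuousLinearMap.proj (R := ℂ) (φ := fun _ : Y => ℂ) y).comp
      (ContinuousLinearMap.snd ℂ E (Y → ℂ))).smulRight y.1
  have hT0 : ∀ p c, T0 (p, c) = p.1.1 - R p.1.2 + ∑ y : Y, c y • y.1 := by
    intro p c
    simp only [T0, P1, add_apply, sub_apply, sum_apply]
    rfl
  have hT0m : ∀ x, T0 x ∈ F := by
    rintro ⟨p, c⟩
    rw [hT0]
    exact add_mem (sub_mem (h1 _ p.2) (h2 _ p.2))
      (Submodule.sum_mem _ fun y _ => Submodule.smul_mem _ _ (hZB y.1 y.2))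
  let T : (E × (Y → ℂ)) →L[ℂ] F := T0.codRestrict _ hT0m
  have app : ∀ g : F, ∃ x, ‖x‖ ≤ (max K 1) * ‖g‖ ∧ ‖g - T x‖ ≤ ‖g‖ / 2 := by
    intro g
    by_cases g0 : ‖g‖ = 0
    · refine ⟨0, by simp [g0], ?_⟩
      rw [map_zero, sub_zero, g0]; simp
    have gp : 0 < ‖g‖ := lt_of_le_of_ne (norm_nonneg _) (Ne.symm g0)
    let u : Y1 := ((‖g‖ : ℂ)⁻¹) • g.1
    have hu : u ∈ F := Submodule.smul_mem _ _ g.2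
    have nu : ‖u‖ ≤ 1 := by
      simp only [u, norm_smul, norm_inv, Complex.norm_real, norm_norm]
      change ‖g‖⁻¹ * ‖g‖ ≤ 1
      rw [inv_mul_cancel₀ g0]
    have eu : g.1 = (‖g‖ : ℂ) • u := by
      simp only [u, smul_smul]
      rw [mul_inv_cancel₀ (by exact_mod_cast g0), one_smul]
    obtain ⟨p, hp, hp1, hpn⟩ := hK u hu
    have hpK : ‖p‖ ≤ K := hpn.trans (by nlinarith)
    have hr' := cZ (hS p hp hpK)
    simp only [mem_iUnion] at hr'
    obtain ⟨y, hy, hyd⟩ := hr'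
    have hyd : dist (R p.2) y < 1 / 2 := hyd
    have hyY : y ∈ Y := fZ.mem_toFinset.2 hy
    refine ⟨(‖g‖ : ℂ) • (⟨p, hp⟩, Pi.single ⟨y, hyY⟩ 1), ?_, ?_⟩
    · rw [norm_smul, Complex.norm_real, norm_norm, mul_comm]
      gcongr
      rw [Prod.norm_def]
      refine max_le_max hpK ?_
      refine (pi_norm_le_iff_of_nonneg zero_le_one).2 fun i => ?_
      by_cases h : i = ⟨y, hyY⟩
      · subst h; simp
      · simp [Pi.single_eq_of_ne h]
    · rw [map_smul]
      change ‖g.1 - (‖g‖ : ℂ) • T0 (⟨p, hp⟩, Pi.single ⟨y, hyY⟩ 1)‖ ≤ _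
      rw [hT0]
      have e1 : ∑ y' : Y, (Pi.single (M := fun _ => ℂ) (⟨y, hyY⟩ : Y) (1:ℂ)) y' • y'.1 = y := by
        rw [Finset.sum_eq_single (⟨y, hyY⟩ : Y)]
        · simp
        · intro b _ hb; rw [Pi.single_eq_of_ne hb]; simp
        · simp
      rw [e1, eu]
      have e2 : (‖g‖ : ℂ) • u - (‖g‖ : ℂ) • (p.1 - R p.2 + y) =
        (‖g‖ : ℂ) • (R p.2 - y) := by
        rw [hp1, ← smul_sub]; congr 1; abel
      simp only
      rw [e2, norm_smul, Complex.norm_real, norm_norm, ← dist_eq_norm]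
      nlinarith
  have surj := iterate_surj T (max K 1) (le_max_of_le_right zero_le_one) app
  intro g hg
  obtain ⟨⟨p, c⟩, hx, -⟩ := surj ⟨g, hg⟩
  have hx : T0 (p, c) = g := congrArg Subtype.val hx
  rw [hT0] at hx
  exact ⟨p.1, p.2, c, hx⟩

lemma schwartz_fin [ProperSpace X] {A B C : I → Set X} (hA : ∀ i, IsOpen (A i)) (hB : ∀ i, IsOpen (B i))
    (hC : ∀ i, IsOpen (C i)) (hAB : ∀ i, A i ⊆ B i) (hBb : ∀ i, Bornology.IsBounded (B i))
    {δ : ℝ} (hδ : 0 < δ) (hBC : ∀ i, ∀ z ∈ B i, ball z δ ⊆ C i) (hs : Solv A B C) :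
    ∃ (Y : Finset (BF (I × I × X) ℂ)), (∀ y ∈ Y, y ∈ cocB B) ∧ ∀ g ∈ cocM B, ∃ c : Y → ℂ,
      g - ∑ y : Y, c y • cur y.1 ∈ splM A := by
  classical
  have hBC' : ∀ i, B i ⊆ C i := fun i z hz => hBC i z hz (mem_ball_self hδ)
  obtain ⟨K, K0, hK⟩ := schwartz_rel hA hB hC (fun i => (hAB i).trans (hBC' i)) hs
  have tb := tb_res hBb hδ hBC K
  obtain ⟨Y, hY, surj⟩ := schwartz_abs (relE A B C) (isClosed_relE hA hB hC) (cocB B)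
    ((BF.res (cdom B)).comp (ContinuousLinearMap.fst ℂ (BF (I × I × X) ℂ) (BF (I × X) ℂ)))
    (fun p hp => hp.1) (fun p hp => res_mem_cocB hBC' hp.2.1) K K0 hK
    (BF.res (cdom B) '' {f : BF (I × I × X) ℂ | f ∈ cocB C ∧ ‖f‖ ≤ K})
    (fun p hp hpK => ⟨p.2.1, ⟨hp.2.1, ((norm_fst_le p.2).trans (norm_snd_le p)).trans hpK⟩, rfl⟩)
    (by rintro _ ⟨f, hf, rfl⟩; exact res_mem_cocB hBC' hf.1) tb
  refine ⟨Y, hY, ?_⟩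
  intro g hg
  obtain ⟨z', h, M, hz, bz, dh, bh, e⟩ := hs _ hg
  obtain ⟨f, hf⟩ := exists_bf bz
  have hfC : f ∈ cocB C := hz.congr hf
  obtain ⟨p, hp, c, hx⟩ := surj (BF.res (cdom B) f) (res_mem_cocB hBC' hfC)
  have hx : p.1 - BF.res (cdom B) p.2.1 + ∑ y : Y, c y • y.1 = BF.res (cdom B) f := hx
  refine ⟨c, fun i z => h i z + p.2.2 (i, z), fun i => (dh i).add (hp.2.2.1 i), ?_⟩
  intro i j z hi hj
  have hiB := hAB i hi
  have hjB := hAB j hj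
  have e1 := e i j z hi hj
  have e2 := hp.2.2.2 i j z hi hj
  have e3 := congrArg (fun f : BF (I × I × X) ℂ => f (i, j, z)) hx
  have hm : (i, j, z) ∈ cdom B := ⟨hiB, hjB⟩
  have e5 : (∑ y : Y, c y • cur y.1) i j z = (∑ y : Y, c y • y.1 : BF (I × I × X) ℂ) (i, j, z) := by
    simp only [Finset.sum_apply, Pi.smul_apply, lp.coeFn_sum, lp.coeFn_smul, cur]
  simp only [lp.coeFn_add, lp.coeFn_sub, Pi.add_apply, Pi.sub_apply] at e3
  rw [BF.res_mem hm, BF.res_mem hm, hf i j z (hBC' i hiB) (hBC' j hjB)] at e3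
  change g i j z - (∑ y : Y, c y • cur y.1) i j z = _
  rw [e5]
  linear_combination e1 + e2 - e3


end Schwartz2

section weyl
variable {I : Type} [Fintype I] {κ : Type} [Fintype κ] [DecidableEq κ]

def mulK (k : κ) : (I → I → (κ → ℂ) → ℂ) →ₗ[ℂ] (I → I → (κ → ℂ) → ℂ) where
  toFun g := fun i j z => z k * g i j z
  map_add' := fun f g => by ext i j z; simp [mul_add]
  map_smul' := fun f g => by ext i j z; simp; ring

open Classical in
def derK (B : I → Set (κ → ℂ)) (k : κ) (g : I → I → (κ → ℂ) → ℂ) : I → I → (κ → ℂ) → ℂ :=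
  fun i j z => if z ∈ B i ∩ B j then fderiv ℂ (g i j) z (Pi.single k 1) else 0

lemma diffOn_fderiv {X : Type*} [NormedAddCommGroup X] [NormedSpace ℂ X] [ProperSpace X]
    {f : X → ℂ} {U : Set X} (hU : IsOpen U) (hf : DifferentiableOn ℂ f U)
    (v : X) : DifferentiableOn ℂ (fun z => fderiv ℂ f z v) U := by
  apply diffOn_of_local
  intro x hx
  obtain ⟨r, hr, hrU⟩ := Metric.isOpen_iff.1 hU x hx
  obtain ⟨s, hs, hsv⟩ : ∃ s > 0, s * ‖v‖ < r / 2 := by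
    refine ⟨r / (4 * (‖v‖ + 1)), by positivity, ?_⟩
    rw [div_mul_eq_mul_div, div_lt_iff₀ (by positivity)]
    nlinarith [norm_nonneg v]
  have hin : ∀ z ∈ ball x (r/2), ∀ t : ℂ, ‖t‖ ≤ s → z + t • v ∈ U := by
    intro z hz t ht
    apply hrU
    rw [mem_ball, dist_eq_norm]
    calc ‖z + t • v - x‖ = ‖(z - x) + t • v‖ := by congr 1; abel
      _ ≤ ‖z - x‖ + ‖t • v‖ := norm_add_le _ _
      _ ≤ ‖z - x‖ + s * ‖v‖ := by rw [norm_smul]; gcongr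
      _ < r := by rw [mem_ball, dist_eq_norm] at hz; linarith
  have hcm : ∀ θ : ℝ, ‖circleMap 0 s θ‖ ≤ s := fun θ => by simp [abs_of_pos hs]
  have hc0 : ∀ θ : ℝ, circleMap 0 s θ ≠ 0 := fun θ => by
    simpa using circleMap_ne_center (c := (0:ℂ)) hs.ne' (θ := θ)
  refine ⟨ball x (r/2), fun z => ((2 * Real.pi * Complex.I : ℂ)⁻¹) * ∫ θ in (0:ℝ)..2 * Real.pi,
    (circleMap 0 s θ * Complex.I) * ((circleMap 0 s θ)^2)⁻¹ * f (z + circleMap 0 s θ • v), isOpen_ball,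
    mem_ball_self (by positivity), ?_, ?_⟩
  · apply DifferentiableOn.const_mul
    apply diffOn_integral isOpen_ball
    · apply ContinuousOn.mul
      · have : Continuous fun q : ℝ × X => circleMap 0 s q.1 := (continuous_circleMap 0 s).comp continuous_fst
        apply Continuous.continuousOn
        exact (this.mul continuous_const).mul ((this.pow 2).inv₀ fun q => pow_ne_zero _ (hc0 _))
      · refine hf.continuousOn.comp ?_ fun q hq => hin q.2 hq.2 _ (hcm _)
        have : Continuous fun q : ℝ × X => circleMap 0 s q.1 := (continuous_circleMap 0 s).comp continuous_fst
        exact (continuous_snd.add (this.smul continuous_const)).continuousOn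
    · intro t _
      apply DifferentiableOn.const_mul
      exact hf.comp (by fun_prop) fun z hz => hin z hz _ (hcm _)
  · intro z hz
    have hd : DifferentiableAt ℂ f z := hf.differentiableAt (hU.mem_nhds (by simpa using hin z hz 0 (by simpa using hs.le)))
    have hcomp : HasDerivAt (fun t : ℂ => f (z + t • v)) (fderiv ℂ f z v) 0 := by
      have h1 : HasDerivAt (fun t : ℂ => z + t • v) v 0 := by
        simpa using ((hasDerivAt_id (0:ℂ)).smul_const v).const_add z
      have h2 : HasFDerivAt f (fderiv ℂ f z) (z + (0:ℂ) • v) := by simpa using hd.hasFDerivAt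
      exact h2.comp_hasDerivAt (0:ℂ) h1
    have hO : DifferentiableOn ℂ (fun t : ℂ => f (z + t • v)) (closedBall 0 s) :=
      hf.comp (by fun_prop) fun t ht => hin z hz t (by simpa using ht)
    have := Complex.two_pi_I_inv_smul_circleIntegral_sub_sq_inv_smul_of_differentiable
      (U := {t : ℂ | z + t • v ∈ U}) (hU.preimage (by fun_prop)) (c := 0) (w₀ := 0) (R := s)
      (f := fun t => f (z + t • v)) (fun t ht => hin z hz t (by simpa using ht))
      (hf.comp (by fun_prop) fun t ht => ht) (mem_ball_self hs)
    rw [hcomp.deriv] at this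
    rw [← this]
    simp only [circleIntegral, deriv_circleMap, smul_eq_mul, sub_zero, mul_assoc]

lemma trace_trick {Q : Type*} [AddCommGroup Q] [Module ℂ Q] [Module.Finite ℂ Q]
    (a b : Q →ₗ[ℂ] Q) (h : a * b - b * a = 1) : Subsingleton Q := by
  have := congrArg (LinearMap.trace ℂ Q) h
  rw [map_sub, LinearMap.trace_mul_comm, sub_self, LinearMap.trace_one] at this
  have h0 : Module.finrank ℂ Q = 0 := by exact_mod_cast this.symm
  exact Module.finrank_zero_iff.1 h0

lemma derK_coc {B : I → Set (κ → ℂ)} (hB : ∀ i, IsOpen (B i)) (k : κ) {g} (hg : IsCoc B g) :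
    IsCoc B (derK B k g) := by
  constructor
  · intro i j
    refine (diffOn_fderiv ((hB i).inter (hB j)) (hg.1 i j) (Pi.single k 1)).congr fun z hz => ?_
    exact if_pos hz
  · intro i j l z hi hj hl
    have o : IsOpen (B i ∩ B j ∩ B l) := ((hB i).inter (hB j)).inter (hB l)
    have n := o.mem_nhds (show z ∈ B i ∩ B j ∩ B l from ⟨⟨hi, hj⟩, hl⟩)
    have d : ∀ a b, z ∈ B a → z ∈ B b → DifferentiableAt ℂ (g a b) z := fun a b ha hb =>
      (hg.1 a b).differentiableAt (((hB a).inter (hB b)).mem_nhds ⟨ha, hb⟩)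
    have e : g i l =ᶠ[𝓝 z] g i j + g j l := by
      filter_upwards [n] with w hw
      exact (hg.2 i j l w hw.1.1 hw.1.2 hw.2).symm
    simp only [derK, if_pos (show z ∈ B i ∩ B j from ⟨hi, hj⟩), if_pos (show z ∈ B j ∩ B l from ⟨hj, hl⟩),
      if_pos (show z ∈ B i ∩ B l from ⟨hi, hl⟩)]
    rw [e.fderiv_eq, fderiv_add (d _ _ hi hj) (d _ _ hj hl)]
    rfl

lemma derK_spl {A B : I → Set (κ → ℂ)} (hA : ∀ i, IsOpen (A i)) (hAB : ∀ i, A i ⊆ B i)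
    (k : κ) {g} (hg : Spl A g) : Spl A (derK B k g) := by
  obtain ⟨h, dh, e⟩ := hg
  refine ⟨fun i z => fderiv ℂ (h i) z (Pi.single k 1), fun i => diffOn_fderiv (hA i) (dh i) _, ?_⟩
  intro i j z hi hj
  have d : ∀ a, z ∈ A a → DifferentiableAt ℂ (h a) z := fun a ha =>
      (dh a).differentiableAt ((hA a).mem_nhds ha)
  have e : g i j =ᶠ[𝓝 z] h i - h j := by
    filter_upwards [((hA i).inter (hA j)).mem_nhds ⟨hi, hj⟩] with w hw
    exact e i j w hw.1 hw.2
  simp only [derK, if_pos (show z ∈ B i ∩ B j from ⟨hAB i hi, hAB j hj⟩)]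
  rw [e.fderiv_eq, fderiv_sub (d _ hi) (d _ hj)]
  rfl

def derL {B : I → Set (κ → ℂ)} (hB : ∀ i, IsOpen (B i)) (k : κ) : cocM B →ₗ[ℂ] cocM B where
  toFun g := ⟨derK B k g.1, derK_coc hB k g.2⟩
  map_add' := by
    rintro ⟨f, hf⟩ ⟨g, hg⟩
    apply Subtype.ext
    funext i j z
    change derK B k (f + g) i j z = derK B k f i j z + derK B k g i j z
    simp only [derK]
    by_cases h : z ∈ B i ∩ B j
    · have n := ((hB i).inter (hB j)).mem_nhds h
      rw [if_pos h, if_pos h, if_pos h]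
      change (fderiv ℂ (f i j + g i j) z) _ = _
      rw [fderiv_add ((hf.1 i j).differentiableAt n) ((hg.1 i j).differentiableAt n)]
      rfl
    · rw [if_neg h, if_neg h, if_neg h, add_zero]
  map_smul' := by
    rintro c ⟨f, hf⟩
    apply Subtype.ext
    funext i j z
    change derK B k (c • f) i j z = c * derK B k f i j z
    simp only [derK]
    by_cases h : z ∈ B i ∩ B j
    · have n := ((hB i).inter (hB j)).mem_nhds h
      rw [if_pos h, if_pos h]
      change (fderiv ℂ (c • f i j) z) _ = _
      rw [fderiv_const_smul ((hf.1 i j).differentiableAt n)]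
      rfl
    · rw [if_neg h, if_neg h, mul_zero]

lemma mulK_coc {B : I → Set (κ → ℂ)} (k : κ) {g} (hg : IsCoc B g) : IsCoc B (mulK k g) := by
  constructor
  · intro i j
    exact DifferentiableOn.mul (by fun_prop) (hg.1 i j)
  · intro i j l z hi hj hl
    simp only [mulK, LinearMap.coe_mk, AddHom.coe_mk]
    rw [← hg.2 i j l z hi hj hl]; ring

lemma mulK_spl {A : I → Set (κ → ℂ)} (k : κ) {g} (hg : Spl A g) : Spl A (mulK k g) := by
  obtain ⟨h, dh, e⟩ := hg
  refine ⟨fun i z => z k * h i z, fun i => DifferentiableOn.mul (by fun_prop) (dh i), ?_⟩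
  intro i j z hi hj
  simp only [mulK, LinearMap.coe_mk, AddHom.coe_mk]
  rw [e i j z hi hj]; ring

def mulL (B : I → Set (κ → ℂ)) (k : κ) : cocM B →ₗ[ℂ] cocM B :=
  (mulK k).restrict fun _ hg => mulK_coc k hg

/-- Finite dimensionality plus the Weyl relation: everything splits. -/
theorem solv_split [Nonempty κ] {A B C : I → Set (κ → ℂ)} (hA : ∀ i, IsOpen (A i)) (hB : ∀ i, IsOpen (B i))
    (hC : ∀ i, IsOpen (C i)) (hAB : ∀ i, A i ⊆ B i) (hBb : ∀ i, Bornology.IsBounded (B i))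
    {δ : ℝ} (hδ : 0 < δ) (hBC : ∀ i, ∀ z ∈ B i, ball z δ ⊆ C i) (hs : Solv A B C)
    {g} (hg : IsCoc B g) : Spl A g := by
  obtain ⟨Y, hY, hfin⟩ := schwartz_fin hA hB hC hAB hBb hδ hBC hs
  let W : Submodule ℂ (cocM B) := (splM A).comap (cocM B).subtype
  have hfinQ : Module.Finite ℂ (cocM B ⧸ W) := by
    let y : Y → cocM B := fun y => ⟨cur y.1, hY y.1 y.2⟩
    have : Submodule.span ℂ (Set.range fun a => W.mkQ (y a)) = ⊤ := by
      rw [eq_top_iff]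
      rintro q -
      obtain ⟨g, rfl⟩ := W.mkQ_surjective q
      obtain ⟨c, hc⟩ := hfin g.1 g.2
      have : W.mkQ g = ∑ a, c a • W.mkQ (y a) := by
        rw [← sub_eq_zero]
        simp only [← map_smul, ← map_sum, ← map_sub]
        rw [Submodule.mkQ_apply, Submodule.Quotient.mk_eq_zero]
        change (g - ∑ a, c a • y a : cocM B).1 ∈ splM A
        have e : (g - ∑ a, c a • y a : cocM B).1 = g.1 - ∑ a, c a • cur a.1 := by
          rw [AddSubgroupClass.coe_sub, AddSubmonoidClass.coe_finset_sum]
          rfl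
        rw [e]
        exact hc
      rw [this]
      exact Submodule.sum_mem _ fun a _ => Submodule.smul_mem _ _ (Submodule.subset_span ⟨a, rfl⟩)
    exact ⟨by rw [← this]; exact Submodule.fg_span (Set.finite_range _)⟩
  obtain ⟨k⟩ := ‹Nonempty κ›
  let a : (cocM B ⧸ W) →ₗ[ℂ] (cocM B ⧸ W) := W.mapQ W (derL hB k) (fun g hg => derK_spl hA hAB k hg)
  let b : (cocM B ⧸ W) →ₗ[ℂ] (cocM B ⧸ W) := W.mapQ W (mulL B k) (fun g hg => mulK_spl k hg)
  have hab : a * b - b * a = 1 := by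
    apply LinearMap.ext
    intro q
    obtain ⟨g, rfl⟩ := W.mkQ_surjective q
    change W.mkQ (derL hB k (mulL B k g)) - W.mkQ (mulL B k (derL hB k g)) = W.mkQ g
    rw [← sub_eq_zero, ← map_sub, ← map_sub, Submodule.mkQ_apply, Submodule.Quotient.mk_eq_zero]
    refine ⟨0, fun i => differentiableOn_const _, ?_⟩
    intro i j z hi hj
    have hz : z ∈ B i ∩ B j := ⟨hAB i hi, hAB j hj⟩
    change derK B k (mulK k g.1) i j z - z k * derK B k g.1 i j z - g.1 i j z = 0 - 0
    simp only [derK, if_pos hz]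
    have n := ((hB i).inter (hB j)).mem_nhds hz
    have hd := (g.2.1 i j).differentiableAt n
    have : fderiv ℂ (mulK k g.1 i j) z = (z k) • fderiv ℂ (g.1 i j) z + (g.1 i j z) • (ContinuousLinearMap.proj (R := ℂ) (φ := fun _ : κ => ℂ) k) := by
      have h1 : HasFDerivAt (fun z : κ → ℂ => z k) (ContinuousLinearMap.proj (R := ℂ) (φ := fun _ : κ => ℂ) k) z :=
        (ContinuousLinearMap.proj (R := ℂ) (φ := fun _ : κ => ℂ) k).hasFDerivAt
      exact (h1.mul hd.hasFDerivAt).fderiv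
    rw [this]
    simp
  have ss := trace_trick a b hab
  have : W.mkQ ⟨g, hg⟩ = 0 := Subsingleton.elim _ _
  rw [Submodule.mkQ_apply, Submodule.Quotient.mk_eq_zero] at this
  exact this

end weyl

section psh
variable {κ : Type} [Fintype κ] [DecidableEq κ]

lemma eu_le_card (z : κ → ℂ) {r : ℝ} (h : ‖z‖ ≤ r) : eu z ≤ Fintype.card κ * r ^ 2 := by
  have h0 : 0 ≤ r := (norm_nonneg _).trans h
  unfold eu
  calc ∑ k, ‖z k‖ ^ 2 ≤ ∑ _k : κ, r ^ 2 := by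
        refine Finset.sum_le_sum fun k _ => ?_
        gcongr
        exact (norm_le_pi_norm z k).trans h
    _ = _ := by simp

lemma lc_sub (i : κ × Bool) (z w : κ → ℂ) : lc i (z - w) = lc i z - lc i w := by
  unfold lc; split <;> simp

lemma abs_lc_le (i : κ × Bool) (z : κ → ℂ) : |lc i z| ≤ ‖z i.1‖ := by
  unfold lc; split
  · exact Complex.abs_re_le_norm _
  · exact Complex.abs_im_le_norm _

def qbox (R : ℝ) (p : κ → ℂ) : Set (κ → ℂ) := box (fun i => lc i p - R) (fun i => lc i p + R)

lemma mem_qbox {R : ℝ} {p z : κ → ℂ} : z ∈ qbox R p ↔ ∀ i, |lc i (z - p)| ≤ R := by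
  unfold qbox box
  simp only [mem_ofPred_eq, lc_sub, abs_le]
  refine forall_congr' fun i => ?_
  constructor <;> rintro ⟨h1, h2⟩ <;> constructor <;> linarith

lemma qbox_sub {R : ℝ} (hR : 0 ≤ R) (p : κ → ℂ) : qbox R p ⊆ closedBall p (2 * R) := by
  intro z hz
  rw [mem_qbox] at hz
  rw [mem_closedBall, dist_eq_norm, pi_norm_le_iff_of_nonneg (by linarith)]
  intro k
  have h1 := hz (k, true)
  have h2 := hz (k, false)
  simp only [lc] at h1 h2
  have := Complex.norm_le_abs_re_add_abs_im ((z - p) k)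
  simp at h1 h2 this ⊢
  linarith

lemma ball_sub_qbox {R : ℝ} (p : κ → ℂ) : closedBall p R ⊆ qbox R p := by
  intro z hz
  rw [mem_qbox]
  intro i
  rw [mem_closedBall, dist_eq_norm] at hz
  exact (abs_lc_le i _).trans ((norm_le_pi_norm _ _).trans hz)

lemma chi_off {R : ℝ} (hR : 0 ≤ R) {p z : κ → ℂ} (hz : z ∉ qbox R p) : chi R p z = 0 := by
  rw [mem_qbox] at hz
  push Not at hz
  obtain ⟨i, hi⟩ := hz
  have h1 := abs_lc_le i (z - p)
  have h2 : ‖(z - p) i.1‖ ^ 2 ≤ eu (z - p) :=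
    Finset.single_le_sum (f := fun k => ‖(z - p) k‖ ^ 2) (fun _ _ => sq_nonneg _) (Finset.mem_univ i.1)
  have h3 : R ^ 2 ≤ ‖(z - p) i.1‖ ^ 2 := by
    gcongr
    linarith
  unfold chi
  rw [max_eq_left (by linarith)]
  simp

/-- Cocycles split on strict sublevel sets of `∑ |f_j|^2 - c`. -/
theorem psh_split [Nonempty κ] {m : ℕ} {M U0 : Set (κ → ℂ)} (hM : IsCompact M) (oU0 : IsOpen U0) (hMU : M ⊆ U0)
    {f : Fin m → (κ → ℂ) → ℂ} {τ c : ℝ} (hτ0 : 0 < τ) (hf : ∀ j, DifferentiableOn ℂ (f j) U0)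
    (hτ : ∀ z w, τ * eu (z - w) ≤ ∑ j, ‖f j z - f j w‖ ^ 2)
    (hb : ∀ z ∈ M, z ∉ interior M → 1 ≤ ∑ j, ‖f j z‖ ^ 2 - c)
    {ι : Type} {U : ι → Set (κ → ℂ)} (oU : ∀ i, IsOpen (U i)) (hMc : M ⊆ ⋃ i, U i)
    {g : ι → ι → (κ → ℂ) → ℂ} (hg : IsCoc U g) :
    SplitsOn U g {z ∈ interior M | ∑ j, ‖f j z‖ ^ 2 - c < 0} := by
  classical
  set ρ : (κ → ℂ) → ℝ := fun z => ∑ j, ‖f j z‖ ^ 2 - c with hρ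
  have ρc : ContinuousOn ρ U0 :=
    (continuousOn_finsetSum _ fun j _ => ((hf j).continuousOn.norm.pow 2)).sub continuousOn_const
  have ρcM : ContinuousOn ρ M := ρc.mono hMU
  have sub_closed : ∀ (φ : (κ → ℂ) → ℝ), Continuous φ → IsCompact {z ∈ M | ρ z ≤ φ z} := by
    intro φ hφ
    refine hM.of_isClosed_subset ?_ fun z hz => hz.1
    exact hM.isClosed.isClosed_le ρcM hφ.continuousOn
  have int_of : ∀ z ∈ M, ρ z < 1 → z ∈ interior M := by
    intro z hz h
    by_contra h'
    exact absurd (hb z hz h') (not_le.2 h)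
  have sub_open : ∀ t : ℝ, IsOpen {z ∈ interior M | ρ z < t} := fun t =>
    (ρc.mono (interior_subset.trans hMU)).isOpen_inter_preimage isOpen_interior isOpen_Iio
  set M0 := {z ∈ M | ρ z ≤ 1 / 2} with hM0
  have cM0 : IsCompact M0 := sub_closed _ continuous_const
  obtain ⟨δ0, hδ0, hleb⟩ := lebesgue_number_lemma_of_metric (c := fun i => U i ∩ interior M) cM0
    (fun i => (oU i).inter isOpen_interior) (by
      rintro z ⟨hz, hz'⟩
      obtain ⟨i, hi⟩ := mem_iUnion.1 (hMc hz)
      exact mem_iUnion.2 ⟨i, hi, int_of z hz (by linarith)⟩)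
  set R := δ0 / 3 with hR
  have R0 : 0 < R := by positivity
  have hN : (1 : ℝ) ≤ Fintype.card κ := by exact_mod_cast Fintype.card_pos
  set N : ℝ := (Fintype.card κ : ℝ) with hNdef
  set r0 := R / (4 * N) with hr0
  have r00 : 0 < r0 := by positivity
  have r03 : 3 * r0 ≤ R := by
    rw [hr0, ← mul_div_assoc, div_le_iff₀ (by positivity)]
    nlinarith
  have r0N : N * r0 ^ 2 ≤ R ^ 2 / 2 := by
    rw [hr0, div_pow, mul_pow]
    rw [← mul_div_assoc, div_le_div_iff₀ (by positivity) (by positivity)]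
    nlinarith [sq_nonneg R, mul_nonneg (sq_nonneg R) (by linarith : 0 ≤ N), mul_nonneg (mul_nonneg (sq_nonneg R) (by linarith : 0 ≤ N)) (by linarith : 0 ≤ N - 1)]
  obtain ⟨t, htM, hcov⟩ := cM0.elim_nhds_subcover (fun p => ball p r0) (fun p _ => ball_mem_nhds p r00)
  have hcov' : ∀ z ∈ M0, ∃ i : t, z ∈ ball i.1 r0 := by
    intro z hz
    obtain ⟨i, hi, h⟩ := mem_iUnion₂.1 (hcov hz)
    exact ⟨⟨i, hi⟩, h⟩
  choose σ hσ using fun i : t => hleb i.1 (htM i.1 i.2)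
  have hQ : ∀ i : t, qbox R i.1 ⊆ U (σ i) ∩ interior M := fun i => by
    refine ((qbox_sub R0.le _).trans (closedBall_subset_ball ?_)).trans (hσ i)
    rw [hR]; linarith
  obtain ⟨d, hd⟩ : ∃ d, ∀ z ∈ M, ∀ w ∈ M, eu (z - w) ≤ d := by
    have := (hM.prod hM).bddAbove_image (f := fun q : (κ → ℂ) × (κ → ℂ) => eu (q.1 - q.2))
      (continuous_eu.comp (continuous_fst.sub continuous_snd)).continuousOn
    obtain ⟨d, hd⟩ := this
    exact ⟨d, fun z hz w hw => hd ⟨(z, w), ⟨hz, hw⟩, rfl⟩⟩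
  set D := max d 0
  set ε := τ / (t.card * (16 * D) + 1) with hε
  have ε0 : 0 < ε := by positivity
  have hεd : ∀ s : Finset t, ε * (s.card * (16 * D)) ≤ τ := by
    intro s
    have h1 : (s.card : ℝ) ≤ t.card := by
      have := Finset.card_le_univ s
      rw [Fintype.card_coe] at this
      exact_mod_cast this
    have hD : 0 ≤ D := le_max_right _ _
    rw [hε, div_mul_eq_mul_div, div_le_iff₀ (by positivity)]
    gcongr
    nlinarith
  let K : Finset t → Set (κ → ℂ) := fun s => {z ∈ M | ρ z ≤ ε * ∑ i ∈ s, chi R i.1 z}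
  have cK : ∀ s, IsCompact (K s) := fun s => sub_closed _
    (continuous_const.mul (continuous_finsetSum _ fun i _ => continuous_chi R i.1))
  have qM : ∀ i : t, qbox R i.1 ⊆ M := fun i => (hQ i).trans (inter_subset_right.trans interior_subset)
  have hH1 : ∀ s (i : t), H1 (K s ∩ qbox R i.1) := by
    intro s i
    have h := lowerSup_main (U := U0) (Q := qbox R i.1) (f := f) (τ := τ) (c := c) (d := D) (ε := ε) (R := R)
      (s := s) (p := fun i : t => i.1) hf (fun z _ w _ => hτ z w)
      (fun z hz j => (hd z (qM i hz) j.1 (htM j.1 j.2).1).trans (le_max_left _ _)) ε0.le (hεd s)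
    have h := H1_of_lowerSup oU0 ((qM i).trans hMU) h
    convert h using 1
    ext z
    constructor
    · rintro ⟨⟨h1, h2⟩, h3⟩
      refine ⟨h3, ?_⟩
      change ρ z - _ ≤ 0
      linarith
    · rintro ⟨h1, h2⟩
      refine ⟨⟨qM i h1, ?_⟩, h1⟩
      change ρ z - _ ≤ 0 at h2
      linarith
  have hmono : ∀ s (i : t), i ∉ s → K s ⊆ K (insert i s) := by
    rintro s i hi z ⟨h1, h2⟩
    refine ⟨h1, h2.trans ?_⟩
    rw [Finset.sum_insert hi]
    have := chi_nonneg R i.1 z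
    gcongr
    linarith
  have hext : ∀ s, K ∅ ⊆ K s ∧ CExt (K ∅) (K s) := by
    intro s
    induction s using Finset.induction_on with
    | empty => exact ⟨subset_rfl, CExt_refl _⟩
    | insert i s hi ih =>
      refine ⟨ih.1.trans (hmono s i hi), CExt_trans ih.1 ih.2 ?_⟩
      have e : K (insert i s) = K s ∪ (K (insert i s) ∩ qbox R i.1) := by
        apply Subset.antisymm
        · intro z hz
          by_cases hq : z ∈ qbox R i.1
          · exact Or.inr ⟨hz, hq⟩
          · left
            refine ⟨hz.1, ?_⟩
            have := hz.2
            rw [Finset.sum_insert hi, chi_off R0.le hq, zero_add] at this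
            exact this
        · exact union_subset (hmono s i hi) inter_subset_left
      rw [e]
      refine CExt_step (cK s) ((cK _).inter_right (isClosed_box _ _)) ?_
      have : K s ∩ (K (insert i s) ∩ qbox R i.1) = K s ∩ qbox R i.1 := by
        ext z
        exact ⟨fun h => ⟨h.1, h.2.2⟩, fun h => ⟨h.1, hmono s i hi h.1, h.2⟩⟩
      rw [this]
      exact hH1 s i
  set s2 : ℝ := min (ε * (R ^ 4 / 4)) (1 / 2) with hs2
  have s20 : 0 < s2 := by positivity
  set Dm := {z ∈ interior M | ρ z < 0} with hDm
  set D1 := {z ∈ interior M | ρ z < s2 / 2} with hD1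
  set D2 := {z ∈ interior M | ρ z < s2} with hD2
  have hK0D : K ∅ ⊆ D1 := by
    rintro z ⟨h1, h2⟩
    simp only [Finset.sum_empty, mul_zero] at h2
    exact ⟨int_of z h1 (by linarith), by linarith⟩
  have hD2K : D2 ⊆ K Finset.univ := by
    rintro z ⟨h1, h2⟩
    have hz : z ∈ M0 := ⟨interior_subset h1, h2.le.trans (min_le_right _ _)⟩
    refine ⟨hz.1, (h2.le.trans (min_le_left _ _)).trans ?_⟩
    obtain ⟨i, hi⟩ := hcov' z hz
    have h3 : chi R i.1 z ≤ ∑ i : t, chi R i.1 z :=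
      Finset.single_le_sum (f := fun i : t => chi R i.1 z) (fun i _ => chi_nonneg _ _ _) (Finset.mem_univ i)
    have h4 : R ^ 4 / 4 ≤ chi R i.1 z := by
      rw [mem_ball, dist_eq_norm] at hi
      have := (eu_le_card _ hi.le).trans r0N
      unfold chi
      have h5 : R ^ 2 / 2 ≤ max 0 (R ^ 2 - eu (z - i.1)) := le_max_of_le_right (by linarith)
      calc R ^ 4 / 4 = (R ^ 2 / 2) ^ 2 := by ring
        _ ≤ _ := by gcongr
    gcongr
    linarith
  let A : t → Set (κ → ℂ) := fun i => Dm ∩ ball i.1 r0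
  let B : t → Set (κ → ℂ) := fun i => D1 ∩ ball i.1 (2 * r0)
  let C : t → Set (κ → ℂ) := fun i => D2 ∩ ball i.1 (3 * r0)
  have oA : ∀ i, IsOpen (A i) := fun i => (sub_open 0).inter isOpen_ball
  have oB : ∀ i, IsOpen (B i) := fun i => (sub_open _).inter isOpen_ball
  have oC : ∀ i, IsOpen (C i) := fun i => (sub_open _).inter isOpen_ball
  have hAB : ∀ i, A i ⊆ B i := fun i z hz =>
    ⟨⟨hz.1.1, hz.1.2.trans (by positivity)⟩, ball_subset_ball (by linarith) hz.2⟩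
  have hCQ : ∀ i : t, C i ⊆ K Finset.univ ∩ qbox R i.1 := fun i z hz =>
    ⟨hD2K hz.1, ball_sub_qbox _ (ball_subset_closedBall (ball_subset_ball r03 hz.2))⟩
  have hDmK : Dm ⊆ K ∅ := by
    rintro z ⟨h1, h2⟩
    refine ⟨interior_subset h1, ?_⟩
    simp only [Finset.sum_empty, mul_zero]
    exact h2.le
  have hK0M : K ∅ ⊆ M0 := by
    rintro z ⟨h1, h2⟩
    simp only [Finset.sum_empty, mul_zero] at h2
    exact ⟨h1, by linarith⟩
  obtain ⟨δ, hδ, hBC⟩ : ∃ δ > 0, ∀ i, ∀ z ∈ B i, ball z δ ⊆ C i := by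
    have c1 : IsCompact {z ∈ M | ρ z ≤ s2 / 2} := sub_closed _ continuous_const
    obtain ⟨δ1, hδ1, h1⟩ := c1.exists_thickening_subset_open (sub_open s2) (by
      rintro z ⟨h1, h2⟩
      have : s2 ≤ 1 / 2 := min_le_right _ _
      exact ⟨int_of z h1 (by linarith), show ρ z < s2 by linarith⟩)
    refine ⟨min δ1 r0, by positivity, ?_⟩
    rintro i z ⟨hz1, hz2⟩ w hw
    rw [mem_ball] at hw hz2
    refine ⟨h1 (mem_thickening_iff.2 ⟨z, ⟨interior_subset hz1.1, hz1.2.le⟩, hw.trans_le (min_le_left _ _)⟩), ?_⟩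
    rw [mem_ball]
    have := dist_triangle w z i.1
    have := min_le_right δ1 r0
    linarith
  have hsolv : Solv A B C := by
    intro g hg
    obtain ⟨V, T, z', h, oV, hV, hz', oT, hT, dh, heq⟩ := leray (hext Finset.univ).2 (O := B)
      (Q := fun i : t => qbox R i.1) oB (by
        intro z hz
        obtain ⟨i, hi⟩ := hcov' z (hK0M hz)
        exact mem_iUnion.2 ⟨i, hK0D hz, ball_subset_ball (by linarith) hi⟩) hg (fun i => hH1 _ i)
    have hAT : ∀ i : t, K ∅ ∩ closedBall i.1 r0 ⊆ T i := fun i z hz => hT i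
      ⟨⟨⟨hz.1, (hext Finset.univ).1 hz.1⟩, hK0D hz.1, closedBall_subset_ball (by linarith) hz.2⟩,
        ball_sub_qbox _ (closedBall_subset_closedBall (by linarith) hz.2)⟩
    have hAK : ∀ i : t, A i ⊆ K ∅ ∩ closedBall i.1 r0 := fun i z hz => ⟨hDmK hz.1, ball_subset_closedBall hz.2⟩
    have b1 : ∀ i : t, ∃ m, ∀ z ∈ A i, ‖h i z‖ ≤ m := by
      intro i
      obtain ⟨m, hm⟩ := ((cK ∅).inter_right isClosed_closedBall).exists_bound_of_continuousOn
        ((dh i).continuousOn.mono (hAT i))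
      exact ⟨m, fun z hz => hm z (hAK i hz)⟩
    have b2 : ∀ q : t × t, ∃ m, ∀ z ∈ C q.1 ∩ C q.2, ‖z' q.1 q.2 z‖ ≤ m := by
      intro q
      have cc : IsCompact ((K Finset.univ ∩ qbox R q.1.1) ∩ (K Finset.univ ∩ qbox R q.2.1)) :=
        ((cK Finset.univ).inter_right (isClosed_box _ _)).inter_right ((cK Finset.univ).isClosed.inter (isClosed_box _ _))
      obtain ⟨m, hm⟩ := cc.exists_bound_of_continuousOn
        ((hz'.1 q.1 q.2).continuousOn.mono (inter_subset_inter (hV _) (hV _)))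
      exact ⟨m, fun z hz => hm z ⟨hCQ _ hz.1, hCQ _ hz.2⟩⟩
    choose m1 hm1 using b1
    choose m2 hm2 using b2
    refine ⟨z', h, ∑ i, |m1 i| + ∑ q, |m2 q|, hz'.mono fun i => (hCQ i).trans (hV i), ?_,
      fun i => (dh i).mono ((hAK i).trans (hAT i)), ?_, ?_⟩
    · intro i j z hz
      have := hm2 (i, j) z hz
      have h1 : |m2 (i, j)| ≤ ∑ q, |m2 q| :=
        Finset.single_le_sum (f := fun q => |m2 q|) (fun _ _ => abs_nonneg _) (Finset.mem_univ (i, j))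
      have h2 : 0 ≤ ∑ i, |m1 i| := Finset.sum_nonneg fun _ _ => abs_nonneg _
      have := le_abs_self (m2 (i, j))
      dsimp only at *
      linarith
    · intro i z hz
      have := hm1 i z hz
      have h1 : |m1 i| ≤ ∑ q, |m1 q| :=
        Finset.single_le_sum (f := fun q => |m1 q|) (fun _ _ => abs_nonneg _) (Finset.mem_univ i)
      have h2 : 0 ≤ ∑ i, |m2 i| := Finset.sum_nonneg fun _ _ => abs_nonneg _
      have := le_abs_self (m1 i)
      linarith
    · intro i j z hi hj
      exact heq i j z (hAT i (hAK i hi)) (hAT j (hAK j hj))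
  have hBU : ∀ i : t, B i ⊆ U (σ i) := fun i z hz =>
    (hQ i (ball_sub_qbox _ (ball_subset_closedBall (ball_subset_ball (by linarith) hz.2)))).1
  obtain ⟨h, dh, he⟩ := solv_split oA oB oC hAB
    (fun i => isBounded_ball.subset inter_subset_right) hδ hBC hsolv
    (g := fun i j => g (σ i) (σ j)) (IsCoc.mono ⟨fun i j => hg.1 _ _, fun i j k => hg.2 _ _ _⟩ hBU)
  -- transfer
  have hAU : ∀ i : t, A i ⊆ U (σ i) := fun i => (hAB i).trans (hBU i)
  have hDA : ∀ z ∈ Dm, ∃ i : t, z ∈ A i := fun z hz => by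
    obtain ⟨i, hi⟩ := hcov' z (hK0M (hDmK hz))
    exact ⟨i, hz, hi⟩
  choose ι0 hι0 using hDA
  have key : ∀ u z i j, z ∈ U u → z ∈ A i → z ∈ A j →
      g u (σ i) z + h i z = g u (σ j) z + h j z := by
    intro u z i j hu hi hj
    have h1 := hg.2 u (σ i) (σ j) z hu (hAU i hi) (hAU j hj)
    have h2 : g (σ i) (σ j) z = h i z - h j z := he i j z hi hj
    rw [← h1, h2]; ring
  refine ⟨fun u z => if hz : z ∈ Dm then g u (σ (ι0 z hz)) z + h (ι0 z hz) z else 0, ?_, ?_⟩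
  · intro u
    apply diffOn_of_local
    rintro x ⟨hxu, hx⟩
    refine ⟨U u ∩ A (ι0 x hx), fun z => g u (σ (ι0 x hx)) z + h (ι0 x hx) z, (oU u).inter (oA _), ⟨hxu, hι0 x hx⟩, ?_, ?_⟩
    · exact ((hg.1 _ _).mono (inter_subset_inter_right _ (hAU _))).add ((dh _).mono inter_subset_right)
    · rintro z ⟨hzu, hz⟩
      dsimp only
      rw [dif_pos hz.1]
      exact key u z _ _ hzu (hι0 z hz.1) hz
  · intro u v z hu hv hz
    have hz : z ∈ Dm := hz
    have hi := hι0 z hz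
    simp only [dif_pos hz]
    have h1 := hg.2 u v (σ (ι0 z hz)) z hu hv (hAU _ hi)
    rw [← h1]; ring

end psh

section hconv
variable {X : Type*} [NormedAddCommGroup X] [NormedSpace ℂ X]

/-- `L` compact in the open `Ω`, and every point of `Ω` off `L` is separated from `L` by holomorphic functions. -/
def HConv (L Ω : Set X) : Prop :=
  IsOpen Ω ∧ L ⊆ Ω ∧ IsCompact L ∧ ∀ p ∈ Ω, p ∉ L → ∃ g : X → ℂ, DifferentiableOn ℂ g Ω ∧
    (∀ z ∈ L, ‖g z‖ ≤ 1) ∧ 1 < ‖g p‖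

def H1u (L : Set X) : Prop :=
  ∀ (ι : Type) (U : ι → Set X), (∀ i, IsOpen (U i)) → L ⊆ ⋃ i, U i →
    ∃ V, IsOpen V ∧ L ⊆ V ∧ ∀ g : ι → ι → X → ℂ, IsCoc U g → SplitsOn U g V

lemma H1u_of_HConv_pi {κ : Type} [Fintype κ] [DecidableEq κ] [Nonempty κ] {L Ω : Set (κ → ℂ)}
    (h : HConv L Ω) : H1u L := by
  classical
  obtain ⟨oΩ, hLΩ, hL, hg⟩ := h
  intro ι U oU hU
  obtain ⟨M, hM, hLM, hMU⟩ := exists_compact_between hL (oΩ.inter (isOpen_iUnion oU)) (subset_inter hLΩ hU)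
  have cF : IsCompact (M \ interior M) := hM.diff isOpen_interior
  choose! G dG G1 G2 using hg
  have hF : ∀ p ∈ M \ interior M, p ∈ Ω ∧ p ∉ L := fun p hp => ⟨(hMU hp.1).1, fun h => hp.2 (hLM h)⟩
  obtain ⟨t, ht, hcov⟩ := cF.elim_nhds_subcover (fun p => {z ∈ Ω | (1 + ‖G p p‖) / 2 < ‖G p z‖}) (by
    intro p hp
    obtain ⟨h1, h2⟩ := hF p hp
    refine IsOpen.mem_nhds ?_ ⟨h1, ?_⟩
    · exact (dG p h1 h2).continuousOn.norm.isOpen_inter_preimage oΩ isOpen_Ioi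
    · have := G2 p h1 h2; change _ < ‖G p p‖; linarith)
  -- a power making everything large
  obtain ⟨k, hk⟩ : ∃ k : ℕ, ∀ p ∈ t, (t.card : ℝ) + 4 ≤ ((1 + ‖G p p‖) / 2) ^ (2 * k) := by
    have : ∀ p ∈ t, ∀ᶠ k : ℕ in atTop, (t.card : ℝ) + 4 ≤ ((1 + ‖G p p‖) / 2) ^ (2 * k) := by
      intro p hp
      obtain ⟨h1, h2⟩ := hF p (ht p hp)
      have h3 : 1 < (1 + ‖G p p‖) / 2 := by have := G2 p h1 h2; linarith
      have h4 : 1 < ((1 + ‖G p p‖) / 2) ^ 2 := one_lt_pow₀ h3 two_ne_zero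
      have := (tendsto_pow_atTop_atTop_of_one_lt h4).eventually_ge_atTop ((t.card : ℝ) + 4)
      filter_upwards [this] with k hk
      rw [pow_mul]; exact hk
    exact ((Finset.eventually_all t).2 this).exists
  obtain ⟨d, hd⟩ := hL.bddAbove_image (f := eu) continuous_eu.continuousOn
  set D := max d 0
  have D0 : 0 ≤ D := le_max_right _ _
  set τ := 1 / (D + 1) with hτ
  have τ0 : 0 < τ := by positivity
  have hτD : ∀ z ∈ L, τ * eu z ≤ 1 := by
    intro z hz
    have : eu z ≤ D := (hd ⟨z, hz, rfl⟩).trans (le_max_left _ _)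
    rw [hτ, one_div_mul_eq_div, div_le_one (by positivity)]
    linarith
  let F : t ⊕ κ → (κ → ℂ) → ℂ := Sum.elim (fun p z => G p.1 z ^ k) (fun q z => (Real.sqrt τ : ℂ) * z q)
  have Fsum : ∀ z, ∑ j, ‖F j z‖ ^ 2 = ∑ p : t, ‖G p.1 z‖ ^ (2 * k) + τ * eu z := by
    intro z
    rw [Fintype.sum_sum_type]
    congr 1
    · refine Finset.sum_congr rfl fun p _ => ?_
      simp only [F, Sum.elim_inl, norm_pow]
      rw [← pow_mul, mul_comm]
    · rw [eu, Finset.mul_sum]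
      refine Finset.sum_congr rfl fun p _ => ?_
      simp only [F, Sum.elim_inr, norm_mul, Complex.norm_real, mul_pow, Real.norm_eq_abs, sq_abs]
      rw [Real.sq_sqrt τ0.le]
  have dF : ∀ j, DifferentiableOn ℂ (F j) Ω := by
    rintro (p | q)
    · obtain ⟨h1, h2⟩ := hF p.1 (ht p.1 p.2)
      exact (dG p.1 h1 h2).pow k
    · exact DifferentiableOn.const_mul (by fun_prop) _
  let e := Fintype.equivFin (t ⊕ κ)
  have esum : ∀ φ : t ⊕ κ → ℝ, ∑ j, φ (e.symm j) = ∑ j, φ j := fun φ => Equiv.sum_comp e.symm φ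
  have key : ∀ g : ι → ι → (κ → ℂ) → ℂ, IsCoc U g → SplitsOn U g
      {z ∈ interior M | ∑ j, ‖F (e.symm j) z‖ ^ 2 - (t.card + 2 : ℝ) < 0} := by
    intro g hg
    refine psh_split (f := fun j => F (e.symm j)) hM oΩ (fun z hz => (hMU hz).1) τ0 (fun j => dF _) ?_ ?_ oU (fun z hz => (hMU hz).2) hg
    · intro z w
      rw [esum (fun j => ‖F j z - F j w‖ ^ 2), Fintype.sum_sum_type]
      have h1 : 0 ≤ ∑ p : t, ‖F (Sum.inl p) z - F (Sum.inl p) w‖ ^ 2 := Finset.sum_nonneg fun _ _ => sq_nonneg _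
      have h2 : ∑ q : κ, ‖F (Sum.inr q) z - F (Sum.inr q) w‖ ^ 2 = τ * eu (z - w) := by
        rw [eu, Finset.mul_sum]
        refine Finset.sum_congr rfl fun p _ => ?_
        simp only [F, Sum.elim_inr, ← mul_sub, norm_mul, Complex.norm_real, mul_pow, Real.norm_eq_abs, sq_abs]
        rw [Real.sq_sqrt τ0.le]; rfl
      linarith
    · intro z hz hz'
      rw [esum (fun j => ‖F j z‖ ^ 2), Fsum]
      obtain ⟨p, hp, h⟩ := mem_iUnion₂.1 (hcov ⟨hz, hz'⟩)
      have h1 : ‖G p z‖ ^ (2 * k) ≤ ∑ p : t, ‖G p.1 z‖ ^ (2 * k) :=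
        Finset.single_le_sum (f := fun p : t => ‖G p.1 z‖ ^ (2 * k)) (fun _ _ => by positivity) (Finset.mem_univ ⟨p, hp⟩)
      have h2 : ((1 + ‖G p p‖) / 2) ^ (2 * k) ≤ ‖G p z‖ ^ (2 * k) := by
        gcongr
        exact h.2.le
      have h3 := mul_nonneg τ0.le (eu_nonneg z)
      have := hk p hp
      linarith
  refine ⟨_, ?_, ?_, key⟩
  · have : ContinuousOn (fun z => ∑ j, ‖F (e.symm j) z‖ ^ 2 - (t.card + 2 : ℝ)) Ω :=
      (continuousOn_finsetSum _ fun j _ => ((dF _).continuousOn.norm.pow 2)).sub continuousOn_const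
    exact (this.mono (interior_subset.trans fun z hz => (hMU hz).1)).isOpen_inter_preimage isOpen_interior isOpen_Iio
  · intro z hz
    refine ⟨hLM hz, ?_⟩
    rw [esum (fun j => ‖F j z‖ ^ 2), Fsum]
    have h1 : ∑ p : t, ‖G p.1 z‖ ^ (2 * k) ≤ ∑ _p : t, (1 : ℝ) := by
      refine Finset.sum_le_sum fun p _ => ?_
      obtain ⟨h1, h2⟩ := hF p.1 (ht p.1 p.2)
      exact pow_le_one₀ (norm_nonneg _) (G1 p.1 h1 h2 z hz)
    have h2 := hτD z hz
    rw [Finset.sum_const, Finset.card_univ, Fintype.card_coe, nsmul_eq_mul, mul_one] at h1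
    linarith

lemma H1u_of_HConv [FiniteDimensional ℂ X] [Nontrivial X] {L Ω : Set X} (h : HConv L Ω) : H1u L := by
  classical
  obtain ⟨oΩ, hLΩ, hL, hg⟩ := h
  let e : X ≃L[ℂ] (Fin (Module.finrank ℂ X) → ℂ) := ContinuousLinearEquiv.ofFinrankEq (by simp)
  have : Nonempty (Fin (Module.finrank ℂ X)) := Fin.pos_iff_nonempty.1 Module.finrank_pos
  have h' : HConv (e.symm ⁻¹' L) (e.symm ⁻¹' Ω) := by
    refine ⟨oΩ.preimage e.symm.continuous, preimage_mono hLΩ, ?_, ?_⟩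
    · rw [← e.image_eq_preimage_symm]; exact hL.image e.continuous
    · intro p hp hp'
      obtain ⟨g, dg, g1, g2⟩ := hg _ hp hp'
      exact ⟨fun z => g (e.symm z), dg.comp e.symm.differentiable.differentiableOn fun z hz => hz,
        fun z hz => g1 _ hz, g2⟩
  intro ι U oU hU
  obtain ⟨V, oV, hV, hs⟩ := H1u_of_HConv_pi h' ι (fun i => e.symm ⁻¹' (U i))
    (fun i => (oU i).preimage e.symm.continuous) (by
      intro z hz
      obtain ⟨i, hi⟩ := mem_iUnion.1 (hU hz)
      exact mem_iUnion.2 ⟨i, hi⟩)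
  refine ⟨e ⁻¹' V, oV.preimage e.continuous, fun z hz => hV (by simpa using hz), fun g hg => ?_⟩
  obtain ⟨H, dH, eH⟩ := hs (fun i j z => g i j (e.symm z)) ⟨fun i j =>
    (hg.1 i j).comp e.symm.differentiable.differentiableOn fun z hz => hz, fun i j k z => hg.2 i j k _⟩
  refine ⟨fun i z => H i (e z), fun i => (dH i).comp e.differentiable.differentiableOn
    fun z hz => ⟨by simpa using hz.1, hz.2⟩, fun i j z hi hj hz => ?_⟩
  have := eH i j (e z) (by simpa using hi) (by simpa using hj) hz
  simpa using this

end hconv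

section HFsec
variable {P : Type*} [TopologicalSpace P]
variable {Y Y' X G : Type*} [NormedAddCommGroup Y] [NormedSpace ℂ Y] [NormedAddCommGroup Y'] [NormedSpace ℂ Y']
  [NormedAddCommGroup X] [NormedSpace ℂ X] [NormedAddCommGroup G] [NormedSpace ℂ G]

/-- Continuous families of holomorphic maps. -/
def HF (f : P → Y → G) (U : Set Y) : Prop :=
  (∀ ζ, DifferentiableOn ℂ (f ζ) U) ∧
    ContinuousOn (fun q : P × Y => f q.1 q.2) ((univ : Set P) ×ˢ U)

lemma HF.mono {f : P → Y → G} {U V : Set Y} (h : HF f U) (hV : V ⊆ U) : HF f V :=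
  ⟨fun ζ => (h.1 ζ).mono hV, h.2.mono (prod_mono subset_rfl hV)⟩

lemma HF.congr {f g : P → Y → G} {U : Set Y} (h : HF f U) (e : ∀ ζ, ∀ z ∈ U, g ζ z = f ζ z) : HF g U :=
  ⟨fun ζ => (h.1 ζ).congr (e ζ), h.2.congr fun q hq => e q.1 q.2 hq.2⟩

lemma HF.of_diff {f : Y → G} {U : Set Y} (h : DifferentiableOn ℂ f U) : HF (fun _ : P => f) U :=
  ⟨fun _ => h, h.continuousOn.comp continuousOn_snd fun _ hq => hq.2⟩

lemma HF.add {f g : P → Y → G} {U : Set Y} (hf : HF f U) (hg : HF g U) :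
    HF (fun ζ z => f ζ z + g ζ z) U := ⟨fun ζ => (hf.1 ζ).add (hg.1 ζ), hf.2.add hg.2⟩

lemma HF.sub {f g : P → Y → G} {U : Set Y} (hf : HF f U) (hg : HF g U) :
    HF (fun ζ z => f ζ z - g ζ z) U := ⟨fun ζ => (hf.1 ζ).sub (hg.1 ζ), hf.2.sub hg.2⟩

lemma HF.neg {f : P → Y → G} {U : Set Y} (hf : HF f U) :
    HF (fun ζ z => - f ζ z) U := ⟨fun ζ => (hf.1 ζ).neg, hf.2.neg⟩

lemma HF.prodMk {f : P → Y → G} {g : P → Y → X} {U : Set Y} (hf : HF f U) (hg : HF g U) :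
    HF (fun ζ z => (f ζ z, g ζ z)) U := ⟨fun ζ => (hf.1 ζ).prodMk (hg.1 ζ), hf.2.prodMk hg.2⟩

lemma HF.comp {f : P → Y → G} {g : P → Y' → Y} {U : Set Y} {V : Set Y'} (hf : HF f U) (hg : HF g V)
    (h : ∀ ζ, ∀ z ∈ V, g ζ z ∈ U) : HF (fun ζ z => f ζ (g ζ z)) V :=
  ⟨fun ζ => (hf.1 ζ).comp (hg.1 ζ) (h ζ),
   hf.2.comp (continuousOn_fst.prodMk hg.2) fun q hq => ⟨mem_univ _, h q.1 q.2 hq.2⟩⟩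

lemma HF.of_local {f : P → Y → G} {U : Set Y}
    (h : ∀ x ∈ U, ∃ W g, IsOpen W ∧ x ∈ W ∧ HF g W ∧ ∀ ζ, ∀ z ∈ W, f ζ z = g ζ z) : HF f U := by
  constructor
  · intro ζ
    apply diffOn_of_local
    intro x hx
    obtain ⟨W, g, oW, hxW, hg, e⟩ := h x hx
    exact ⟨W, g ζ, oW, hxW, hg.1 ζ, e ζ⟩
  · rintro ⟨ζ, x⟩ ⟨-, hx⟩
    obtain ⟨W, g, oW, hxW, hg, e⟩ := h x hx
    have n : (univ : Set P) ×ˢ W ∈ 𝓝 (ζ, x) := (isOpen_univ.prod oW).mem_nhds ⟨mem_univ _, hxW⟩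
    have := (hg.2.continuousAt n)
    refine (this.congr ?_).continuousWithinAt
    filter_upwards [n] with q hq using (e q.1 q.2 hq.2).symm

/-- glue two families which agree on the overlap -/
lemma HF.glue {f g : P → Y → G} {U V : Set Y} (oU : IsOpen U) (oV : IsOpen V) (hf : HF f U) (hg : HF g V)
    (e : ∀ ζ, ∀ z ∈ U ∩ V, f ζ z = g ζ z) :
    ∃ h : P → Y → G, HF h (U ∪ V) ∧ (∀ ζ, ∀ z ∈ U, h ζ z = f ζ z) ∧ ∀ ζ, ∀ z ∈ V, h ζ z = g ζ z := by
  classical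
  have e1 : ∀ ζ, ∀ z ∈ U, (if z ∈ U then f ζ z else g ζ z) = f ζ z := fun ζ z hz => if_pos hz
  have e2 : ∀ ζ, ∀ z ∈ V, (if z ∈ U then f ζ z else g ζ z) = g ζ z := by
    intro ζ z hz
    split_ifs with h
    · exact e ζ z ⟨h, hz⟩
    · rfl
  refine ⟨fun ζ z => if z ∈ U then f ζ z else g ζ z, HF.of_local ?_, e1, e2⟩
  rintro x (hx | hx)
  · exact ⟨U, f, oU, hx, hf, e1⟩
  · exact ⟨V, g, oV, hx, hg, e2⟩

lemma isClosed_HF [CompleteSpace G] {U : Set Y} (hU : IsOpen U) :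
    IsClosed {f : BF (P × Y) G | HF (fun ζ z => f (ζ, z)) U} := by
  have : {f : BF (P × Y) G | HF (fun ζ z => f (ζ, z)) U} =
      (⋂ ζ, {f : BF (P × Y) G | DifferentiableOn ℂ (fun z => f (ζ, z)) U}) ∩
        {f : BF (P × Y) G | ContinuousOn (fun q => f (id q)) ((univ : Set P) ×ˢ U)} := by
    ext f
    simp only [HF, mem_inter_iff, mem_iInter, mem_ofPred_eq, id]
  rw [this]
  exact (isClosed_iInter fun ζ => BF.isClosed_diffOn (fun z => (ζ, z)) hU).inter (BF.isClosed_contOn id)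

lemma lip_ball {f : X → G} {x : X} {η M : ℝ} (hη : 0 < η) (hf : DifferentiableOn ℂ f (ball x η))
    (hb : ∀ z ∈ ball x η, ‖f z‖ ≤ M) {z w : X} (hz : z ∈ ball x (η / 2)) (hw : w ∈ ball x (η / 2)) :
    ‖f z - f w‖ ≤ 4 * M / η * ‖z - w‖ := by
  refine (convex_ball x (η / 2)).norm_image_sub_le_of_norm_fderiv_le (𝕜 := ℂ) ?_ ?_ hw hz
  · intro y hy
    exact hf.differentiableAt (isOpen_ball.mem_nhds (ball_subset_ball (by linarith) hy))
  · intro y hy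
    have hs : ball y (η / 2) ⊆ ball x η := by
      intro u hu
      rw [mem_ball] at *
      have := dist_triangle u y x
      linarith
    have := cauchy_fderiv (x := y) (half_pos hη) (hf.mono hs) (fun z hz => hb z (hs hz))
    refine this.trans_eq ?_
    field_simp
    ring

/-- The fixed point lemma. -/
theorem fixpt [CompleteSpace X] {D : Set Y} (oD : IsOpen D) {η K M : ℝ} (hη : 0 < η) (hK : 0 ≤ K)
    (hM : 0 ≤ M) (h8 : 8 * K * M ≤ η) {H : P → Y × X → X} (hH : HF H (D ×ˢ ball 0 η))
    (hb : ∀ ζ, ∀ q ∈ D ×ˢ ball (0 : X) η, ‖H ζ q‖ ≤ M) (Λ : (P → Y → X) → P → Y → X)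
    (hΛ1 : ∀ x, HF x D → HF (Λ x) D)
    (hΛ2 : ∀ x x' B, HF x D → HF x' D → (∀ ζ, ∀ y ∈ D, ‖x ζ y - x' ζ y‖ ≤ B) →
      ∀ ζ, ∀ y ∈ D, ‖Λ x ζ y - Λ x' ζ y‖ ≤ K * B)
    (hΛ0 : ∀ ζ, ∀ y ∈ D, Λ (fun _ _ => 0) ζ y = 0) :
    ∃ x, HF x D ∧ (∀ ζ, ∀ y ∈ D, ‖x ζ y‖ ≤ M) ∧ (∀ ζ, ∀ y ∈ D, ‖Λ x ζ y‖ ≤ K * M) ∧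
      ∀ ζ, ∀ y ∈ D, x ζ y = H ζ (y, Λ x ζ y) := by
  classical
  have z0 : HF (fun (_ : P) (_ : Y) => (0 : X)) D := HF.of_diff (differentiableOn_const _)
  have hΛM : ∀ x, HF x D → (∀ ζ, ∀ y ∈ D, ‖x ζ y‖ ≤ M) → ∀ ζ, ∀ y ∈ D, ‖Λ x ζ y‖ ≤ K * M := by
    intro x hx hxM ζ y hy
    have := hΛ2 x _ M hx z0 (fun ζ y hy => by simpa using hxM ζ y hy) ζ y hy
    rwa [hΛ0 ζ y hy, sub_zero] at this
  have hKM : K * M < η / 2 := by nlinarith [mul_nonneg hK hM]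
  let S : Set (BF (P × Y) X) := {x | HF (fun ζ y => x (ζ, y)) D} ∩ closedBall 0 M
  have cS : IsComplete S := ((isClosed_HF oD).inter isClosed_closedBall).isComplete
  have hSM : ∀ x ∈ S, ∀ ζ, ∀ y ∈ D, ‖x (ζ, y)‖ ≤ M := by
    intro x hx ζ y _
    have := hx.2
    rw [mem_closedBall, dist_zero_right] at this
    exact (BF.le x _).trans this
  let Φ0 : BF (P × Y) X → P × Y → X := fun x q =>
    if q.2 ∈ D ∧ x ∈ S then H q.1 (q.2, Λ (fun ζ y => x (ζ, y)) q.1 q.2) else 0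
  have hmem : ∀ x ∈ S, ∀ ζ, ∀ y ∈ D, (y, Λ (fun ζ y => x (ζ, y)) ζ y) ∈ D ×ˢ ball (0 : X) (η / 2) := by
    intro x hx ζ y hy
    refine ⟨hy, ?_⟩
    rw [mem_ball, dist_zero_right]
    exact (hΛM _ hx.1 (hSM x hx) ζ y hy).trans_lt hKM
  have hsub : D ×ˢ ball (0 : X) (η / 2) ⊆ D ×ˢ ball (0 : X) η :=
    prod_mono subset_rfl (ball_subset_ball (by linarith))
  have hΦ0 : ∀ x q, ‖Φ0 x q‖ ≤ M := by
    intro x q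
    simp only [Φ0]
    split_ifs with h
    · exact hb _ _ (hsub (hmem x h.2 _ _ h.1))
    · simpa using hM
  let Φ : BF (P × Y) X → BF (P × Y) X := fun x => BF.of (Φ0 x) ⟨M, hΦ0 x⟩
  have hΦe : ∀ x ∈ S, ∀ ζ, ∀ y ∈ D, Φ x (ζ, y) = H ζ (y, Λ (fun ζ y => x (ζ, y)) ζ y) := by
    intro x hx ζ y hy
    change Φ0 x (ζ, y) = _
    simp only [Φ0]
    rw [if_pos ⟨hy, hx⟩]
  have hmaps : MapsTo Φ S S := by
    intro x hx
    refine ⟨?_, ?_⟩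
    · change HF (fun ζ y => Φ x (ζ, y)) D
      refine HF.congr (hH.comp ((HF.of_diff differentiableOn_id).prodMk (hΛ1 _ hx.1)) ?_) (hΦe x hx)
      intro ζ y hy
      exact hsub (hmem x hx ζ y hy)
    · rw [mem_closedBall, dist_zero_right]
      exact BF.norm_le hM fun q => hΦ0 x q
  have hcontr : ContractingWith (1 / 2) (hmaps.restrict Φ S S) := by
    refine ⟨by norm_num, LipschitzWith.of_dist_le_mul ?_⟩
    rintro ⟨x, hx⟩ ⟨x', hx'⟩
    change dist (Φ x) (Φ x') ≤ _ * dist x x'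
    rw [dist_eq_norm, dist_eq_norm]
    refine BF.norm_le (by positivity) ?_
    rintro ⟨ζ, y⟩
    change ‖Φ0 x (ζ, y) - Φ0 x' (ζ, y)‖ ≤ _
    by_cases hy : y ∈ D
    · simp only [Φ0]
      rw [if_pos ⟨hy, hx⟩, if_pos ⟨hy, hx'⟩]
      have h1 := lip_ball (f := fun ξ => H ζ (y, ξ)) (x := 0) (M := M) hη
        ((hH.1 ζ).comp (by fun_prop) fun ξ hξ => ⟨hy, hξ⟩) (fun ξ hξ => hb ζ _ ⟨hy, hξ⟩)
        (hmem x hx ζ y hy).2 (hmem x' hx' ζ y hy).2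
      refine h1.trans ?_
      have h2 := hΛ2 _ _ ‖x - x'‖ hx.1 hx'.1 (fun ζ y _ => BF.le (x - x') (ζ, y)) ζ y hy
      have h3 : 4 * M / η * K ≤ 1 / 2 := by
        rw [div_mul_eq_mul_div, div_le_iff₀ hη]
        linarith
      calc _ ≤ 4 * M / η * (K * ‖x - x'‖) := by gcongr
        _ = (4 * M / η * K) * ‖x - x'‖ := by ring
        _ ≤ (1 / 2) * ‖x - x'‖ := by gcongr
        _ = _ := by norm_num
    · simp only [Φ0]
      rw [if_neg (fun h => hy h.1), if_neg (fun h => hy h.1)]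
      simp only [sub_zero, norm_zero]
      positivity
  have h0 : (0 : BF (P × Y) X) ∈ S := ⟨z0, by simpa using hM⟩
  obtain ⟨x, hxS, hx, -⟩ := hcontr.exists_fixedPoint' cS hmaps h0 (edist_ne_top _ _)
  refine ⟨fun ζ y => x (ζ, y), hxS.1, hSM x hxS, hΛM _ hxS.1 (hSM x hxS), fun ζ y hy => ?_⟩
  rw [← hΦe x hxS ζ y hy, hx]

lemma ball_thick {S : Set X} {r : ℝ} {z : X} (hz : z ∈ thickening (r / 2) S) : ball z (r / 2) ⊆ thickening r S := by
  intro w hw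
  rw [mem_thickening_iff] at *
  obtain ⟨s, hs, h⟩ := hz
  refine ⟨s, hs, ?_⟩
  rw [mem_ball] at hw
  have := dist_triangle w z s
  linarith

/-- inverse of a family of maps close to the identity -/
lemma HF.inv [CompleteSpace X] {S : Set X} {r M : ℝ} (hr : 0 < r) (hM : 0 ≤ M) (h16 : 16 * M ≤ r)
    {α : P → X → X} (hα : HF α (thickening r S)) (hb : ∀ ζ, ∀ z ∈ thickening r S, ‖α ζ z - z‖ ≤ M) :
    ∃ κ : P → X → X, HF κ (thickening (r / 2) S) ∧ (∀ ζ, ∀ y ∈ thickening (r / 2) S, ‖κ ζ y - y‖ ≤ M) ∧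
      ∀ ζ, ∀ y ∈ thickening (r / 2) S, α ζ (κ ζ y) = y := by
  have hin : ∀ q ∈ thickening (r / 2) S ×ˢ ball (0 : X) (r / 2), q.1 + q.2 ∈ thickening r S := by
    rintro ⟨y, ξ⟩ ⟨hy, hξ⟩
    refine ball_thick hy ?_
    rw [mem_ball, dist_eq_norm] at *
    simpa using hξ
  have hid : HF (fun (_ : P) (z : X) => z) (thickening r S) := HF.of_diff differentiableOn_id
  have hg : HF (fun (_ : P) (q : X × X) => q.1 + q.2) (thickening (r / 2) S ×ˢ ball (0 : X) (r / 2)) :=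
    HF.of_diff (differentiable_fst.add differentiable_snd).differentiableOn
  have hs : HF (fun ζ z => α ζ z - z) (thickening r S) := hα.sub hid
  have hH : HF (fun (ζ : P) (q : X × X) => -(α ζ (q.1 + q.2) - (q.1 + q.2)))
      (thickening (r / 2) S ×ˢ ball (0 : X) (r / 2)) := (HF.comp hs hg fun ζ => hin).neg
  have hbH : ∀ ζ, ∀ q ∈ thickening (r / 2) S ×ˢ ball (0 : X) (r / 2),
      ‖-(α ζ (q.1 + q.2) - (q.1 + q.2))‖ ≤ M := fun ζ q hq => by rw [norm_neg]; exact hb ζ _ (hin q hq)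
  have hΛ2 : ∀ (x x' : P → X → X) (B : ℝ), HF x (thickening (r / 2) S) → HF x' (thickening (r / 2) S) →
      (∀ ζ, ∀ y ∈ thickening (r / 2) S, ‖x ζ y - x' ζ y‖ ≤ B) →
      ∀ ζ, ∀ y ∈ thickening (r / 2) S, ‖id x ζ y - id x' ζ y‖ ≤ 1 * B :=
    fun x x' B _ _ h ζ y hy => by rw [one_mul]; exact h ζ y hy
  obtain ⟨x, hx, hxM, -, he⟩ := fixpt (isOpen_thickening (δ := r / 2) (E := S)) (half_pos hr) zero_le_one hM
    (by linarith) hH hbH id (fun x hx => hx) hΛ2 (fun _ _ _ => rfl)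
  refine ⟨fun ζ y => y + x ζ y, (HF.of_diff differentiableOn_id).add hx, fun ζ y hy => by simpa using hxM ζ y hy, ?_⟩
  intro ζ y hy
  have := he ζ y hy
  simp only [id] at this
  have h2 : α ζ (y + x ζ y) = y + x ζ y - x ζ y := by
    nth_rewrite 3 [this]
    abel
  rw [h2]; abel

lemma inj_near {S : Set X} {r M : ℝ} (hr : 0 < r) (h16 : 16 * M < r)
    {α : X → X} (hα : DifferentiableOn ℂ α (thickening r S)) (hb : ∀ z ∈ thickening r S, ‖α z - z‖ ≤ M) :
    InjOn α (thickening (r / 2) S) := by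
  intro z hz w hw h
  have hsub : thickening (r / 2) S ⊆ thickening r S := thickening_mono (by linarith) S
  have h1 := hb z (hsub hz)
  have h2 := hb w (hsub hw)
  have e : z - w = (α w - w) - (α z - z) := by rw [h]; abel
  have h3 : ‖z - w‖ ≤ M + M := by rw [e]; exact (norm_sub_le _ _).trans (add_le_add h2 h1)
  have M0 : 0 ≤ M := (norm_nonneg _).trans h1
  have h4 := lip_ball (f := fun z => α z - z) (x := z) (M := M) (half_pos hr)
    ((hα.sub differentiableOn_id).mono (ball_thick hz)) (fun u hu => hb u (ball_thick hz hu))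
    (z := w) (w := z) (by rw [mem_ball, dist_eq_norm, norm_sub_rev]; linarith) (mem_ball_self (by positivity))
  rw [← e, norm_sub_rev w z] at h4
  have h5 : 4 * M / (r / 2) ≤ 1 / 2 := by
    rw [div_le_iff₀ (by positivity)]; linarith
  have h6 : ‖z - w‖ ≤ 1 / 2 * ‖z - w‖ := h4.trans (by gcongr)
  have h7 : ‖z - w‖ = 0 := by linarith [norm_nonneg (z - w)]
  exact sub_eq_zero.1 (norm_eq_zero.1 h7)

lemma thick_inter {Z : Type*} [MetricSpace Z] {K1 K2 : Set Z} (h1 : IsCompact K1) (h2 : IsCompact K2) {ρ : ℝ} (hρ : 0 < ρ) :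
    ∃ r > 0, thickening r K1 ∩ thickening r K2 ⊆ thickening ρ (K1 ∩ K2) := by
  obtain ⟨V1, V2, o1, o2, s1, s2, hV⟩ := shrink2 h1 h2 (isOpen_thickening (δ := ρ) (E := K1 ∩ K2)) (self_subset_thickening hρ _)
  obtain ⟨r1, hr1, t1⟩ := h1.exists_thickening_subset_open o1 s1
  obtain ⟨r2, hr2, t2⟩ := h2.exists_thickening_subset_open o2 s2
  refine ⟨min r1 r2, lt_min hr1 hr2, fun z hz => hV ⟨t1 (thickening_mono (min_le_left _ _) _ hz.1), t2 (thickening_mono (min_le_right _ _) _ hz.2)⟩⟩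

end HFsec

section ext
lemma norm_convex_le {V ι : Type*} [NormedAddCommGroup V] [NormedSpace ℂ V] {s : Finset ι} {w : ι → ℝ} {v : ι → V}
    {B : ℝ} (h0 : ∀ i ∈ s, 0 ≤ w i) (h1 : ∑ i ∈ s, w i = 1) (hv : ∀ i ∈ s, w i ≠ 0 → ‖v i‖ ≤ B) :
    ‖∑ i ∈ s, (w i : ℂ) • v i‖ ≤ B := by
  calc ‖∑ i ∈ s, (w i : ℂ) • v i‖ ≤ ∑ i ∈ s, w i * B := by
        refine norm_sum_le_of_le _ fun i hi => ?_
        rw [norm_smul, Complex.norm_real, Real.norm_of_nonneg (h0 i hi)]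
        by_cases h : w i = 0
        · rw [h, zero_mul, zero_mul]
        · exact mul_le_mul_of_nonneg_left (hv i hi h) (h0 i hi)
    _ = B := by rw [← Finset.sum_mul, h1, one_mul]

/-- lifting continuous families through a surjection -/
lemma lift_fam {Y1 Y2 : Type*} [NormedAddCommGroup Y1] [NormedSpace ℂ Y1] [CompleteSpace Y1]
    [NormedAddCommGroup Y2] [NormedSpace ℂ Y2] [CompleteSpace Y2] (T : Y1 →L[ℂ] Y2) {C : ℝ} (hC : 0 ≤ C)
    (h : ∀ y, ∃ x, T x = y ∧ ‖x‖ ≤ C * ‖y‖) (P : Type*) [MetricSpace P] [CompactSpace P] (c : C(P, Y2)) :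
    ∃ x : C(P, Y1), (∀ ζ, T (x ζ) = c ζ) ∧ ‖x‖ ≤ 2 * C * ‖c‖ := by
  classical
  choose s hs1 hs2 using h
  obtain ⟨x, hx, hx'⟩ := iterate_surj (ContinuousLinearMap.compLeftContinuous ℂ P T) C hC (fun y => by
    by_cases hy : y = 0
    · refine ⟨0, by rw [norm_zero]; positivity, by simp [hy]⟩
    have hy0 : 0 < ‖y‖ := norm_pos_iff.2 hy
    obtain ⟨δ, hδ, hu⟩ := Metric.uniformContinuous_iff.1 (CompactSpace.uniformContinuous_of_continuous y.continuous) (‖y‖ / 2) (by positivity)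
    obtain ⟨t, -, ht⟩ := (isCompact_univ (X := P)).elim_nhds_subcover (fun p => ball p δ) (fun p _ => ball_mem_nhds p hδ)
    let φ : P → P → ℝ := fun i ζ => max 0 (δ - dist ζ i)
    have φ0 : ∀ i ζ, 0 ≤ φ i ζ := fun i ζ => le_max_left _ _
    have φc : ∀ i, Continuous (φ i) := fun i => by fun_prop
    have S0 : ∀ ζ, 0 < ∑ i ∈ t, φ i ζ := by
      intro ζ
      obtain ⟨i, hi, hζ⟩ := mem_iUnion₂.1 (ht (mem_univ ζ))
      refine Finset.sum_pos' (fun i _ => φ0 i ζ) ⟨i, hi, ?_⟩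
      rw [mem_ball] at hζ
      exact lt_max_of_lt_right (by linarith)
    have Sc : Continuous fun ζ => ∑ i ∈ t, φ i ζ := continuous_finsetSum _ fun i _ => φc i
    let w : P → P → ℝ := fun i ζ => φ i ζ / ∑ i ∈ t, φ i ζ
    have w0 : ∀ i ζ, 0 ≤ w i ζ := fun i ζ => div_nonneg (φ0 i ζ) (S0 ζ).le
    have w1 : ∀ ζ, ∑ i ∈ t, w i ζ = 1 := fun ζ => by
      simp only [w]
      rw [← Finset.sum_div, div_self (S0 ζ).ne']
    have wd : ∀ i ζ, w i ζ ≠ 0 → dist ζ i < δ := by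
      intro i ζ hw
      by_contra hd
      apply hw
      simp only [w, φ]
      rw [max_eq_left (by linarith), zero_div]
    have wc : ∀ i, Continuous (w i) := fun i => (φc i).div Sc fun ζ => (S0 ζ).ne'
    refine ⟨⟨fun ζ => ∑ i ∈ t, (w i ζ : ℂ) • s (y i), continuous_finsetSum _ fun i _ =>
      (Complex.continuous_ofReal.comp (wc i)).smul continuous_const⟩, ?_, ?_⟩
    · refine (ContinuousMap.norm_le _ (by positivity)).2 fun ζ => ?_
      refine norm_convex_le (fun i _ => w0 i ζ) (w1 ζ) fun i _ _ => (hs2 _).trans ?_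
      gcongr
      exact y.norm_coe_le_norm i
    · refine (ContinuousMap.norm_le _ (by positivity)).2 fun ζ => ?_
      change ‖y ζ - T (∑ i ∈ t, (w i ζ : ℂ) • s (y i))‖ ≤ _
      have : y ζ - T (∑ i ∈ t, (w i ζ : ℂ) • s (y i)) = ∑ i ∈ t, (w i ζ : ℂ) • (y ζ - y i) := by
        simp only [smul_sub, Finset.sum_sub_distrib, map_sum, map_smul, hs1]
        rw [← Finset.sum_smul, ← Complex.ofReal_sum, w1, Complex.ofReal_one, one_smul]
      rw [this]
      refine norm_convex_le (fun i _ => w0 i ζ) (w1 ζ) fun i _ hw => ?_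
      rw [← dist_eq_norm]
      exact (hu (wd i ζ hw)).le) c
  exact ⟨x, fun ζ => DFunLike.congr_fun hx ζ, hx'⟩

lemma lift_rel {Y1 Y2 : Type*} [NormedAddCommGroup Y1] [NormedSpace ℂ Y1] [CompleteSpace Y1]
    [NormedAddCommGroup Y2] [NormedSpace ℂ Y2] [CompleteSpace Y2]
    (E : Submodule ℂ (Y1 × Y2)) (hE : IsClosed (E : Set (Y1 × Y2))) (F : Submodule ℂ Y1)
    (hF : IsClosed (F : Set Y1)) (hsub : ∀ p ∈ E, p.1 ∈ F) (hs : ∀ y ∈ F, ∃ p ∈ E, p.1 = y)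
    (P : Type*) [MetricSpace P] [CompactSpace P] :
    ∃ C > 0, ∀ c : C(P, Y1), (∀ ζ, c ζ ∈ F) → ∃ G : C(P, Y2), (∀ ζ, (c ζ, G ζ) ∈ E) ∧ ∀ ζ, ‖G ζ‖ ≤ C * ‖c‖ := by
  obtain ⟨C, hC, h⟩ := om_rel E hE F hF hsub hs
  have : CompleteSpace E := hE.completeSpace_coe
  have : CompleteSpace F := hF.completeSpace_coe
  let T : E →L[ℂ] F :=
    ((ContinuousLinearMap.fst ℂ Y1 Y2).comp E.subtypeL).codRestrict F (fun p => hsub p.1 p.2)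
  refine ⟨2 * C, by positivity, fun c hc => ?_⟩
  obtain ⟨x, hx, hx'⟩ := lift_fam T hC.le (fun y => by
    obtain ⟨p, hp, e, hn⟩ := h y.1 y.2
    exact ⟨⟨p, hp⟩, Subtype.ext e, hn⟩) P ⟨fun ζ => ⟨c ζ, hc ζ⟩, by fun_prop⟩
  refine ⟨⟨fun ζ => (x ζ).1.2, by fun_prop⟩, fun ζ => ?_, fun ζ => ?_⟩
  · have e : (x ζ).1.1 = c ζ := congrArg Subtype.val (hx ζ)
    change (c ζ, (x ζ).1.2) ∈ E
    rw [← e]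
    exact (x ζ).2
  · have h1 : ‖(x ζ).1.2‖ ≤ ‖x ζ‖ := norm_snd_le (x ζ).1
    refine (h1.trans (x.norm_coe_le_norm ζ)).trans (hx'.trans ?_)
    gcongr
    exact (ContinuousMap.norm_le _ (norm_nonneg _)).2 fun ζ => c.norm_coe_le_norm ζ

lemma joint_cont {P Y G : Type*} [TopologicalSpace P] [TopologicalSpace Y] [NormedAddCommGroup G]
    {F : P → BF Y G} (hF : Continuous F) {U : Set Y} (h : ∀ ζ, ContinuousOn (fun y => F ζ y) U) :
    ContinuousOn (fun q : P × Y => F q.1 q.2) ((univ : Set P) ×ˢ U) := by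
  rintro ⟨ζ, y⟩ ⟨-, hy⟩
  rw [ContinuousWithinAt, Metric.tendsto_nhds]
  intro ε hε
  have h1 : ∀ᶠ q : P × Y in 𝓝[univ ×ˢ U] (ζ, y), dist (F q.1) (F ζ) < ε / 2 :=
    nhdsWithin_le_nhds ((Metric.tendsto_nhds.1 (hF.continuousAt (x := ζ)) (ε / 2) (by positivity)).filter_mono
      (continuous_fst.tendsto (ζ, y)) |> fun h => (continuous_fst.tendsto (ζ, y)).eventually
        (Metric.tendsto_nhds.1 (hF.continuousAt (x := ζ)) (ε / 2) (by positivity)))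
  have h2 : ∀ᶠ q : P × Y in 𝓝[univ ×ˢ U] (ζ, y), dist (F ζ q.2) (F ζ y) < ε / 2 := by
    have t : Tendsto (fun q : P × Y => q.2) (𝓝[univ ×ˢ U] (ζ, y)) (𝓝[U] y) :=
      tendsto_nhdsWithin_of_tendsto_nhds_of_eventually_within _
        (tendsto_nhdsWithin_of_tendsto_nhds (continuous_snd.tendsto (ζ, y)))
        (eventually_nhdsWithin_of_forall fun q hq => hq.2)
    exact t.eventually (Metric.tendsto_nhds.1 (h ζ y hy) (ε / 2) (by positivity))
  filter_upwards [h1, h2] with q hq1 hq2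
  have h3 : dist (F q.1 q.2) (F ζ q.2) ≤ dist (F q.1) (F ζ) := by
    rw [dist_eq_norm, dist_eq_norm]
    exact BF.le (F q.1 - F ζ) q.2
  have := dist_triangle (F q.1 q.2) (F ζ q.2) (F ζ y)
  linarith

variable {κ : Type} [Fintype κ] [DecidableEq κ]

lemma HConv_prod3 {L Ω : Set (κ → ℂ)} (h : HConv L Ω) {s : ℝ} (hs : 0 < s) :
    HConv (L ×ˢ (closedBall (0 : κ → ℂ) s ×ˢ sphere (0 : ℂ) 1)) (Ω ×ˢ ((univ : Set (κ → ℂ)) ×ˢ {0}ᶜ)) := by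
  obtain ⟨oΩ, hLΩ, hL, hg⟩ := h
  refine ⟨oΩ.prod (isOpen_univ.prod isOpen_compl_singleton), ?_, hL.prod ((isCompact_closedBall _ _).prod (isCompact_sphere _ _)), ?_⟩
  · rintro ⟨z, ξ, w⟩ ⟨hz, -, hw⟩
    refine ⟨hLΩ hz, mem_univ _, ?_⟩
    rintro rfl
    simp at hw
  rintro ⟨z, ξ, w⟩ ⟨hz, -, hw⟩ hn
  have hw0 : w ≠ 0 := hw
  by_cases h1 : z ∈ L
  swap
  · obtain ⟨g, dg, g1, g2⟩ := hg z hz h1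
    exact ⟨fun q => g q.1, dg.comp differentiableOn_fst fun q hq => hq.1, fun q hq => g1 _ hq.1, g2⟩
  by_cases h2 : ξ ∈ closedBall (0 : κ → ℂ) s
  swap
  · rw [mem_closedBall, dist_zero_right, pi_norm_le_iff_of_nonneg hs.le] at h2
    push Not at h2
    obtain ⟨k, hk⟩ := h2
    refine ⟨fun q => (s : ℂ)⁻¹ * q.2.1 k, by fun_prop, ?_, ?_⟩
    · rintro ⟨z, ξ, w⟩ ⟨-, hξ, -⟩
      rw [mem_closedBall, dist_zero_right] at hξ
      rw [norm_mul, norm_inv, Complex.norm_real, Real.norm_of_nonneg hs.le, inv_mul_le_one₀ hs]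
      exact (norm_le_pi_norm ξ k).trans hξ
    · rw [norm_mul, norm_inv, Complex.norm_real, Real.norm_of_nonneg hs.le, inv_mul_eq_div, one_lt_div hs]
      exact hk
  have h3 : ‖w‖ ≠ 1 := fun h => hn ⟨h1, h2, by simpa using h⟩
  rcases lt_or_gt_of_ne h3 with h3 | h3
  · refine ⟨fun q => 1 / q.2.2, ?_, ?_, ?_⟩
    · exact diffOn_div (by fun_prop) (by fun_prop) fun q hq => hq.2.2
    · rintro ⟨z, ξ, w⟩ ⟨-, -, hw⟩
      have : ‖w‖ = 1 := by simpa using hw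
      simp [this]
    · simp only [norm_div, norm_one]
      exact (one_lt_div (norm_pos_iff.2 hw0)).2 h3
  · refine ⟨fun q => q.2.2, by fun_prop, ?_, h3⟩
    rintro ⟨z, ξ, w⟩ ⟨-, -, hw⟩
    have : ‖w‖ = 1 := by simpa using hw
    simp [this]

/-- extension from the graph hypersurface: single function, no bounds -/
lemma ext_one {L Ω : Set (κ → ℂ)} (h : HConv L Ω) {f : (κ → ℂ) → ℂ} (hf : Differentiable ℂ f) {r s : ℝ} (hs : 0 < s) (hsr : s < r) :
    ∃ V : Set ((κ → ℂ) × (κ → ℂ) × ℂ), IsOpen V ∧ L ×ˢ (closedBall (0 : κ → ℂ) s ×ˢ sphere (0 : ℂ) 1) ⊆ V ∧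
      ∀ c : (κ → ℂ) → ℂ, DifferentiableOn ℂ c (thickening r {z ∈ L | ‖f z‖ = 1}) →
        ∃ G : (κ → ℂ) × (κ → ℂ) × ℂ → ℂ, DifferentiableOn ℂ G V ∧
          ∀ z ξ, (z, ξ, f z) ∈ V → z + ξ ∈ thickening r {z ∈ L | ‖f z‖ = 1} → G (z, ξ, f z) = c (z + ξ) := by
  classical
  set T := thickening r {z ∈ L | ‖f z‖ = 1} with hT
  let U : Bool → Set ((κ → ℂ) × (κ → ℂ) × ℂ) := fun b =>
    if b then {q | q.1 + q.2.1 ∈ T} else {q | q.2.2 - f q.1 ≠ 0}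
  have oT : IsOpen {q : (κ → ℂ) × (κ → ℂ) × ℂ | q.1 + q.2.1 ∈ T} :=
    isOpen_thickening.preimage (f := fun q : (κ → ℂ) × (κ → ℂ) × ℂ => q.1 + q.2.1) (by fun_prop)
  have dd : Differentiable ℂ (fun q : (κ → ℂ) × (κ → ℂ) × ℂ => q.2.2 - f q.1) :=
    (by fun_prop : Differentiable ℂ (fun q : (κ → ℂ) × (κ → ℂ) × ℂ => q.2.2)).sub (hf.comp differentiable_fst)
  have oD : IsOpen {q : (κ → ℂ) × (κ → ℂ) × ℂ | q.2.2 - f q.1 ≠ 0} :=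
    isOpen_compl_singleton.preimage dd.continuous
  have oU : ∀ b, IsOpen (U b) := by
    rintro (_ | _)
    · exact oD
    · exact oT
  have hcov : L ×ˢ (closedBall (0 : κ → ℂ) s ×ˢ sphere (0 : ℂ) 1) ⊆ ⋃ i, U i := by
    rintro ⟨z, ξ, w⟩ ⟨hz, hξ, hw⟩
    by_cases e : w - f z = 0
    · refine mem_iUnion.2 ⟨true, ?_⟩
      change z + ξ ∈ T
      have hw : ‖w‖ = 1 := by simpa using hw
      rw [sub_eq_zero.1 e] at hw
      refine mem_thickening_iff.2 ⟨z, ⟨hz, hw⟩, ?_⟩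
      have hξ : ‖ξ‖ ≤ s := by simpa using hξ
      rw [dist_eq_norm]
      simpa using hξ.trans_lt hsr
    · exact mem_iUnion.2 ⟨false, e⟩
  obtain ⟨V, oV, hV, hsp⟩ := H1u_of_HConv (HConv_prod3 h hs) Bool U oU hcov
  have oW : IsOpen (V ∩ (U true ∪ U false)) := oV.inter ((oU true).union (oU false))
  have hW : L ×ˢ (closedBall (0 : κ → ℂ) s ×ˢ sphere (0 : ℂ) 1) ⊆ V ∩ (U true ∪ U false) := by
    intro q hq
    refine ⟨hV hq, ?_⟩
    obtain ⟨i, hi⟩ := mem_iUnion.1 (hcov hq)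
    cases i
    · exact Or.inr hi
    · exact Or.inl hi
  refine ⟨V ∩ (U true ∪ U false), oW, hW, fun c hc => ?_⟩
  let g0 : (κ → ℂ) × (κ → ℂ) × ℂ → ℂ := fun q => c (q.1 + q.2.1) / (q.2.2 - f q.1)
  have dg0 : DifferentiableOn ℂ g0 (U true ∩ U false) :=
    diffOn_div (hc.comp (by fun_prop) fun q hq => hq.1) dd.differentiableOn fun q hq => hq.2
  let g : Bool → Bool → (κ → ℂ) × (κ → ℂ) × ℂ → ℂ := fun a b q =>
    (if a then g0 q else 0) - (if b then g0 q else 0)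
  have hg : IsCoc U g := by
    constructor
    · rintro (_ | _) (_ | _)
      · exact (differentiableOn_const (0 : ℂ)).congr fun q _ => by simp [g]
      · exact (dg0.neg.mono fun q hq => ⟨hq.2, hq.1⟩).congr fun q _ => by simp [g]
      · exact dg0.congr fun q _ => by simp [g]
      · exact (differentiableOn_const (0 : ℂ)).congr fun q _ => by simp [g]
    · intro i j k z _ _ _
      simp only [g]; ring
  obtain ⟨H, dH, hH⟩ := hsp g hg
  refine ⟨fun q => if q ∈ U false then -(q.2.2 - f q.1) * H false q else c (q.1 + q.2.1) - (q.2.2 - f q.1) * H true q, ?_, ?_⟩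
  · have e1 : ∀ q ∈ U true ∩ V, (if q ∈ U false then -(q.2.2 - f q.1) * H false q else c (q.1 + q.2.1) - (q.2.2 - f q.1) * H true q)
        = c (q.1 + q.2.1) - (q.2.2 - f q.1) * H true q := by
      rintro q ⟨hq1, hq2⟩
      split_ifs with hq3
      · have e := hH true false q hq1 hq3 hq2
        have e' : H true q = g0 q + H false q := by
          simp only [g, if_true] at e
          simp at e
          rw [e]; ring
        have hne : q.2.2 - f q.1 ≠ 0 := hq3
        rw [e']
        simp only [g0]
        field_simp
        ring
      · rfl
    have d1 : DifferentiableOn ℂ (fun q : (κ → ℂ) × (κ → ℂ) × ℂ => c (q.1 + q.2.1) - (q.2.2 - f q.1) * H true q) (U true ∩ V) :=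
      (hc.comp (by fun_prop) fun q hq => hq.1).sub (dd.differentiableOn.mul (dH true))
    have d2 : DifferentiableOn ℂ (fun q : (κ → ℂ) × (κ → ℂ) × ℂ => -(q.2.2 - f q.1) * H false q) (U false ∩ V) :=
      dd.neg.differentiableOn.mul (dH false)
    apply diffOn_of_local
    rintro q ⟨hq, hq' | hq'⟩
    · exact ⟨_, _, (oU true).inter oV, ⟨hq', hq⟩, d1, e1⟩
    · exact ⟨_, _, (oU false).inter oV, ⟨hq', hq⟩, d2, fun z hz => if_pos hz.1⟩
  · intro z ξ hv hT
    have : (z, ξ, f z) ∉ U false := fun h => h (sub_self _)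
    simp only [if_neg this, sub_self, zero_mul, sub_zero]

lemma eta_small {L : Set (κ → ℂ)} (hL : IsCompact L) {f : (κ → ℂ) → ℂ} (hf : Continuous f) {s : ℝ} (hs : 0 < s) :
    ∃ η > 0, η ≤ 1 ∧ ∀ z ∈ thickening η L, |‖f z‖ - 1| < η → z ∈ thickening s {z ∈ L | ‖f z‖ = 1} := by
  rcases L.eq_empty_or_nonempty with rfl | hne
  · exact ⟨1, one_pos, le_rfl, fun z hz => by simp at hz⟩
  have cS : IsCompact (cthickening 1 L \ thickening s {z ∈ L | ‖f z‖ = 1}) := hL.cthickening.diff isOpen_thickening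
  have hc : Continuous fun z => infDist z L + |‖f z‖ - 1| := (continuous_infDist_pt L).add (by fun_prop)
  obtain ⟨m, hm, hmin⟩ := cS.exists_forall_le' hc.continuousOn (a := 0) (by
    rintro z ⟨hz1, hz2⟩
    by_contra hn
    have h1 : 0 ≤ infDist z L := infDist_nonneg
    have h2 : 0 ≤ |‖f z‖ - 1| := abs_nonneg _
    have h3 : infDist z L = 0 := by linarith
    have h4 : |‖f z‖ - 1| = 0 := by linarith
    have h5 : z ∈ L := (hL.isClosed.mem_iff_infDist_zero hne).2 h3
    have h6 : ‖f z‖ = 1 := by linarith [abs_eq_zero.1 h4]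
    exact hz2 (self_subset_thickening hs _ ⟨h5, h6⟩))
  refine ⟨min 1 (m / 2), by positivity, min_le_left _ _, fun z hz hfz => ?_⟩
  by_contra hn
  have h1 := hmin z ⟨thickening_subset_cthickening _ _ (thickening_mono (min_le_left _ _) _ hz), hn⟩
  have h2 := (mem_thickening_iff_infDist_lt hne).1 hz
  have h3 := min_le_right 1 (m / 2)
  linarith

def WW (L : Set (κ → ℂ)) (η : ℝ) : Set ((κ → ℂ) × (κ → ℂ) × ℂ) :=
  thickening η L ×ˢ (ball 0 η ×ˢ {w : ℂ | |‖w‖ - 1| < η})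

lemma isOpen_ann (η : ℝ) : IsOpen {w : ℂ | |‖w‖ - 1| < η} :=
  isOpen_lt (by fun_prop) continuous_const

lemma isOpen_WW (L : Set (κ → ℂ)) (η : ℝ) : IsOpen (WW L η) :=
  isOpen_thickening.prod (isOpen_ball.prod (isOpen_ann η))

lemma WW_sub {L : Set (κ → ℂ)} {η s : ℝ} (h1 : η ≤ 1) (hs : η ≤ s) :
    WW L η ⊆ thickening η (L ×ˢ (closedBall (0 : κ → ℂ) s ×ˢ sphere (0 : ℂ) 1)) := by
  rintro ⟨z, ξ, w⟩ ⟨hz, hξ, hw⟩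
  obtain ⟨z0, hz0, hd⟩ := mem_thickening_iff.1 hz
  have hw : |‖w‖ - 1| < η := hw
  have hη : 0 < η := lt_of_le_of_lt (abs_nonneg _) hw
  have hw0 : 0 < ‖w‖ := by linarith [(abs_lt.1 hw).1]
  have hwc : (‖w‖ : ℂ) ≠ 0 := by exact_mod_cast hw0.ne'
  refine mem_thickening_iff.2 ⟨(z0, ξ, w / ‖w‖), ⟨hz0, ?_, ?_⟩, ?_⟩
  · exact closedBall_subset_closedBall hs (ball_subset_closedBall hξ)
  · simp [hw0.ne']
  · rw [Prod.dist_eq, Prod.dist_eq]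
    refine max_lt hd (max_lt (by simpa using hη) ?_)
    have : w - w / ‖w‖ = ((‖w‖ - 1 : ℝ) : ℂ) * (w / ‖w‖) := by
      push_cast; field_simp
    change dist w (w / ‖w‖) < η
    rw [dist_eq_norm, this, norm_mul, Complex.norm_real, norm_div, Complex.norm_real, norm_norm, div_self hw0.ne', mul_one]
    exact hw

def rE (T : Set (κ → ℂ)) (W : Set ((κ → ℂ) × (κ → ℂ) × ℂ)) (f : (κ → ℂ) → ℂ) :
    Submodule ℂ (BF (κ → ℂ) ℂ × BF ((κ → ℂ) × (κ → ℂ) × ℂ) ℂ) where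
  carrier := {p | DifferentiableOn ℂ (fun z => p.1 z) T ∧ DifferentiableOn ℂ (fun z => p.2 z) W ∧
    ∀ z ξ, (z, ξ, f z) ∈ W → p.2 (z, ξ, f z) = p.1 (z + ξ)}
  add_mem' := by
    rintro a b ⟨h1, h2, h3⟩ ⟨h1', h2', h3'⟩
    refine ⟨h1.add h1', h2.add h2', fun z ξ h => ?_⟩
    change a.2 (z, ξ, f z) + b.2 (z, ξ, f z) = a.1 (z + ξ) + b.1 (z + ξ)
    rw [h3 z ξ h, h3' z ξ h]
  zero_mem' := ⟨differentiableOn_const (0 : ℂ), differentiableOn_const (0 : ℂ), fun _ _ _ => rfl⟩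
  smul_mem' := by
    rintro c a ⟨h1, h2, h3⟩
    refine ⟨h1.const_smul c, h2.const_smul c, fun z ξ h => ?_⟩
    change c • a.2 (z, ξ, f z) = c • a.1 (z + ξ)
    rw [h3 z ξ h]

def rF (T : Set (κ → ℂ)) : Submodule ℂ (BF (κ → ℂ) ℂ) where
  carrier := {p | DifferentiableOn ℂ (fun z => p z) T}
  add_mem' := fun h1 h2 => h1.add h2
  zero_mem' := differentiableOn_const (0 : ℂ)
  smul_mem' := fun c _ h => h.const_smul c

lemma isClosed_rF {T : Set (κ → ℂ)} (hT : IsOpen T) : IsClosed (rF T : Set (BF (κ → ℂ) ℂ)) :=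
  BF.isClosed_diffOn id hT

lemma isClosed_rE {T : Set (κ → ℂ)} {W : Set ((κ → ℂ) × (κ → ℂ) × ℂ)} (hT : IsOpen T) (hW : IsOpen W) (f : (κ → ℂ) → ℂ) :
    IsClosed (rE T W f : Set (BF (κ → ℂ) ℂ × BF ((κ → ℂ) × (κ → ℂ) × ℂ) ℂ)) := by
  have e : (rE T W f : Set (BF (κ → ℂ) ℂ × BF ((κ → ℂ) × (κ → ℂ) × ℂ) ℂ)) =
      (Prod.fst ⁻¹' {p : BF (κ → ℂ) ℂ | DifferentiableOn ℂ (fun z => p z) T}) ∩ (Prod.snd ⁻¹' {p : BF ((κ → ℂ) × (κ → ℂ) × ℂ) ℂ | DifferentiableOn ℂ (fun z => p z) W}) ∩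
      (⋂ z, ⋂ ξ, ⋂ (_ : (z, ξ, f z) ∈ W), {p : BF (κ → ℂ) ℂ × BF ((κ → ℂ) × (κ → ℂ) × ℂ) ℂ | p.2 (z, ξ, f z) = p.1 (z + ξ)}) := by
    ext p
    simp only [mem_inter_iff, mem_iInter, mem_preimage, mem_ofPred_eq, and_assoc]
    rfl
  rw [e]
  refine IsClosed.inter (IsClosed.inter ((BF.isClosed_diffOn id hT).preimage continuous_fst)
    ((BF.isClosed_diffOn id hW).preimage continuous_snd)) ?_
  refine isClosed_iInter fun z => isClosed_iInter fun ξ => isClosed_iInter fun _ => ?_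
  exact isClosed_eq ((BF.cont_apply _).comp continuous_snd) ((BF.cont_apply _).comp continuous_fst)

/-- continuous families as continuous maps into bounded functions -/
lemma fam_to_BF {P : Type*} [MetricSpace P] [CompactSpace P] {Y : Type*} [MetricSpace Y] {K T : Set Y}
    (hK : IsCompact K) (hTK : T ⊆ K) {c : P → Y → ℂ} (hc : ContinuousOn (fun q : P × Y => c q.1 q.2) ((univ : Set P) ×ˢ K))
    {M : ℝ} (hM : 0 ≤ M) (hb : ∀ ζ, ∀ z ∈ T, ‖c ζ z‖ ≤ M) :
    ∃ F : C(P, BF Y ℂ), (∀ ζ, ∀ z ∈ T, F ζ z = c ζ z) ∧ ‖F‖ ≤ M := by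
  classical
  have bd : ∀ ζ y, ‖T.indicator (c ζ) y‖ ≤ M := by
    intro ζ y
    by_cases h : y ∈ T
    · rw [indicator_of_mem h]; exact hb ζ y h
    · rw [indicator_of_notMem h, norm_zero]; exact hM
  let F : P → BF Y ℂ := fun ζ => BF.of (T.indicator (c ζ)) ⟨M, bd ζ⟩
  have Fv : ∀ ζ y, F ζ y = T.indicator (c ζ) y := fun ζ y => rfl
  have Fc : Continuous F := by
    have uc := (isCompact_univ.prod hK).uniformContinuousOn_of_continuous hc
    rw [Metric.uniformContinuousOn_iff] at uc
    rw [Metric.continuous_iff]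
    intro ζ ε hε
    obtain ⟨δ, hδ, h⟩ := uc (ε / 2) (by positivity)
    refine ⟨δ, hδ, fun ζ' hd => ?_⟩
    rw [dist_eq_norm]
    refine lt_of_le_of_lt (BF.norm_le (by positivity : 0 ≤ ε / 2) fun y => ?_) (by linarith)
    change ‖F ζ' y - F ζ y‖ ≤ ε / 2
    rw [Fv, Fv]
    by_cases hy : y ∈ T
    · rw [indicator_of_mem hy, indicator_of_mem hy, ← dist_eq_norm]
      exact (h (ζ', y) ⟨mem_univ _, hTK hy⟩ (ζ, y) ⟨mem_univ _, hTK hy⟩ (by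
        rw [Prod.dist_eq]; exact max_lt hd (by simpa using hδ))).le
    · rw [indicator_of_notMem hy, indicator_of_notMem hy, sub_zero, norm_zero]; positivity
  refine ⟨⟨F, Fc⟩, fun ζ z hz => ?_, (ContinuousMap.norm_le _ hM).2 fun ζ => BF.norm_le hM (bd ζ)⟩
  change F ζ z = c ζ z
  rw [Fv, indicator_of_mem hz]

theorem ext_scalar {L Ω : Set (κ → ℂ)} (h : HConv L Ω) {f : (κ → ℂ) → ℂ} (hf : Differentiable ℂ f) {r : ℝ} (hr : 0 < r)
    (P : Type*) [MetricSpace P] [CompactSpace P] :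
    ∃ η > 0, η ≤ 1 / 2 ∧ (∀ z ∈ thickening η L, |‖f z‖ - 1| < η → z ∈ thickening (r / 4) {z ∈ L | ‖f z‖ = 1}) ∧
      ∃ C > 0, ∀ (c : P → (κ → ℂ) → ℂ) (M : ℝ), 0 ≤ M → HF c (thickening r {z ∈ L | ‖f z‖ = 1}) →
        (∀ ζ, ∀ z ∈ thickening r {z ∈ L | ‖f z‖ = 1}, ‖c ζ z‖ ≤ M) →
        ∃ G : P → (κ → ℂ) × (κ → ℂ) × ℂ → ℂ, HF G (WW L η) ∧ (∀ ζ, ∀ q ∈ WW L η, ‖G ζ q‖ ≤ C * M) ∧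
          ∀ ζ z ξ, (z, ξ, f z) ∈ WW L η → G ζ (z, ξ, f z) = c ζ (z + ξ) := by
  classical
  set L0 := {z ∈ L | ‖f z‖ = 1} with hL0
  have hL := h.2.2.1
  have cL0 : IsCompact L0 := hL.inter_right (isClosed_eq hf.continuous.norm continuous_const)
  obtain ⟨V, oV, hV, hext⟩ := ext_one h hf (r := r / 2) (s := r / 4) (by positivity) (by linarith)
  have c3 : IsCompact (L ×ˢ (closedBall (0 : κ → ℂ) (r / 4) ×ˢ sphere (0 : ℂ) 1)) :=
    hL.prod ((isCompact_closedBall _ _).prod (isCompact_sphere _ _))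
  obtain ⟨ρ, hρ, hρV⟩ := c3.exists_cthickening_subset_open oV hV
  obtain ⟨η1, hη1, h11, hsm⟩ := eta_small hL hf.continuous (s := r / 4) (by positivity)
  set η := min (min η1 (1 / 2)) (min ρ (r / 4)) with hη
  have l1 : η ≤ η1 := (min_le_left _ _).trans (min_le_left _ _)
  have l2 : η ≤ 1 / 2 := (min_le_left _ _).trans (min_le_right _ _)
  have l3 : η ≤ ρ := (min_le_right _ _).trans (min_le_left _ _)
  have l4 : η ≤ r / 4 := (min_le_right _ _).trans (min_le_right _ _)
  have η0 : 0 < η := by positivity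
  have hsm' : ∀ z ∈ thickening η L, |‖f z‖ - 1| < η → z ∈ thickening (r / 4) L0 := fun z hz hw =>
    hsm z (thickening_mono l1 _ hz) (hw.trans_le l1)
  have WK : WW L η ⊆ cthickening ρ (L ×ˢ (closedBall (0 : κ → ℂ) (r / 4) ×ˢ sphere (0 : ℂ) 1)) :=
    ((WW_sub (by linarith) l4).trans (thickening_mono l3 _)).trans (thickening_subset_cthickening _ _)
  have cK := c3.cthickening (r := ρ)
  have hin : ∀ z ξ, (z, ξ, f z) ∈ WW L η → z + ξ ∈ thickening (r / 2) L0 := by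
    rintro z ξ ⟨h1, h2, h3⟩
    obtain ⟨z0, hz0, hd⟩ := mem_thickening_iff.1 (hsm' z h1 h3)
    refine mem_thickening_iff.2 ⟨z0, hz0, ?_⟩
    have h2 : ‖ξ‖ < η := by simpa using h2
    calc dist (z + ξ) z0 ≤ dist (z + ξ) z + dist z z0 := dist_triangle _ _ _
      _ < r / 4 + r / 4 := by
        refine add_lt_add ?_ hd
        rw [dist_eq_norm]; simpa using h2.trans_le l4
      _ = r / 2 := by ring
  refine ⟨η, η0, l2, hsm', ?_⟩
  obtain ⟨C, hC, hlift⟩ := lift_rel (rE (thickening (r / 2) L0) (WW L η) f)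
    (isClosed_rE isOpen_thickening (isOpen_WW L η) f) (rF (thickening (r / 2) L0))
    (isClosed_rF isOpen_thickening) (fun p hp => hp.1) (by
      intro y hy
      obtain ⟨G, dG, hG⟩ := hext (fun z => y z) hy
      obtain ⟨B, hB⟩ := cK.exists_bound_of_continuousOn (dG.continuousOn.mono hρV)
      refine ⟨(y, BF.of ((WW L η).indicator G) ⟨max B 0, fun q => ?_⟩), ⟨hy, ?_, ?_⟩, rfl⟩
      · by_cases hq : q ∈ WW L η
        · rw [indicator_of_mem hq]; exact (hB q (WK hq)).trans (le_max_left _ _)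
        · rw [indicator_of_notMem hq, norm_zero]; exact le_max_right _ _
      · exact (dG.mono (WK.trans hρV)).congr fun q hq => indicator_of_mem hq G
      · intro z ξ hq
        exact (indicator_of_mem hq G).trans (hG z ξ (hρV (WK hq)) (hin z ξ hq))) P
  refine ⟨C, hC, fun c M hM hc hb => ?_⟩
  have hsub : cthickening (r / 2) L0 ⊆ thickening r L0 := cthickening_subset_thickening' hr (by linarith) _
  obtain ⟨F, hF, hFn⟩ := fam_to_BF (cL0.cthickening (r := r / 2)) (thickening_subset_cthickening _ _)
    (hc.2.mono (prod_mono_right hsub)) hM (fun ζ z hz => hb ζ z (hsub (thickening_subset_cthickening _ _ hz)))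
  obtain ⟨G, hG, hGn⟩ := hlift F (fun ζ => ((hc.1 ζ).mono ((thickening_subset_cthickening _ _).trans hsub)).congr fun z hz => hF ζ z hz)
  refine ⟨fun ζ q => G ζ q, ⟨fun ζ => (hG ζ).2.1, joint_cont G.continuous fun ζ => (hG ζ).2.1.continuousOn⟩, fun ζ q _ => ?_, fun ζ z ξ hq => ?_⟩
  · refine (BF.le (G ζ) q).trans ((hGn ζ).trans ?_)
    gcongr
  · rw [← hF ζ _ (hin z ξ hq)]
    exact (hG ζ).2.2 z ξ hq

theorem ext_family {L Ω : Set (κ → ℂ)} (h : HConv L Ω) {f : (κ → ℂ) → ℂ} (hf : Differentiable ℂ f) {r : ℝ} (hr : 0 < r)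
    (P : Type*) [MetricSpace P] [CompactSpace P] :
    ∃ η > 0, η ≤ 1 / 2 ∧ (∀ z ∈ thickening η L, |‖f z‖ - 1| < η → z ∈ thickening (r / 4) {z ∈ L | ‖f z‖ = 1}) ∧
      ∃ C > 0, ∀ (c : P → (κ → ℂ) → κ → ℂ) (M : ℝ), 0 ≤ M → HF c (thickening r {z ∈ L | ‖f z‖ = 1}) →
        (∀ ζ, ∀ z ∈ thickening r {z ∈ L | ‖f z‖ = 1}, ‖c ζ z‖ ≤ M) →
        ∃ G : P → (κ → ℂ) × (κ → ℂ) × ℂ → κ → ℂ, HF G (WW L η) ∧ (∀ ζ, ∀ q ∈ WW L η, ‖G ζ q‖ ≤ C * M) ∧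
          ∀ ζ z ξ, (z, ξ, f z) ∈ WW L η → G ζ (z, ξ, f z) = c ζ (z + ξ) := by
  obtain ⟨η, h1, h2, h3, C, hC, H⟩ := ext_scalar h hf hr P
  refine ⟨η, h1, h2, h3, C, hC, fun c M hM hc hb => ?_⟩
  have : ∀ k, ∃ G : P → (κ → ℂ) × (κ → ℂ) × ℂ → ℂ, HF G (WW L η) ∧ (∀ ζ, ∀ q ∈ WW L η, ‖G ζ q‖ ≤ C * M) ∧
          ∀ ζ z ξ, (z, ξ, f z) ∈ WW L η → G ζ (z, ξ, f z) = c ζ (z + ξ) k := fun k =>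
    H (fun ζ z => c ζ z k) M hM ⟨fun ζ => differentiableOn_pi.1 (hc.1 ζ) k, continuousOn_pi.1 hc.2 k⟩
      fun ζ z hz => (norm_le_pi_norm _ k).trans (hb ζ z hz)
  choose G hG hG1 hG2 using this
  refine ⟨fun ζ q k => G k ζ q, ⟨fun ζ => differentiableOn_pi.2 fun k => (hG k).1 ζ, continuousOn_pi.2 fun k => (hG k).2⟩,
    fun ζ q hq => (pi_norm_le_iff_of_nonneg (by positivity)).2 fun k => hG1 k ζ q hq, fun ζ z ξ hq => ?_⟩
  ext k
  exact hG2 k ζ z ξ hq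

end ext

section SC
variable {P : Type*} [TopologicalSpace P] {Y G : Type*}
  [NormedAddCommGroup Y] [NormedSpace ℂ Y] [ProperSpace Y]
  [NormedAddCommGroup G] [NormedSpace ℂ G] [CompleteSpace G]

/-- Cauchy integral over the circle of radius `s` in the last variable -/
def CI (s : ℝ) (x : P → Y × ℂ → G) (ζ : P) (q : Y × ℂ) : G :=
  (2 * Real.pi * Complex.I : ℂ)⁻¹ • ∮ t in C(0, s), (t - q.2)⁻¹ • x ζ (q.1, t)

def cker (s : ℝ) (x : P → Y × ℂ → G) (ζ : P) (q : Y × ℂ) (t : ℝ) : G :=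
  deriv (circleMap (0 : ℂ) s) t • ((circleMap (0 : ℂ) s t - q.2)⁻¹ • x ζ (q.1, circleMap (0 : ℂ) s t))

lemma CI_HF {N : Set Y} (oN : IsOpen N) {S : Set ℂ} {s : ℝ} (hs : 0 < s) (hS : sphere (0 : ℂ) s ⊆ S) {x : P → Y × ℂ → G}
    (hx : HF x (N ×ˢ S)) : HF (CI s x) (N ×ˢ {w : ℂ | ‖w‖ ≠ s}) := by
  have oA : IsOpen (N ×ˢ {w : ℂ | ‖w‖ ≠ s}) := oN.prod (isOpen_ne_fun continuous_norm continuous_const)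
  have hcm : ∀ θ, ‖circleMap (0 : ℂ) s θ‖ = s := fun θ => by simp [abs_of_pos hs]
  have hmem : ∀ θ, circleMap (0 : ℂ) s θ ∈ S := fun θ => hS (by simp [abs_of_pos hs])
  have hne : ∀ θ, ∀ w : ℂ, ‖w‖ ≠ s → circleMap (0 : ℂ) s θ - w ≠ 0 := by
    intro θ w hw h
    apply hw
    rw [← sub_eq_zero.1 h, hcm]
  have cont : ContinuousOn (fun q : (P × Y × ℂ) × ℝ =>
      deriv (circleMap (0 : ℂ) s) q.2 • ((circleMap (0 : ℂ) s q.2 - q.1.2.2)⁻¹ • x q.1.1 (q.1.2.1, circleMap (0 : ℂ) s q.2)))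
      (((univ : Set P) ×ˢ (N ×ˢ {w : ℂ | ‖w‖ ≠ s})) ×ˢ univ) := by
    have c1 : Continuous fun q : (P × Y × ℂ) × ℝ => circleMap (0 : ℂ) s q.2 := (continuous_circleMap 0 s).comp continuous_snd
    refine ContinuousOn.smul ?_ (ContinuousOn.smul ?_ ?_)
    · simp only [deriv_circleMap]
      exact (c1.mul continuous_const).continuousOn
    · refine ContinuousOn.inv₀ (by fun_prop) ?_
      rintro ⟨⟨p, y, w⟩, t⟩ ⟨⟨-, -, hw⟩, -⟩
      exact hne t w hw
    · have c2 : ContinuousOn (fun q : (P × Y × ℂ) × ℝ => ((q.1.1, (q.1.2.1, circleMap (0 : ℂ) s q.2)) : P × Y × ℂ))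
          (((univ : Set P) ×ˢ (N ×ˢ {w : ℂ | ‖w‖ ≠ s})) ×ˢ univ) := by
        refine Continuous.continuousOn ?_
        exact (continuous_fst.comp continuous_fst).prodMk ((continuous_fst.comp (continuous_snd.comp continuous_fst)).prodMk c1)
      exact hx.2.comp c2 fun q hq => ⟨mem_univ _, hq.1.2.1, hmem _⟩
  have cont' : ContinuousOn (fun q : (P × Y × ℂ) × ℝ => cker s x q.1.1 q.1.2 q.2)
      (((univ : Set P) ×ˢ (N ×ˢ {w : ℂ | ‖w‖ ≠ s})) ×ˢ univ) := cont
  constructor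
  · intro ζ
    have hc : ContinuousOn (fun q : ℝ × Y × ℂ => cker s x ζ q.2 q.1) (uIcc 0 (2 * Real.pi) ×ˢ (N ×ˢ {w : ℂ | ‖w‖ ≠ s})) := by
      have g : Continuous (fun q : ℝ × Y × ℂ => ((ζ, q.2), q.1)) := by fun_prop
      exact cont'.comp g.continuousOn fun q hq => ⟨⟨mem_univ _, hq.2⟩, mem_univ _⟩
    have hd : ∀ t ∈ uIcc 0 (2 * Real.pi), DifferentiableOn ℂ (fun q => cker s x ζ q t) (N ×ˢ {w : ℂ | ‖w‖ ≠ s}) := by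
      intro t _
      refine DifferentiableOn.const_smul ?_ _
      refine DifferentiableOn.smul ?_ ?_
      · refine DifferentiableOn.inv (by fun_prop) ?_
        rintro ⟨y, w⟩ ⟨-, hw⟩
        exact hne t w hw
      · have g : DifferentiableOn ℂ (fun q : Y × ℂ => (q.1, circleMap (0 : ℂ) s t)) (N ×ˢ {w : ℂ | ‖w‖ ≠ s}) := by fun_prop
        exact (hx.1 ζ).comp g fun q hq => ⟨hq.1, hmem _⟩
    have := diffOn_integral (φ := fun t q => cker s x ζ q t) oA hc hd
    exact this.const_smul _
  · have h1 : ContinuousOn (fun q : P × Y × ℂ => ∫ t in (0)..(2 * Real.pi), cker s x q.1 q.2 t) ((univ : Set P) ×ˢ (N ×ˢ {w : ℂ | ‖w‖ ≠ s})) := by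
      rw [continuousOn_iff_continuous_domRestrict]
      refine intervalIntegral.continuous_parametric_intervalIntegral_of_continuous' (f := fun (q : ((univ : Set P) ×ˢ (N ×ˢ {w : ℂ | ‖w‖ ≠ s}) : Set (P × Y × ℂ))) θ =>
        cker s x q.1.1 q.1.2 θ) ?_ _ _
      have g : Continuous (fun q : ((univ : Set P) ×ˢ (N ×ˢ {w : ℂ | ‖w‖ ≠ s}) : Set (P × Y × ℂ)) × ℝ => ((q.1.1, q.2) : (P × Y × ℂ) × ℝ)) := by fun_prop
      exact cont'.comp_continuous g fun q => ⟨q.1.2, mem_univ _⟩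
    exact h1.const_smul _

lemma CI_bound {s d B : ℝ} (hs : 0 ≤ s) (hd : 0 < d) {x : P → Y × ℂ → G} {ζ : P} {y : Y} {w : ℂ}
    (hB : ∀ t : ℂ, ‖t‖ = s → ‖x ζ (y, t)‖ ≤ B) (hw : d ≤ |‖w‖ - s|) : ‖CI s x ζ (y, w)‖ ≤ s * (B / d) := by
  refine circleIntegral.norm_two_pi_i_inv_smul_integral_le_of_norm_le_const hs fun t ht => ?_
  have ht : ‖t‖ = s := by simpa using ht
  have h1 : d ≤ ‖t - w‖ := by
    refine hw.trans ?_
    rw [← ht, abs_sub_comm]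
    exact abs_norm_sub_norm_le t w
  rw [norm_smul, norm_inv, div_eq_inv_mul]
  have := hB t ht
  have h0 : 0 ≤ B := (norm_nonneg _).trans this
  gcongr

lemma CI_sub {s : ℝ} (hs : 0 < s) {x x' : P → Y × ℂ → G} {ζ : P} {y : Y} {w : ℂ} (hw : ‖w‖ ≠ s)
    (hx : ContinuousOn (fun t => x ζ (y, t)) (sphere 0 s)) (hx' : ContinuousOn (fun t => x' ζ (y, t)) (sphere 0 s)) :
    CI s (fun ζ q => x ζ q - x' ζ q) ζ (y, w) = CI s x ζ (y, w) - CI s x' ζ (y, w) := by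
  have hi : ContinuousOn (fun t : ℂ => (t - w)⁻¹) (sphere 0 s) := by
    refine ContinuousOn.inv₀ (by fun_prop) fun t ht h => hw ?_
    rw [← sub_eq_zero.1 h]
    simpa using ht
  simp only [CI]
  have i1 : CircleIntegrable (fun t : ℂ => (t - w)⁻¹ • x ζ (y, t)) 0 s := (hi.smul hx).circleIntegrable hs.le
  have i2 : CircleIntegrable (fun t : ℂ => (t - w)⁻¹ • x' ζ (y, t)) 0 s := (hi.smul hx').circleIntegrable hs.le
  rw [← smul_sub, ← circleIntegral.integral_sub i1 i2]
  simp only [smul_sub]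

lemma CI_annulus {a b : ℝ} (ha : 0 < a) {x : P → Y × ℂ → G} {ζ : P} {y : Y} {w : ℂ} {S : Set ℂ} (oS : IsOpen S)
    (hS : closedBall 0 b \ ball 0 a ⊆ S) (hx : DifferentiableOn ℂ (fun t => x ζ (y, t)) S) (h1 : a < ‖w‖) (h2 : ‖w‖ < b) :
    CI b x ζ (y, w) - CI a x ζ (y, w) = x ζ (y, w) := by
  set F : ℂ → G := fun t => x ζ (y, t) with hF
  have hb : 0 < b := by linarith
  have hwS : w ∈ S := hS ⟨by simpa using h2.le, by simpa using h1.le⟩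
  have sphA : sphere (0 : ℂ) a ⊆ closedBall 0 b \ ball 0 a := by
    intro t ht
    have : ‖t‖ = a := by simpa using ht
    refine ⟨?_, ?_⟩
    · simp [this]; linarith
    · simp [this]
  have sphB : sphere (0 : ℂ) b ⊆ closedBall 0 b \ ball 0 a := by
    intro t ht
    have : ‖t‖ = b := by simpa using ht
    refine ⟨?_, ?_⟩
    · simp [this]
    · simp [this]; linarith
  have dF : ∀ t ∈ S, DifferentiableAt ℂ F t := fun t ht => hx.differentiableAt (oS.mem_nhds ht)
  have key : (∮ t in C(0, b), dslope F w t) = ∮ t in C(0, a), dslope F w t := by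
    refine Complex.circleIntegral_eq_of_differentiable_on_annulus_off_countable ha (by linarith) (countable_singleton w) ?_ ?_
    · exact ((continuousOn_dslope (oS.mem_nhds hwS)).2 ⟨hx.continuousOn, dF w hwS⟩).mono hS
    · rintro t ⟨⟨ht1, ht2⟩, ht3⟩
      have hne : t ≠ w := ht3
      rw [differentiableAt_dslope_of_ne hne]
      exact dF t (hS ⟨ball_subset_closedBall ht1, fun h => ht2 (ball_subset_closedBall h)⟩)
  have conv : ∀ s, 0 < s → ‖w‖ ≠ s → sphere (0 : ℂ) s ⊆ S →
      (∮ t in C(0, s), dslope F w t) = (∮ t in C(0, s), (t - w)⁻¹ • F t) - (∮ t in C(0, s), (t - w)⁻¹) • F w := by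
    intro s hs hw hsS
    have hi : ContinuousOn (fun t : ℂ => (t - w)⁻¹) (sphere 0 s) := by
      refine ContinuousOn.inv₀ (by fun_prop) fun t ht h => hw ?_
      rw [← sub_eq_zero.1 h]
      simpa using ht
    have i1 : CircleIntegrable (fun t : ℂ => (t - w)⁻¹ • F t) 0 s := (hi.smul (hx.continuousOn.mono hsS)).circleIntegrable hs.le
    have i2 : CircleIntegrable (fun t : ℂ => (t - w)⁻¹ • F w) 0 s := (hi.smul continuousOn_const).circleIntegrable hs.le
    rw [← circleIntegral.integral_smul_const, ← circleIntegral.integral_sub i1 i2]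
    refine circleIntegral.integral_congr hs.le fun t ht => ?_
    have hne : t ≠ w := by
      rintro rfl
      exact hw (by simpa using ht)
    rw [dslope_of_ne _ hne, slope_def_module]
    exact smul_sub _ _ _
  have iA : (∮ t in C(0, a), (t - w)⁻¹) = 0 := by
    refine Complex.circleIntegral_eq_zero_of_differentiable_on_off_countable ha.le countable_empty ?_ ?_
    · refine ContinuousOn.inv₀ (by fun_prop) fun t ht h => ?_
      rw [sub_eq_zero.1 h] at ht
      have : ‖w‖ ≤ a := by simpa using ht
      linarith
    · rintro t ⟨ht, -⟩
      refine DifferentiableAt.inv (by fun_prop) fun h => ?_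
      rw [sub_eq_zero.1 h] at ht
      have : ‖w‖ < a := by simpa using ht
      linarith
  have iB : (∮ t in C(0, b), (t - w)⁻¹) = 2 * Real.pi * Complex.I :=
    circleIntegral.integral_sub_inv_of_mem_ball (by simpa using h2)
  rw [conv b hb h2.ne (sphB.trans hS), conv a ha h1.ne' (sphA.trans hS), iA, iB, zero_smul, sub_zero] at key
  have h2pi : (2 * Real.pi * Complex.I : ℂ) ≠ 0 := Complex.two_pi_I_ne_zero
  simp only [CI]
  rw [← smul_sub, ← key, sub_sub_cancel, smul_smul, inv_mul_cancel₀ h2pi, one_smul]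

open Classical in
/-- outer Laurent part (with sign) -/
def xout (η : ℝ) (x : P → Y × ℂ → G) (ζ : P) (q : Y × ℂ) : G :=
  if 1 < ‖q.2‖ then CI (1 - η / 2) x ζ q else CI (1 + η / 2) x ζ q - x ζ q

open Classical in
/-- inner Laurent part -/
def xin (η : ℝ) (x : P → Y × ℂ → G) (ζ : P) (q : Y × ℂ) : G :=
  if 1 < ‖q.2‖ then x ζ q + CI (1 - η / 2) x ζ q else CI (1 + η / 2) x ζ q

lemma xin_eq (η : ℝ) (x : P → Y × ℂ → G) (ζ : P) (q : Y × ℂ) : xin η x ζ q = x ζ q + xout η x ζ q := by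
  unfold xin xout
  split_ifs
  · rfl
  · abel

section
variable {N : Set Y} {η : ℝ} {x : P → Y × ℂ → G}

lemma ann_mem {η : ℝ} {w : ℂ} (h1 : 1 - η < ‖w‖) (h2 : ‖w‖ < 1 + η) : w ∈ {w : ℂ | |‖w‖ - 1| < η} :=
  show |‖w‖ - 1| < η from abs_lt.2 ⟨by linarith, by linarith⟩

lemma ann_cl {η : ℝ} (h0 : 0 < η) : closedBall (0 : ℂ) (1 + η / 2) \ ball 0 (1 - η / 2) ⊆ {w : ℂ | |‖w‖ - 1| < η} := by
  rintro w ⟨h1, h2⟩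
  have h1 : ‖w‖ ≤ 1 + η / 2 := by simpa using h1
  have h2 : 1 - η / 2 ≤ ‖w‖ := by simpa using h2
  exact ann_mem (by linarith) (by linarith)

lemma sph_a {η : ℝ} (h0 : 0 < η) : sphere (0 : ℂ) (1 - η / 2) ⊆ {w : ℂ | |‖w‖ - 1| < η} := by
  intro w h
  have h : ‖w‖ = 1 - η / 2 := by simpa using h
  exact ann_mem (by linarith) (by linarith)

lemma sph_b {η : ℝ} (h0 : 0 < η) : sphere (0 : ℂ) (1 + η / 2) ⊆ {w : ℂ | |‖w‖ - 1| < η} := by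
  intro w h
  have h : ‖w‖ = 1 + η / 2 := by simpa using h
  exact ann_mem (by linarith) (by linarith)

lemma slice_diff (hx : HF x (N ×ˢ {w : ℂ | |‖w‖ - 1| < η})) (ζ : P) {y : Y} (hy : y ∈ N) :
    DifferentiableOn ℂ (fun t => x ζ (y, t)) {w : ℂ | |‖w‖ - 1| < η} :=
  (hx.1 ζ).comp (by fun_prop) fun _ ht => ⟨hy, ht⟩

lemma CI_ab (h0 : 0 < η) (h1 : η ≤ 1 / 2) (hx : HF x (N ×ˢ {w : ℂ | |‖w‖ - 1| < η})) (ζ : P) {y : Y} {w : ℂ} (hy : y ∈ N)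
    (hw1 : 1 - η / 2 < ‖w‖) (hw2 : ‖w‖ < 1 + η / 2) :
    CI (1 + η / 2) x ζ (y, w) - CI (1 - η / 2) x ζ (y, w) = x ζ (y, w) :=
  CI_annulus (by linarith) (isOpen_ann η) (ann_cl h0) (slice_diff hx ζ hy) hw1 hw2

lemma xout_HF (oN : IsOpen N) (h0 : 0 < η) (h1 : η ≤ 1 / 2) (hx : HF x (N ×ˢ {w : ℂ | |‖w‖ - 1| < η})) :
    HF (xout η x) (N ×ˢ {w : ℂ | 1 - η < ‖w‖}) := by
  have HA := CI_HF oN (by linarith : 0 < 1 - η / 2) (sph_a h0) hx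
  have HB := CI_HF oN (by linarith : 0 < 1 + η / 2) (sph_b h0) hx
  apply HF.of_local
  rintro ⟨y, w⟩ ⟨hy, hw⟩
  have hw : 1 - η < ‖w‖ := hw
  by_cases h : 1 - η / 2 < ‖w‖
  · refine ⟨N ×ˢ {w : ℂ | 1 - η / 2 < ‖w‖}, CI (1 - η / 2) x, oN.prod (isOpen_lt continuous_const continuous_norm), ⟨hy, h⟩,
      HA.mono (prod_mono_right fun w hw => ne_of_gt hw), ?_⟩
    rintro ζ ⟨y, w⟩ ⟨hy, hw⟩
    have hw : 1 - η / 2 < ‖w‖ := hw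
    unfold xout
    split_ifs with h2
    · rfl
    · have h2 : ¬ 1 < ‖w‖ := h2
      rw [← CI_ab h0 h1 hx ζ hy hw (by linarith)]
      abel
  · refine ⟨N ×ˢ {w : ℂ | 1 - η < ‖w‖ ∧ ‖w‖ < 1}, fun ζ q => CI (1 + η / 2) x ζ q - x ζ q,
      oN.prod ((isOpen_lt continuous_const continuous_norm).inter (isOpen_lt continuous_norm continuous_const)), ⟨hy, hw, by linarith⟩, ?_, ?_⟩
    · refine (HB.mono (prod_mono_right fun w hw => ?_)).sub (hx.mono (prod_mono_right fun w hw => ann_mem hw.1 (hw.2.trans (by linarith))))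
      exact ne_of_lt (hw.2.trans (by linarith))
    · rintro ζ ⟨y, w⟩ ⟨hy, hw⟩
      exact if_neg (not_lt.2 hw.2.le)

lemma xin_HF (oN : IsOpen N) (h0 : 0 < η) (h1 : η ≤ 1 / 2) (hx : HF x (N ×ˢ {w : ℂ | |‖w‖ - 1| < η})) :
    HF (xin η x) (N ×ˢ {w : ℂ | ‖w‖ < 1 + η}) := by
  have HA := CI_HF oN (by linarith : 0 < 1 - η / 2) (sph_a h0) hx
  have HB := CI_HF oN (by linarith : 0 < 1 + η / 2) (sph_b h0) hx
  apply HF.of_local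
  rintro ⟨y, w⟩ ⟨hy, hw⟩
  have hw : ‖w‖ < 1 + η := hw
  by_cases h : ‖w‖ < 1 + η / 2
  · refine ⟨N ×ˢ {w : ℂ | ‖w‖ < 1 + η / 2}, CI (1 + η / 2) x, oN.prod (isOpen_lt continuous_norm continuous_const), ⟨hy, h⟩,
      HB.mono (prod_mono_right fun w hw => ne_of_lt hw), ?_⟩
    rintro ζ ⟨y, w⟩ ⟨hy, hw⟩
    have hw : ‖w‖ < 1 + η / 2 := hw
    unfold xin
    split_ifs with h2
    · have h2 : 1 < ‖w‖ := h2
      rw [← CI_ab h0 h1 hx ζ hy (by linarith) hw]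
      abel
    · rfl
  · refine ⟨N ×ˢ {w : ℂ | 1 < ‖w‖ ∧ ‖w‖ < 1 + η}, fun ζ q => x ζ q + CI (1 - η / 2) x ζ q,
      oN.prod ((isOpen_lt continuous_const continuous_norm).inter (isOpen_lt continuous_norm continuous_const)), ⟨hy, by linarith, hw⟩, ?_, ?_⟩
    · refine (hx.mono (prod_mono_right fun w hw => ann_mem (lt_trans (by linarith) hw.1) hw.2)).add (HA.mono (prod_mono_right fun w hw => ?_))
      exact ne_of_gt (lt_trans (by linarith) hw.1)
    · rintro ζ ⟨y, w⟩ ⟨hy, hw⟩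
      exact if_pos hw.1

lemma x_bounds (h0 : 0 < η) (h1 : η ≤ 1 / 2) {B : ℝ} {ζ : P} {y : Y} 
    (hB : ∀ w : ℂ, |‖w‖ - 1| < η → ‖x ζ (y, w)‖ ≤ B) :
    (∀ w : ℂ, 1 - η < ‖w‖ → ‖xout η x ζ (y, w)‖ ≤ 4 / η * B) ∧ (∀ w : ℂ, ‖w‖ < 1 + η → ‖xin η x ζ (y, w)‖ ≤ 4 / η * B) := by
  have B0 : 0 ≤ B := (norm_nonneg _).trans (hB 1 (by simpa using h0))
  have hA : ∀ w : ℂ, 1 < ‖w‖ → ‖CI (1 - η / 2) x ζ (y, w)‖ ≤ 3 / η * B := by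
    intro w hw
    refine (CI_bound (d := η / 2) (B := B) (by linarith) (by linarith) (fun t ht => hB t (sph_a h0 (by simpa using ht))) ?_).trans ?_
    · exact (by linarith : η / 2 ≤ ‖w‖ - (1 - η / 2)).trans (le_abs_self _)
    · calc (1 - η / 2) * (B / (η / 2)) ≤ 1 * (B / (η / 2)) := by gcongr; linarith
        _ = 2 / η * B := by field_simp
        _ ≤ _ := by gcongr; norm_num
  have hBb : ∀ w : ℂ, ¬ 1 < ‖w‖ → ‖CI (1 + η / 2) x ζ (y, w)‖ ≤ 3 / η * B := by
    intro w hw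
    refine (CI_bound (d := η / 2) (B := B) (by linarith) (by linarith) (fun t ht => hB t (sph_b h0 (by simpa using ht))) ?_).trans ?_
    · rw [abs_sub_comm]
      exact (by linarith : η / 2 ≤ (1 + η / 2) - ‖w‖).trans (le_abs_self _)
    · calc (1 + η / 2) * (B / (η / 2)) ≤ (3 / 2) * (B / (η / 2)) := by gcongr; linarith
        _ = 3 / η * B := by field_simp
  have hone : B ≤ 1 / η * B := by
    have : 1 ≤ 1 / η := by rw [le_div_iff₀ h0]; linarith
    nlinarith
  have e : 4 / η * B = 3 / η * B + 1 / η * B := by ring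
  have h34 : 3 / η * B ≤ 4 / η * B := by gcongr; norm_num
  constructor
  · intro w hw
    unfold xout
    split_ifs with h
    · exact (hA w h).trans h34
    · have h : ¬ 1 < ‖w‖ := h
      refine (norm_sub_le _ _).trans ?_
      rw [e]
      exact add_le_add (hBb w h) ((hB w (ann_mem hw (by linarith))).trans hone)
  · intro w hw
    unfold xin
    split_ifs with h
    · have h : 1 < ‖w‖ := h
      refine (norm_add_le _ _).trans ?_
      rw [e, add_comm]
      exact add_le_add (hA w h) ((hB w (ann_mem (by linarith) hw)).trans hone)
    · exact (hBb w h).trans h34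

lemma xout_sub (h0 : 0 < η) (h1 : η ≤ 1 / 2) {x' : P → Y × ℂ → G} (hx : HF x (N ×ˢ {w : ℂ | |‖w‖ - 1| < η}))
    (hx' : HF x' (N ×ˢ {w : ℂ | |‖w‖ - 1| < η})) (ζ : P) {y : Y} (hy : y ∈ N) (w : ℂ) :
    xout η (fun ζ q => x ζ q - x' ζ q) ζ (y, w) = xout η x ζ (y, w) - xout η x' ζ (y, w) := by
  have c := (slice_diff hx ζ hy).continuousOn
  have c' := (slice_diff hx' ζ hy).continuousOn
  unfold xout
  split_ifs with h
  · have h : 1 < ‖w‖ := h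
    exact CI_sub (by linarith) (by linarith) (c.mono (sph_a h0)) (c'.mono (sph_a h0))
  · have h : ¬ 1 < ‖w‖ := h
    rw [CI_sub (by linarith) (by linarith) (c.mono (sph_b h0)) (c'.mono (sph_b h0))]
    exact sub_sub_sub_comm _ _ _ _

lemma xout_zero (ζ : P) (q : Y × ℂ) : xout η (fun (_ : P) (_ : Y × ℂ) => (0 : G)) ζ q = 0 := by
  unfold xout CI
  simp [circleIntegral]
end
end SC

section SC2
variable {κ : Type} [Fintype κ] [DecidableEq κ]

theorem SC {L Ω : Set (κ → ℂ)} (h : HConv L Ω) {f : (κ → ℂ) → ℂ} (hf : Differentiable ℂ f) {r : ℝ} (hr : 0 < r)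
    (P : Type*) [MetricSpace P] [CompactSpace P] :
    ∃ r' > 0, ∀ μ > 0, ∃ ε > 0, ∀ θ : P → (κ → ℂ) → κ → ℂ, HF θ (thickening r {z ∈ L | ‖f z‖ = 1}) →
      (∀ ζ, ∀ z ∈ thickening r {z ∈ L | ‖f z‖ = 1}, ‖θ ζ z - z‖ ≤ ε) →
      ∃ up um : P → (κ → ℂ) → κ → ℂ, HF up (thickening r' {z ∈ L | 1 ≤ ‖f z‖}) ∧ HF um (thickening r' {z ∈ L | ‖f z‖ ≤ 1}) ∧
        (∀ ζ, ∀ z ∈ thickening r' {z ∈ L | 1 ≤ ‖f z‖}, ‖up ζ z - z‖ ≤ μ) ∧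
        (∀ ζ, ∀ z ∈ thickening r' {z ∈ L | ‖f z‖ ≤ 1}, ‖um ζ z - z‖ ≤ μ) ∧
        ∀ ζ, ∀ z ∈ thickening r' {z ∈ L | 1 ≤ ‖f z‖} ∩ thickening r' {z ∈ L | ‖f z‖ ≤ 1},
          θ ζ (up ζ z) = um ζ z := by
  obtain ⟨η, h0, h1, hη, C, hC, hext⟩ := ext_family h hf hr P
  have hL := h.2.2.1
  have oN : IsOpen (thickening η L) := isOpen_thickening
  obtain ⟨r1, hr1, hp⟩ := (hL.inter_right (isClosed_le continuous_const hf.continuous.norm) :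
    IsCompact {z ∈ L | 1 ≤ ‖f z‖}).exists_thickening_subset_open
      (oN.inter (isOpen_lt continuous_const hf.continuous.norm : IsOpen {z | 1 - η < ‖f z‖}))
      (fun z hz => ⟨self_subset_thickening h0 _ hz.1, lt_of_lt_of_le (by linarith : 1 - η < 1) hz.2⟩)
  obtain ⟨r2, hr2, hm⟩ := (hL.inter_right (isClosed_le hf.continuous.norm continuous_const) :
    IsCompact {z ∈ L | ‖f z‖ ≤ 1}).exists_thickening_subset_open
      (oN.inter (isOpen_lt hf.continuous.norm continuous_const : IsOpen {z | ‖f z‖ < 1 + η}))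
      (fun z hz => ⟨self_subset_thickening h0 _ hz.1, lt_of_le_of_lt hz.2 (by linarith : 1 < 1 + η)⟩)
  have hp' := (thickening_mono (min_le_left r1 r2) _).trans hp
  have hm' := (thickening_mono (min_le_right r1 r2) _).trans hm
  refine ⟨min r1 r2, lt_min hr1 hr2, fun μ hμ => ?_⟩
  set m := min μ (η / 16) with hmdef
  have m0 : 0 < m := by positivity
  have m1 : m ≤ μ := min_le_left _ _
  have m2 : m ≤ η / 16 := min_le_right _ _
  set ε := η / (4 * C) * m with hε
  have ε0 : 0 < ε := by positivity
  have KM : 4 / η * (C * ε) = m := by rw [hε]; field_simp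
  have M0 : 0 ≤ C * ε := by positivity
  refine ⟨ε, ε0, fun θ hθ hb => ?_⟩
  obtain ⟨G, hG, hGb, hGe⟩ := hext (fun ζ z => θ ζ z - z) ε ε0.le (hθ.sub (HF.of_diff differentiableOn_id)) hb
  have oD : IsOpen (thickening η L ×ˢ {w : ℂ | |‖w‖ - 1| < η}) := oN.prod (isOpen_ann η)
  have hsubD : thickening η L ×ˢ {w : ℂ | |‖w‖ - 1| < η} ⊆ thickening η L ×ˢ {w : ℂ | 1 - η < ‖w‖} :=
    prod_mono_right fun w hw => by
      have hw : |‖w‖ - 1| < η := hw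
      change 1 - η < ‖w‖
      linarith [(abs_lt.1 hw).1]
  have hH : HF (fun ζ (q : ((κ → ℂ) × ℂ) × (κ → ℂ)) => G ζ (q.1.1, q.2, q.1.2))
      ((thickening η L ×ˢ {w : ℂ | |‖w‖ - 1| < η}) ×ˢ ball 0 η) :=
    hG.comp (g := fun _ (q : ((κ → ℂ) × ℂ) × (κ → ℂ)) => (q.1.1, q.2, q.1.2)) (HF.of_diff (by fun_prop))
      fun ζ q hq => ⟨hq.1.1, hq.2, hq.1.2⟩
  obtain ⟨x, hx, xb, xob, xe⟩ := fixpt (P := P) (Y := (κ → ℂ) × ℂ) (X := κ → ℂ) oD h0 (K := 4 / η) (by positivity) M0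
    (by rw [mul_assoc, KM]; linarith)
    (H := fun ζ q => G ζ (q.1.1, q.2, q.1.2))
    hH
    (fun ζ q hq => hGb ζ _ ⟨hq.1.1, hq.2, hq.1.2⟩) (xout η)
    (fun x hx => (xout_HF oN h0 h1 hx).mono hsubD)
    (by
      rintro x x' B hx hx' hB ζ ⟨y, w⟩ ⟨hy, hw⟩
      rw [← xout_sub h0 h1 hx hx' ζ hy w]
      exact (x_bounds (x := fun ζ q => x ζ q - x' ζ q) h0 h1 fun w hw => hB ζ (y, w) ⟨hy, hw⟩).1 w (hsubD (mk_mem_prod hy hw)).2)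
    (fun ζ q _ => xout_zero ζ q)
  have bds : ∀ ζ, ∀ y ∈ thickening η L, _ := fun ζ y hy => x_bounds (x := x) (ζ := ζ) (y := y) h0 h1 (B := C * ε) fun w hw => xb ζ (y, w) ⟨hy, hw⟩
  rw [KM] at bds
  have gr : ∀ S, HF (fun (_ : P) z => (z, f z)) S := fun S => HF.of_diff (differentiableOn_id.prodMk hf.differentiableOn)
  refine ⟨fun ζ z => z + xout η x ζ (z, f z), fun ζ z => z + xin η x ζ (z, f z), ?_, ?_, ?_, ?_, ?_⟩
  · exact (HF.of_diff differentiableOn_id).add ((xout_HF oN h0 h1 hx).comp (gr _) fun ζ z hz => hp' hz)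
  · exact (HF.of_diff differentiableOn_id).add ((xin_HF oN h0 h1 hx).comp (gr _) fun ζ z hz => hm' hz)
  · intro ζ z hz
    rw [add_sub_cancel_left]
    exact ((bds ζ z (hp' hz).1).1 _ (hp' hz).2).trans m1
  · intro ζ z hz
    rw [add_sub_cancel_left]
    exact ((bds ζ z (hm' hz).1).2 _ (hm' hz).2).trans m1
  · rintro ζ z ⟨hz1, hz2⟩
    have hD : (z, f z) ∈ thickening η L ×ˢ {w : ℂ | |‖w‖ - 1| < η} := ⟨(hp' hz1).1, ann_mem (hp' hz1).2 (hm' hz2).2⟩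
    have e := xe ζ _ hD
    have hξ : ‖xout η x ζ (z, f z)‖ < η := ((bds ζ z (hp' hz1).1).1 _ (hp' hz1).2).trans_lt (by linarith)
    dsimp only at e ⊢
    have hW : (z, xout η x ζ (z, f z), f z) ∈ WW L η := ⟨hD.1, by simpa using hξ, hD.2⟩
    rw [hGe ζ z _ hW] at e
    rw [xin_eq, e]
    abel
end SC2

section glue
variable {P : Type*} [MetricSpace P] [CompactSpace P]

lemma thick_move {X : Type*} [NormedAddCommGroup X] {S : Set X} {z w : X} {a b c : ℝ} (hz : z ∈ thickening a S) (h : ‖w - z‖ ≤ b) (hc : a + b ≤ c) :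
    w ∈ thickening c S := by
  obtain ⟨s, hs, hd⟩ := mem_thickening_iff.1 hz
  refine mem_thickening_iff.2 ⟨s, hs, ?_⟩
  rw [← dist_eq_norm] at h
  have := dist_triangle w z s
  linarith

lemma theta_ex {X : Type*} [NormedAddCommGroup X] [NormedSpace ℂ X] [ProperSpace X] [CompleteSpace X] {Am Ap A0 : Set X} (h0m : A0 ⊆ Am) (h0p : A0 ⊆ Ap) {r0 M : ℝ} (hr : 0 < r0) (hM : 0 ≤ M)
    (h16 : 16 * M ≤ r0) {αm αp : P → X → X} (hm : HF αm (thickening r0 Am)) (hp : HF αp (thickening r0 Ap))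
    (bm : ∀ ζ, ∀ z ∈ thickening r0 Am, ‖αm ζ z - z‖ ≤ M) (bp : ∀ ζ, ∀ z ∈ thickening r0 Ap, ‖αp ζ z - z‖ ≤ M) :
    ∃ θ : P → X → X, HF θ (thickening (r0 / 4) A0) ∧ (∀ ζ, ∀ z ∈ thickening (r0 / 4) A0, ‖θ ζ z - z‖ ≤ 2 * M) ∧
      ∀ ζ, ∀ z ∈ thickening (r0 / 4) A0, αm ζ (θ ζ z) = αp ζ z := by
  obtain ⟨k, hk, kb, ke⟩ := HF.inv hr hM h16 hm bm
  have s1 : thickening (r0 / 4) A0 ⊆ thickening r0 Ap :=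
    (thickening_mono (by linarith) _).trans (thickening_subset_of_subset _ h0p)
  have s2 : ∀ ζ, ∀ z ∈ thickening (r0 / 4) A0, αp ζ z ∈ thickening (r0 / 2) Am := fun ζ z hz =>
    thickening_subset_of_subset _ h0m (thick_move hz (bp ζ z (s1 hz)) (by linarith))
  refine ⟨fun ζ z => k ζ (αp ζ z), hk.comp (hp.mono s1) s2, fun ζ z hz => ?_, fun ζ z hz => ke ζ _ (s2 ζ z hz)⟩
  have e : k ζ (αp ζ z) - z = (k ζ (αp ζ z) - αp ζ z) + (αp ζ z - z) := by abel
  rw [e, two_mul]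
  exact (norm_add_le _ _).trans (add_le_add (kb ζ _ (s2 ζ z hz)) (bp ζ z (s1 hz)))

lemma glue_part {X : Type*} [NormedAddCommGroup X] [NormedSpace ℂ X] {Am Ap A0 Lm Lp : Set X} (hLm : Am ⊆ Lm) (hLp : Ap ⊆ Lp)
    {r0 r' r'' m M : ℝ} (hr1 : r'' ≤ r') (hr2 : r'' ≤ r0 / 2) (hm8 : m ≤ r0 / 8) (hr0 : 0 < r0)
    (hinter : thickening r'' Ap ∩ thickening r'' Am ⊆ thickening (r0 / 8) A0)
    {αm αp θ up um : P → X → X} (hm : HF αm (thickening r0 Am)) (hp : HF αp (thickening r0 Ap))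
    (bm : ∀ ζ, ∀ z ∈ thickening r0 Am, ‖αm ζ z - z‖ ≤ M) (bp : ∀ ζ, ∀ z ∈ thickening r0 Ap, ‖αp ζ z - z‖ ≤ M)
    (hθ : ∀ ζ, ∀ z ∈ thickening (r0 / 4) A0, αm ζ (θ ζ z) = αp ζ z)
    (hum : HF um (thickening r' Lm)) (hup : HF up (thickening r' Lp))
    (bum : ∀ ζ, ∀ z ∈ thickening r' Lm, ‖um ζ z - z‖ ≤ m) (bup : ∀ ζ, ∀ z ∈ thickening r' Lp, ‖up ζ z - z‖ ≤ m)
    (he : ∀ ζ, ∀ z ∈ thickening r' Lp ∩ thickening r' Lm, θ ζ (up ζ z) = um ζ z) :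
    ∃ α : P → X → X, HF α (thickening r'' (Ap ∪ Am)) ∧ (∀ ζ, ∀ z ∈ thickening r'' Ap, α ζ z = αp ζ (up ζ z)) ∧
      (∀ ζ, ∀ z ∈ thickening r'' Am, α ζ z = αm ζ (um ζ z)) ∧
      (∀ ζ, ∀ z ∈ thickening r'' (Ap ∪ Am), ‖α ζ z - z‖ ≤ M + m) ∧
      ∀ ζ, ∀ z ∈ thickening r' Lp ∩ thickening r' Lm, z ∈ thickening (r0 / 8) A0 → αm ζ (um ζ z) = αp ζ (up ζ z) := by
  have sm : thickening r'' Am ⊆ thickening r' Lm := (thickening_mono hr1 _).trans (thickening_subset_of_subset _ hLm)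
  have sp : thickening r'' Ap ⊆ thickening r' Lp := (thickening_mono hr1 _).trans (thickening_subset_of_subset _ hLp)
  have mm : ∀ ζ, ∀ z ∈ thickening r'' Am, um ζ z ∈ thickening r0 Am := fun ζ z hz =>
    thick_move hz (bum ζ z (sm hz)) (by linarith)
  have mp : ∀ ζ, ∀ z ∈ thickening r'' Ap, up ζ z ∈ thickening r0 Ap := fun ζ z hz =>
    thick_move hz (bup ζ z (sp hz)) (by linarith)
  have FA : ∀ ζ, ∀ z ∈ thickening r' Lp ∩ thickening r' Lm, z ∈ thickening (r0 / 8) A0 → αm ζ (um ζ z) = αp ζ (up ζ z) := by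
    intro ζ z hz h0
    rw [← he ζ z hz]
    exact hθ ζ _ (thick_move h0 (bup ζ z hz.1) (by linarith))
  obtain ⟨α, hα, e1, e2⟩ := HF.glue isOpen_thickening isOpen_thickening (hp.comp (hup.mono sp) mp) (hm.comp (hum.mono sm) mm)
    (fun ζ z hz => (FA ζ z ⟨sp hz.1, sm hz.2⟩ (hinter hz)).symm)
  refine ⟨α, by rwa [thickening_union], e1, e2, ?_, FA⟩
  intro ζ z hz
  rw [thickening_union] at hz
  rcases hz with hz | hz
  · rw [e1 ζ z hz]
    have e : αp ζ (up ζ z) - z = (αp ζ (up ζ z) - up ζ z) + (up ζ z - z) := by abel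
    rw [e]
    exact (norm_add_le _ _).trans (add_le_add (bp ζ _ (mp ζ z hz)) (bup ζ z (sp hz)))
  · rw [e2 ζ z hz]
    have e : αm ζ (um ζ z) - z = (αm ζ (um ζ z) - um ζ z) + (um ζ z - z) := by abel
    rw [e]
    exact (norm_add_le _ _).trans (add_le_add (bm ζ _ (mm ζ z hz)) (bum ζ z (sm hz)))

/-- solvability with fixed radius -/
def NSr (P : Type*) [MetricSpace P] {X : Type*} [NormedAddCommGroup X] [NormedSpace ℂ X] (Ct SA SB : Set X) (r : ℝ) : Prop :=
  thickening r SA ∩ thickening r SB ⊆ Ct ∧ ∀ μ > 0, ∃ ε > 0, ∀ γ : P → X → X, HF γ Ct →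
    (∀ ζ, ∀ z ∈ Ct, ‖γ ζ z - z‖ ≤ ε) → ∃ α β : P → X → X, HF α (thickening r SA) ∧ HF β (thickening r SB) ∧
      (∀ ζ, ∀ z ∈ thickening r SA, ‖α ζ z - z‖ ≤ μ) ∧ (∀ ζ, ∀ z ∈ thickening r SB, ‖β ζ z - z‖ ≤ μ) ∧
      ∀ ζ, ∀ z ∈ thickening r SA ∩ thickening r SB, α ζ z ∈ Ct ∧ γ ζ (α ζ z) = β ζ z

lemma NSr.mono {X : Type*} [NormedAddCommGroup X] [NormedSpace ℂ X] {Ct SA SB : Set X} {r r' : ℝ} (h : NSr P Ct SA SB r) (hr : r' ≤ r) :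
    NSr P Ct SA SB r' := by
  have sA := thickening_mono hr SA
  have sB := thickening_mono hr SB
  refine ⟨(inter_subset_inter sA sB).trans h.1, fun μ hμ => ?_⟩
  obtain ⟨ε, hε, H⟩ := h.2 μ hμ
  refine ⟨ε, hε, fun γ hγ hb => ?_⟩
  obtain ⟨α, β, h1, h2, h3, h4, h5⟩ := H γ hγ hb
  exact ⟨α, β, h1.mono sA, h2.mono sB, fun ζ z hz => h3 ζ z (sA hz), fun ζ z hz => h4 ζ z (sB hz), fun ζ z hz => h5 ζ z ⟨sA hz.1, sB hz.2⟩⟩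

variable {κ : Type} [Fintype κ] [DecidableEq κ]

theorem NS_glue {Ct SA SB Ω : Set (κ → ℂ)} (cA : IsCompact SA) (cB : IsCompact SB) (hH : HConv (SA ∪ SB) Ω)
    {f : (κ → ℂ) → ℂ} (hf : Differentiable ℂ f)
    (hm : ∃ r > 0, NSr P Ct {z ∈ SA | ‖f z‖ ≤ 1} {z ∈ SB | ‖f z‖ ≤ 1} r)
    (hp : ∃ r > 0, NSr P Ct {z ∈ SA | 1 ≤ ‖f z‖} {z ∈ SB | 1 ≤ ‖f z‖} r) :
    ∃ r > 0, NSr P Ct SA SB r := by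
  obtain ⟨r1, hr1, hm⟩ := hm
  obtain ⟨r2, hr2, hp⟩ := hp
  obtain ⟨r0, hr0, hm, hp⟩ : ∃ r0 > 0, NSr P Ct {z ∈ SA | ‖f z‖ ≤ 1} {z ∈ SB | ‖f z‖ ≤ 1} r0 ∧
      NSr P Ct {z ∈ SA | 1 ≤ ‖f z‖} {z ∈ SB | 1 ≤ ‖f z‖} r0 :=
    ⟨min r1 r2, lt_min hr1 hr2, hm.mono (min_le_left _ _), hp.mono (min_le_right _ _)⟩
  have fc := hf.continuous
  have eqA : {z ∈ SA | 1 ≤ ‖f z‖} ∪ {z ∈ SA | ‖f z‖ ≤ 1} = SA := by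
    ext z
    constructor
    · rintro (h | h) <;> exact h.1
    · intro h
      rcases le_total 1 ‖f z‖ with h' | h'
      · exact Or.inl ⟨h, h'⟩
      · exact Or.inr ⟨h, h'⟩
  have eqB : {z ∈ SB | 1 ≤ ‖f z‖} ∪ {z ∈ SB | ‖f z‖ ≤ 1} = SB := by
    ext z
    constructor
    · rintro (h | h) <;> exact h.1
    · intro h
      rcases le_total 1 ‖f z‖ with h' | h'
      · exact Or.inl ⟨h, h'⟩
      · exact Or.inr ⟨h, h'⟩
  have eq0 : {z ∈ SA ∪ SB | ‖f z‖ = 1} = {z ∈ SA | ‖f z‖ = 1} ∪ {z ∈ SB | ‖f z‖ = 1} := by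
    ext z
    constructor
    · rintro ⟨h | h, h'⟩
      · exact Or.inl ⟨h, h'⟩
      · exact Or.inr ⟨h, h'⟩
    · rintro (⟨h, h'⟩ | ⟨h, h'⟩)
      · exact ⟨Or.inl h, h'⟩
      · exact ⟨Or.inr h, h'⟩
  have cAp : IsCompact {z ∈ SA | 1 ≤ ‖f z‖} := cA.inter_right (isClosed_le continuous_const fc.norm)
  have cAm : IsCompact {z ∈ SA | ‖f z‖ ≤ 1} := cA.inter_right (isClosed_le fc.norm continuous_const)
  have cBp : IsCompact {z ∈ SB | 1 ≤ ‖f z‖} := cB.inter_right (isClosed_le continuous_const fc.norm)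
  have cBm : IsCompact {z ∈ SB | ‖f z‖ ≤ 1} := cB.inter_right (isClosed_le fc.norm continuous_const)
  obtain ⟨r', hr', hSC⟩ := SC hH hf (r := r0 / 4) (by positivity) P
  rw [eq0] at hSC
  -- inclusions
  have iAm : {z ∈ SA | ‖f z‖ = 1} ⊆ {z ∈ SA | ‖f z‖ ≤ 1} := fun z hz => ⟨hz.1, hz.2.le⟩
  have iAp : {z ∈ SA | ‖f z‖ = 1} ⊆ {z ∈ SA | 1 ≤ ‖f z‖} := fun z hz => ⟨hz.1, hz.2.ge⟩
  have iBm : {z ∈ SB | ‖f z‖ = 1} ⊆ {z ∈ SB | ‖f z‖ ≤ 1} := fun z hz => ⟨hz.1, hz.2.le⟩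
  have iBp : {z ∈ SB | ‖f z‖ = 1} ⊆ {z ∈ SB | 1 ≤ ‖f z‖} := fun z hz => ⟨hz.1, hz.2.ge⟩
  have jAm : {z ∈ SA | ‖f z‖ ≤ 1} ⊆ {z ∈ SA ∪ SB | ‖f z‖ ≤ 1} := fun z hz => ⟨Or.inl hz.1, hz.2⟩
  have jAp : {z ∈ SA | 1 ≤ ‖f z‖} ⊆ {z ∈ SA ∪ SB | 1 ≤ ‖f z‖} := fun z hz => ⟨Or.inl hz.1, hz.2⟩
  have jBm : {z ∈ SB | ‖f z‖ ≤ 1} ⊆ {z ∈ SA ∪ SB | ‖f z‖ ≤ 1} := fun z hz => ⟨Or.inr hz.1, hz.2⟩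
  have jBp : {z ∈ SB | 1 ≤ ‖f z‖} ⊆ {z ∈ SA ∪ SB | 1 ≤ ‖f z‖} := fun z hz => ⟨Or.inr hz.1, hz.2⟩
  have kA : {z ∈ SA | 1 ≤ ‖f z‖} ∩ {z ∈ SA | ‖f z‖ ≤ 1} ⊆ {z ∈ SA | ‖f z‖ = 1} := fun z hz => ⟨hz.1.1, le_antisymm hz.2.2 hz.1.2⟩
  have kB : {z ∈ SB | 1 ≤ ‖f z‖} ∩ {z ∈ SB | ‖f z‖ ≤ 1} ⊆ {z ∈ SB | ‖f z‖ = 1} := fun z hz => ⟨hz.1.1, le_antisymm hz.2.2 hz.1.2⟩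
  have kpmA : {z ∈ SA | 1 ≤ ‖f z‖} ∩ {z ∈ SB | ‖f z‖ ≤ 1} ⊆ {z ∈ SA | ‖f z‖ = 1} := fun z hz => ⟨hz.1.1, le_antisymm hz.2.2 hz.1.2⟩
  have kpmB : {z ∈ SA | 1 ≤ ‖f z‖} ∩ {z ∈ SB | ‖f z‖ ≤ 1} ⊆ {z ∈ SB | ‖f z‖ = 1} := fun z hz => ⟨hz.2.1, le_antisymm hz.2.2 hz.1.2⟩
  have kmpA : {z ∈ SA | ‖f z‖ ≤ 1} ∩ {z ∈ SB | 1 ≤ ‖f z‖} ⊆ {z ∈ SA | ‖f z‖ = 1} := fun z hz => ⟨hz.1.1, le_antisymm hz.1.2 hz.2.2⟩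
  have kmpB : {z ∈ SA | ‖f z‖ ≤ 1} ∩ {z ∈ SB | 1 ≤ ‖f z‖} ⊆ {z ∈ SB | ‖f z‖ = 1} := fun z hz => ⟨hz.2.1, le_antisymm hz.1.2 hz.2.2⟩
  have r8 : 0 < r0 / 8 := by positivity
  obtain ⟨t1, ht1, T1⟩ := thick_inter cAp cAm r8
  obtain ⟨t2, ht2, T2⟩ := thick_inter cBp cBm r8
  obtain ⟨t3, ht3, T3⟩ := thick_inter cAp cBm r8
  obtain ⟨t4, ht4, T4⟩ := thick_inter cAm cBp r8
  replace T1 := T1.trans (thickening_subset_of_subset _ kA)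
  replace T2 := T2.trans (thickening_subset_of_subset _ kB)
  have T3A := T3.trans (thickening_subset_of_subset _ kpmA)
  have T3B := T3.trans (thickening_subset_of_subset _ kpmB)
  have T4A := T4.trans (thickening_subset_of_subset _ kmpA)
  have T4B := T4.trans (thickening_subset_of_subset _ kmpB)
  clear T3 T4 kA kB kpmA kpmB kmpA kmpB
  generalize {z ∈ SA ∪ SB | ‖f z‖ ≤ 1} = Lm at *
  generalize {z ∈ SA ∪ SB | 1 ≤ ‖f z‖} = Lp at *
  generalize {z ∈ SA | ‖f z‖ = 1} = A0 at *
  generalize {z ∈ SB | ‖f z‖ = 1} = B0 at *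
  generalize {z ∈ SA | ‖f z‖ ≤ 1} = Am at *
  generalize {z ∈ SB | ‖f z‖ ≤ 1} = Bm at *
  generalize {z ∈ SA | 1 ≤ ‖f z‖} = Ap at *
  generalize {z ∈ SB | 1 ≤ ‖f z‖} = Bp at *
  obtain ⟨r'', hr'', q1, q2, q3, q4, q5, q6⟩ : ∃ r'' > 0, r'' ≤ r' ∧ r'' ≤ r0 / 2 ∧ r'' ≤ t1 ∧ r'' ≤ t2 ∧ r'' ≤ t3 ∧ r'' ≤ t4 := by
    refine ⟨min (min r' (r0 / 2)) (min (min t1 t2) (min t3 t4)), by positivity, ?_, ?_, ?_, ?_, ?_, ?_⟩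
    · exact (min_le_left _ _).trans (min_le_left _ _)
    · exact (min_le_left _ _).trans (min_le_right _ _)
    · exact (min_le_right _ _).trans ((min_le_left _ _).trans (min_le_left _ _))
    · exact (min_le_right _ _).trans ((min_le_left _ _).trans (min_le_right _ _))
    · exact (min_le_right _ _).trans ((min_le_right _ _).trans (min_le_left _ _))
    · exact (min_le_right _ _).trans ((min_le_right _ _).trans (min_le_right _ _))
  replace T1 := (inter_subset_inter (thickening_mono q3 _) (thickening_mono q3 _)).trans T1
  replace T2 := (inter_subset_inter (thickening_mono q4 _) (thickening_mono q4 _)).trans T2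
  replace T3A := (inter_subset_inter (thickening_mono q5 _) (thickening_mono q5 _)).trans T3A
  replace T3B := (inter_subset_inter (thickening_mono q5 _) (thickening_mono q5 _)).trans T3B
  replace T4A := (inter_subset_inter (thickening_mono q6 _) (thickening_mono q6 _)).trans T4A
  replace T4B := (inter_subset_inter (thickening_mono q6 _) (thickening_mono q6 _)).trans T4B
  have u : ∀ S : Set (κ → ℂ), thickening r'' S ⊆ thickening r0 S := fun S => thickening_mono (by linarith) S
  have u' : ∀ S : Set (κ → ℂ), thickening r'' S ⊆ thickening r' S := fun S => thickening_mono (by linarith) S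
  have u8 : ∀ {S S' : Set (κ → ℂ)}, S ⊆ S' → thickening (r0 / 8) S ⊆ thickening r0 S' := fun h =>
    (thickening_mono (by linarith) _).trans (thickening_subset_of_subset _ h)
  refine ⟨r'', hr'', ?_, fun μ hμ => ?_⟩
  · rw [← eqA, ← eqB, thickening_union, thickening_union]
    rintro z ⟨hA | hA, hB | hB⟩
    · exact hp.1 ⟨u _ hA, u _ hB⟩
    · exact hp.1 ⟨u8 iAp (T3A ⟨hA, hB⟩), u8 iBp (T3B ⟨hA, hB⟩)⟩
    · exact hp.1 ⟨u8 iAp (T4A ⟨hA, hB⟩), u8 iBp (T4B ⟨hA, hB⟩)⟩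
    · exact hm.1 ⟨u _ hA, u _ hB⟩
  obtain ⟨m, hm0, m1, m2⟩ : ∃ m > 0, m ≤ μ / 2 ∧ m ≤ r0 / 8 := ⟨min (μ / 2) (r0 / 8), by positivity, min_le_left _ _, min_le_right _ _⟩
  obtain ⟨ε1, hε1, hSC⟩ := hSC m hm0
  obtain ⟨M, hM0, M1, M2, M3⟩ : ∃ M > 0, M ≤ μ / 2 ∧ M ≤ ε1 / 2 ∧ M ≤ r0 / 32 :=
    ⟨min (μ / 2) (min (ε1 / 2) (r0 / 32)), by positivity, min_le_left _ _, (min_le_right _ _).trans (min_le_left _ _),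
      (min_le_right _ _).trans (min_le_right _ _)⟩
  obtain ⟨εm, hεm, Hm⟩ := hm.2 M hM0
  obtain ⟨εp, hεp, Hp⟩ := hp.2 M hM0
  refine ⟨min εm εp, lt_min hεm hεp, fun γ hγ hb => ?_⟩
  obtain ⟨αm, βm, hαm, hβm, bαm, bβm, eqm⟩ := Hm γ hγ fun ζ z hz => (hb ζ z hz).trans (min_le_left _ _)
  obtain ⟨αp, βp, hαp, hβp, bαp, bβp, eqp⟩ := Hp γ hγ fun ζ z hz => (hb ζ z hz).trans (min_le_right _ _)
  obtain ⟨θA, hθA, bθA, eA⟩ := theta_ex iAm iAp hr0 hM0.le (by linarith) hαm hαp bαm bαp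
  obtain ⟨θB, hθB, bθB, eB⟩ := theta_ex iBm iBp hr0 hM0.le (by linarith) hβm hβp bβm bβp
  have agree : ∀ ζ, ∀ z ∈ thickening (r0 / 4) A0 ∩ thickening (r0 / 4) B0, θA ζ z = θB ζ z := by
    rintro ζ z ⟨hzA, hzB⟩
    have inj := inj_near hr0 (by linarith : 16 * M < r0) (hβm.1 ζ) (bβm ζ)
    have uB : θA ζ z ∈ thickening (r0 / 2) Bm := thickening_subset_of_subset _ iBm (thick_move hzB (bθA ζ z hzA) (by linarith))
    have uA : θA ζ z ∈ thickening r0 Am := thickening_subset_of_subset _ iAm (thick_move hzA (bθA ζ z hzA) (by linarith))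
    have vB : θB ζ z ∈ thickening (r0 / 2) Bm := thickening_subset_of_subset _ iBm (thick_move hzB (bθB ζ z hzB) (by linarith))
    refine inj uB vB ?_
    have zp : z ∈ thickening r0 Ap ∩ thickening r0 Bp :=
      ⟨thickening_subset_of_subset _ iAp (thickening_mono (by linarith) _ hzA), thickening_subset_of_subset _ iBp (thickening_mono (by linarith) _ hzB)⟩
    rw [eB ζ z hzB, ← (eqp ζ z zp).2, ← eA ζ z hzA, (eqm ζ _ ⟨uA, thickening_mono (by linarith) _ uB⟩).2]
  obtain ⟨θ, hθ, θe1, θe2⟩ := HF.glue isOpen_thickening isOpen_thickening hθA hθB agree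
  rw [← thickening_union] at hθ
  have bθ : ∀ ζ, ∀ z ∈ thickening (r0 / 4) (A0 ∪ B0), ‖θ ζ z - z‖ ≤ ε1 := by
    intro ζ z hz
    rw [thickening_union] at hz
    rcases hz with hz | hz
    · rw [θe1 ζ z hz]; exact (bθA ζ z hz).trans (by linarith)
    · rw [θe2 ζ z hz]; exact (bθB ζ z hz).trans (by linarith)
  obtain ⟨up, um, hup, hum, bup, bum, he⟩ := hSC θ hθ bθ
  obtain ⟨α, hα, α1, α2, bα, FA⟩ := glue_part jAm jAp q1 q2 m2 hr0 T1 hαm hαp bαm bαp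
    (fun ζ z hz => by rw [θe1 ζ z hz, eA ζ z hz]) hum hup bum bup he
  obtain ⟨β, hβ, β1, β2, bβ, FB⟩ := glue_part jBm jBp q1 q2 m2 hr0 T2 hβm hβp bβm bβp
    (fun ζ z hz => by rw [θe2 ζ z hz, eB ζ z hz]) hum hup bum bup he
  rw [eqA] at hα bα
  rw [eqB] at hβ bβ
  refine ⟨α, β, hα, hβ, fun ζ z hz => (bα ζ z hz).trans (by linarith), fun ζ z hz => (bβ ζ z hz).trans (by linarith), ?_⟩
  have vAp : thickening r'' Ap ⊆ thickening r' Lp := (u' _).trans (thickening_subset_of_subset _ jAp)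
  have vBp : thickening r'' Bp ⊆ thickening r' Lp := (u' _).trans (thickening_subset_of_subset _ jBp)
  have vAm : thickening r'' Am ⊆ thickening r' Lm := (u' _).trans (thickening_subset_of_subset _ jAm)
  have vBm : thickening r'' Bm ⊆ thickening r' Lm := (u' _).trans (thickening_subset_of_subset _ jBm)
  -- the mixed case
  have mix : ∀ ζ z, z ∈ thickening r' Lp → z ∈ thickening (r0 / 8) A0 → z ∈ thickening (r0 / 8) B0 →
      αp ζ (up ζ z) ∈ Ct ∧ γ ζ (αp ζ (up ζ z)) = βp ζ (up ζ z) := by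
    intro ζ z hz h1 h2
    exact eqp ζ _ ⟨thickening_subset_of_subset _ iAp (thick_move h1 (bup ζ z hz) (by linarith)),
      thickening_subset_of_subset _ iBp (thick_move h2 (bup ζ z hz) (by linarith))⟩
  rintro ζ z ⟨hA, hB⟩
  rw [← eqA, thickening_union] at hA
  rw [← eqB, thickening_union] at hB
  rcases hA with hA | hA <;> rcases hB with hB | hB
  · rw [α1 ζ z hA, β1 ζ z hB]
    exact eqp ζ _ ⟨thick_move hA (bup ζ z (vAp hA)) (by linarith), thick_move hB (bup ζ z (vAp hA)) (by linarith)⟩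
  · rw [α1 ζ z hA, β2 ζ z hB, FB ζ z ⟨vAp hA, vBm hB⟩ (T3B ⟨hA, hB⟩)]
    exact mix ζ z (vAp hA) (T3A ⟨hA, hB⟩) (T3B ⟨hA, hB⟩)
  · rw [α2 ζ z hA, β1 ζ z hB, FA ζ z ⟨vBp hB, vAm hA⟩ (T4A ⟨hA, hB⟩)]
    exact mix ζ z (vBp hB) (T4A ⟨hA, hB⟩) (T4B ⟨hA, hB⟩)
  · rw [α2 ζ z hA, β2 ζ z hB]
    exact eqm ζ _ ⟨thick_move hA (bum ζ z (vAm hA)) (by linarith), thick_move hB (bum ζ z (vAm hA)) (by linarith)⟩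
end glue

section boxes
variable {κ : Type} [Fintype κ] [DecidableEq κ]

def lf (i : κ × Bool) (z : κ → ℂ) : ℂ := if i.2 then z i.1 else -Complex.I * z i.1

lemma lf_re (i : κ × Bool) (z : κ → ℂ) : (lf i z).re = lc i z := by
  unfold lf lc; split <;> simp

lemma lf_diff (i : κ × Bool) : Differentiable ℂ (lf (κ := κ) i) := by
  obtain ⟨k, b⟩ := i
  cases b
  · have : lf (κ := κ) (k, false) = fun z => -Complex.I * z k := by funext z; simp [lf]
    rw [this]; fun_prop
  · have : lf (κ := κ) (k, true) = fun z => z k := by funext z; simp [lf]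
    rw [this]; fun_prop

lemma norm_exp_lf (i : κ × Bool) (a : ℝ) (z : κ → ℂ) : ‖Complex.exp (lf i z - a)‖ = Real.exp (lc i z - a) := by
  rw [Complex.norm_exp, Complex.sub_re, lf_re, Complex.ofReal_re]

lemma norm_exp_lf' (i : κ × Bool) (a : ℝ) (z : κ → ℂ) : ‖Complex.exp (a - lf i z)‖ = Real.exp (a - lc i z) := by
  rw [Complex.norm_exp, Complex.sub_re, lf_re, Complex.ofReal_re]

lemma HConv.box {L Ω : Set (κ → ℂ)} (h : HConv L Ω) (lo hi : κ × Bool → ℝ) : HConv (L ∩ _root_.box lo hi) Ω := by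
  obtain ⟨h1, h2, h3, h4⟩ := h
  refine ⟨h1, inter_subset_left.trans h2, h3.inter_right (isClosed_box _ _), fun p hp hpn => ?_⟩
  by_cases hL : p ∈ L
  · have hb : ¬ ∀ i, lo i ≤ lc i p ∧ lc i p ≤ hi i := fun h => hpn ⟨hL, h⟩
    push Not at hb
    obtain ⟨i, hi'⟩ := hb
    by_cases hl : lo i ≤ lc i p
    · refine ⟨fun z => Complex.exp (lf i z - (hi i : ℝ)), (((lf_diff i).sub_const _).cexp).differentiableOn, fun z hz => ?_, ?_⟩
      · rw [norm_exp_lf, Real.exp_le_one_iff]; linarith [(hz.2 i).2]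
      · rw [norm_exp_lf, Real.one_lt_exp_iff]; linarith [hi' hl]
    · refine ⟨fun z => Complex.exp ((lo i : ℝ) - lf i z), (((lf_diff i).const_sub _).cexp).differentiableOn, fun z hz => ?_, ?_⟩
      · rw [norm_exp_lf', Real.exp_le_one_iff]; linarith [(hz.2 i).1]
      · rw [norm_exp_lf', Real.one_lt_exp_iff]; linarith
  · obtain ⟨g, g1, g2, g3⟩ := h4 p hp hL
    exact ⟨g, g1, fun z hz => g2 z hz.1, g3⟩

variable {P : Type*} [MetricSpace P] [CompactSpace P]

lemma NSr_empty {X : Type*} [NormedAddCommGroup X] [NormedSpace ℂ X] {Ct SA SB : Set X} {r : ℝ}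
    (h : thickening r SA ∩ thickening r SB = ∅) : NSr P Ct SA SB r := by
  refine ⟨by rw [h]; exact empty_subset _, fun μ hμ => ⟨1, one_pos, fun γ _ _ => ?_⟩⟩
  refine ⟨fun _ z => z, fun _ z => z, HF.of_diff differentiableOn_id, HF.of_diff differentiableOn_id, ?_, ?_, ?_⟩
  · intro ζ z _; simpa using hμ.le
  · intro ζ z _; simpa using hμ.le
  · intro ζ z hz; rw [h] at hz; exact hz.elim

lemma NSr_inside {X : Type*} [NormedAddCommGroup X] [NormedSpace ℂ X] {Ct SA SB : Set X} {r : ℝ}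
    (h : thickening r SB ⊆ Ct) : NSr P Ct SA SB r := by
  refine ⟨inter_subset_right.trans h, fun μ hμ => ⟨μ, hμ, fun γ hγ hb => ?_⟩⟩
  refine ⟨fun _ z => z, γ, HF.of_diff differentiableOn_id, hγ.mono h, ?_, ?_, ?_⟩
  · intro ζ z _; simpa using hμ.le
  · intro ζ z hz; exact hb ζ z (h hz)
  · intro ζ z hz; exact ⟨h hz.2, rfl⟩

theorem NS_main {Ct A1 B1 Ω : Set (κ → ℂ)} (cA : IsCompact A1) (cB : IsCompact B1) (hH : HConv (A1 ∪ B1) Ω)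
    (oC : IsOpen Ct) (hC : A1 ∩ B1 ⊆ Ct) : ∃ r > 0, NSr P Ct A1 B1 r := by
  obtain ⟨ρ, hρ, hρC⟩ := (cA.inter cB).exists_thickening_subset_open oC hC
  obtain ⟨t, ht, htρ⟩ := thick_inter cA cB hρ
  have key : ∀ lo hi : κ × Bool → ℝ, ∃ r > 0, NSr P Ct (A1 ∩ box lo hi) (B1 ∩ box lo hi) r := by
    refine box_induction (δ := t / 8) _ (by positivity) ?_ ?_
    · intro lo hi hs
      by_cases hne : (A1 ∩ box lo hi).Nonempty
      · obtain ⟨p, hp⟩ := hne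
        refine ⟨t / 4, by positivity, NSr_inside ?_⟩
        refine Subset.trans ?_ (htρ.trans hρC)
        intro z hz
        obtain ⟨q, hq, hzq⟩ := mem_thickening_iff.1 hz
        have h1 := box_small (by positivity) hs hq.2 hp.2
        have h2 := dist_triangle z q p
        exact ⟨mem_thickening_iff.2 ⟨p, hp.1, by linarith⟩, mem_thickening_iff.2 ⟨q, hq.1, by linarith⟩⟩
      · rw [not_nonempty_iff_eq_empty] at hne
        exact ⟨1, one_pos, NSr_empty (by rw [hne, thickening_empty, empty_inter])⟩
    · intro lo hi i a hlo hhi h1 h2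
      rw [box_upd_hi hhi] at h1
      rw [box_upd_lo hlo] at h2
      have e1 : ∀ S : Set (κ → ℂ), S ∩ (box lo hi ∩ {z | lc i z ≤ a}) = {z ∈ S ∩ box lo hi | ‖Complex.exp (lf i z - (a:ℝ))‖ ≤ 1} := by
        intro S
        rw [← inter_assoc]
        ext z
        refine and_congr_right fun _ => ?_
        show _ ↔ ‖Complex.exp (lf i z - (a:ℝ))‖ ≤ 1
        rw [norm_exp_lf, Real.exp_le_one_iff, sub_nonpos]; rfl
      have e2 : ∀ S : Set (κ → ℂ), S ∩ (box lo hi ∩ {z | a ≤ lc i z}) = {z ∈ S ∩ box lo hi | 1 ≤ ‖Complex.exp (lf i z - (a:ℝ))‖} := by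
        intro S
        rw [← inter_assoc]
        ext z
        refine and_congr_right fun _ => ?_
        show _ ↔ 1 ≤ ‖Complex.exp (lf i z - (a:ℝ))‖
        rw [norm_exp_lf, Real.one_le_exp_iff, sub_nonneg]; rfl
      rw [e1, e1] at h1
      rw [e2, e2] at h2
      have hH' : HConv (A1 ∩ box lo hi ∪ B1 ∩ box lo hi) Ω := by
        rw [← union_inter_distrib_right]; exact hH.box lo hi
      exact NS_glue (cA.inter_right (isClosed_box _ _)) (cB.inter_right (isClosed_box _ _)) hH'
        (f := fun z => Complex.exp (lf i z - (a:ℝ))) (((lf_diff i).sub_const _).cexp) h1 h2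
  obtain ⟨R, hR⟩ := (cA.union cB).isBounded.exists_norm_le
  have hb : A1 ∪ B1 ⊆ box (fun _ => -R) (fun _ => R) := fun z hz i => by
    have := ((abs_lc_le i z).trans (norm_le_pi_norm _ _)).trans (hR z hz)
    exact abs_le.1 this
  have := key (fun _ => -R) (fun _ => R)
  rwa [inter_eq_left.2 (subset_union_left.trans hb), inter_eq_left.2 (subset_union_right.trans hb)] at this

end boxes


section final
variable {P : Type*} [MetricSpace P] [CompactSpace P]

lemma thick_equiv {X Y : Type*} [NormedAddCommGroup X] [NormedSpace ℂ X] [NormedAddCommGroup Y] [NormedSpace ℂ Y]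
    (e : X ≃L[ℂ] Y) {c : ℝ} (hc : 0 < c) (he : ∀ x, ‖e x‖ ≤ c * ‖x‖) {r : ℝ} {S : Set X} {z : X} (hz : z ∈ thickening (r / c) S) :
    e z ∈ thickening r (e.symm ⁻¹' S) := by
  obtain ⟨s, hs, hd⟩ := mem_thickening_iff.1 hz
  refine mem_thickening_iff.2 ⟨e s, by simpa using hs, ?_⟩
  rw [dist_eq_norm] at *
  rw [← map_sub]
  calc ‖e (z - s)‖ ≤ c * ‖z - s‖ := he _
    _ < c * (r / c) := by gcongr
    _ = r := by field_simp

lemma equiv_bound {X Y : Type*} [NormedAddCommGroup X] [NormedSpace ℂ X] [NormedAddCommGroup Y] [NormedSpace ℂ Y]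
    (e : X ≃L[ℂ] Y) : ∃ c : ℝ, 0 < c ∧ ∀ x, ‖e x‖ ≤ c * ‖x‖ :=
  (e : X →L[ℂ] Y).bound

lemma NS_transport {X Y : Type*} [NormedAddCommGroup X] [NormedSpace ℂ X] [NormedAddCommGroup Y] [NormedSpace ℂ Y]
    (e : X ≃L[ℂ] Y) {Ct SA SB : Set X}
    (h : ∃ r > 0, NSr P (e.symm ⁻¹' Ct) (e.symm ⁻¹' SA) (e.symm ⁻¹' SB) r) : ∃ r > 0, NSr P Ct SA SB r := by
  obtain ⟨r, hr, h1, h2⟩ := h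
  obtain ⟨c, hc, hce⟩ := equiv_bound e
  obtain ⟨d, hd, hde⟩ := equiv_bound e.symm
  have mv : ∀ {S : Set X} {z : X}, z ∈ thickening (r / c) S → e z ∈ thickening r (e.symm ⁻¹' S) :=
    fun hz => thick_equiv e hc hce hz
  refine ⟨r / c, by positivity, fun z hz => by simpa using h1 ⟨mv hz.1, mv hz.2⟩, fun μ hμ => ?_⟩
  obtain ⟨ε, hε, H⟩ := h2 (μ / d) (by positivity)
  refine ⟨ε / c, by positivity, fun γ hγ hb => ?_⟩
  have dE : ∀ U : Set X, HF (fun (_ : P) (z : X) => e z) U := fun U => HF.of_diff e.differentiable.differentiableOn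
  have dS : ∀ U : Set Y, HF (fun (_ : P) (z : Y) => e.symm z) U := fun U => HF.of_diff e.symm.differentiable.differentiableOn
  have hγ' : HF (fun ζ y => e (γ ζ (e.symm y))) (e.symm ⁻¹' Ct) :=
    (dE univ).comp (hγ.comp (dS _) fun _ _ h => h) fun _ _ _ => mem_univ _
  obtain ⟨α, β, hα, hβ, bα, bβ, E⟩ := H _ hγ' (by
    intro ζ y hy
    have e1 : e (γ ζ (e.symm y)) - y = e (γ ζ (e.symm y) - e.symm y) := by simp
    rw [e1]
    refine (hce _).trans ?_
    calc c * ‖γ ζ (e.symm y) - e.symm y‖ ≤ c * (ε / c) := by gcongr; exact hb ζ _ hy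
      _ = ε := by field_simp)
  have bd : ∀ (S : Set X) (a : P → Y → Y), (∀ ζ, ∀ z ∈ thickening r (e.symm ⁻¹' S), ‖a ζ z - z‖ ≤ μ / d) →
      ∀ ζ, ∀ z ∈ thickening (r / c) S, ‖e.symm (a ζ (e z)) - z‖ ≤ μ := by
    intro S a ha ζ z hz
    have e1 : e.symm (a ζ (e z)) - z = e.symm (a ζ (e z) - e z) := by simp
    rw [e1]
    refine (hde _).trans ?_
    calc d * ‖a ζ (e z) - e z‖ ≤ d * (μ / d) := by gcongr; exact ha ζ _ (mv hz)
      _ = μ := by field_simp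
  refine ⟨fun ζ z => e.symm (α ζ (e z)), fun ζ z => e.symm (β ζ (e z)), ?_, ?_, bd _ _ bα, bd _ _ bβ, ?_⟩
  · exact (dS univ).comp (hα.comp (dE _) fun _ _ h => mv h) fun _ _ _ => mem_univ _
  · exact (dS univ).comp (hβ.comp (dE _) fun _ _ h => mv h) fun _ _ _ => mem_univ _
  · intro ζ z hz
    obtain ⟨E1, E2⟩ := E ζ (e z) ⟨mv hz.1, mv hz.2⟩
    refine ⟨E1, ?_⟩
    show γ ζ (e.symm (α ζ (e z))) = e.symm (β ζ (e z))
    rw [← E2]; simp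

lemma HConv.transport {X Y : Type*} [NormedAddCommGroup X] [NormedSpace ℂ X] [NormedAddCommGroup Y] [NormedSpace ℂ Y]
    (e : X ≃L[ℂ] Y) {L Ω : Set X} (h : HConv L Ω) : HConv (e.symm ⁻¹' L) (e.symm ⁻¹' Ω) := by
  obtain ⟨oΩ, hLΩ, hL, hg⟩ := h
  refine ⟨oΩ.preimage e.symm.continuous, preimage_mono hLΩ, ?_, ?_⟩
  · rw [← e.image_eq_preimage_symm]; exact hL.image e.continuous
  · intro p hp hp'
    obtain ⟨g, g1, g2, g3⟩ := hg (e.symm p) hp hp'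
    exact ⟨fun y => g (e.symm y), g1.comp e.symm.differentiable.differentiableOn fun _ h => h, fun z hz => g2 _ hz, g3⟩

lemma NS_X {n : ℕ} {Ct A1 B1 Ω : Set (CSp n)} (cA : IsCompact A1) (cB : IsCompact B1) (hH : HConv (A1 ∪ B1) Ω)
    (oC : IsOpen Ct) (hC : A1 ∩ B1 ⊆ Ct) : ∃ r > 0, NSr P Ct A1 B1 r := by
  let e : CSp n ≃L[ℂ] (Fin n → ℂ) := EuclideanSpace.equiv (Fin n) ℂ
  refine NS_transport e (NS_main (Ω := e.symm ⁻¹' Ω) ?_ ?_ ?_ (oC.preimage e.symm.continuous) (preimage_mono hC))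
  · rw [← e.image_eq_preimage_symm]; exact cA.image e.continuous
  · rw [← e.image_eq_preimage_symm]; exact cB.image e.continuous
  · exact hH.transport e

lemma stein_hull {n : ℕ} {K V : Set (CSp n)} (hK : IsCompact K) (hV : IsSteinOpen V) (hKV : K ⊆ V) :
    ∃ L, K ⊆ L ∧ HConv L V := by
  refine ⟨{z ∈ V | ∀ g : CSp n → ℂ, DifferentiableOn ℂ g V → ‖g z‖ ≤ sSup ((fun w => ‖g w‖) '' K)}, ?_, hV.1, fun z hz => hz.1, hV.2 K hKV hK, ?_⟩
  · intro z hz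
    refine ⟨hKV hz, fun g hg => le_csSup ?_ ⟨z, hz, rfl⟩⟩
    exact (hK.image_of_continuousOn (hg.continuousOn.mono hKV).norm).bddAbove
  · intro p hp hpL
    have : ¬ ∀ g : CSp n → ℂ, DifferentiableOn ℂ g V → ‖g p‖ ≤ sSup ((fun w => ‖g w‖) '' K) := fun h => hpL ⟨hp, h⟩
    push Not at this
    obtain ⟨g, hg, hlt⟩ := this
    have h0 : 0 ≤ sSup ((fun w => ‖g w‖) '' K) := Real.sSup_nonneg (by rintro _ ⟨w, _, rfl⟩; exact norm_nonneg _)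
    obtain ⟨t, ht1, ht2⟩ := exists_between hlt
    have t0 : 0 < t := h0.trans_lt ht1
    have nt : ‖(t : ℂ)‖ = t := by rw [Complex.norm_real, Real.norm_of_nonneg t0.le]
    refine ⟨fun z => (t : ℂ)⁻¹ * g z, hg.const_mul _, fun z hz => ?_, ?_⟩
    · rw [norm_mul, norm_inv, nt, ← div_eq_inv_mul, div_le_one t0]; exact (hz.2 g hg).trans ht1.le
    · rw [norm_mul, norm_inv, nt, ← div_eq_inv_mul, one_lt_div t0]; exact ht2

lemma NS_setup {n : ℕ} {A B Ct : Set (CSp n)} (hA : IsCompact A) (hB : IsCompact B)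
    (hsep : closure (A \ B) ∩ closure (B \ A) = ∅) (hSAB : HasSteinNbhdBasis (A ∪ B)) (oC : IsOpen Ct) (hC : A ∩ B ⊆ Ct) :
    ∃ A1 B1 : Set (CSp n), A ⊆ A1 ∧ B ⊆ B1 ∧ ∃ r > 0, NSr P Ct A1 B1 r := by
  have cK1 : IsCompact (closure (A \ B)) := hA.of_isClosed_subset isClosed_closure (closure_minimal sdiff_subset hA.isClosed)
  obtain ⟨δ, hδ, hdis⟩ := (disjoint_iff_inter_eq_empty.2 hsep).exists_cthickenings cK1 isClosed_closure
  obtain ⟨η, hη, hηC⟩ := (hA.inter hB).exists_cthickening_subset_open oC hC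
  set F1 := cthickening δ (closure (A \ B)) with hF1
  set F2 := cthickening δ (closure (B \ A)) with hF2
  set F3 := cthickening η (A ∩ B) with hF3
  obtain ⟨V, sV, hABV, hVW⟩ := hSAB (thickening δ (closure (A \ B)) ∪ thickening δ (closure (B \ A)) ∪ thickening η (A ∩ B))
    ((isOpen_thickening.union isOpen_thickening).union isOpen_thickening) (by
      rintro z hz
      by_cases hzA : z ∈ A
      · by_cases hzB : z ∈ B
        · exact Or.inr (self_subset_thickening hη _ ⟨hzA, hzB⟩)
        · exact Or.inl (Or.inl (self_subset_thickening hδ _ (subset_closure ⟨hzA, hzB⟩)))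
      · exact Or.inl (Or.inr (self_subset_thickening hδ _ (subset_closure ⟨hz.resolve_left hzA, hzA⟩))))
  obtain ⟨L, hKL, hL⟩ := stein_hull (hA.union hB) sV hABV
  have cL : IsCompact L := hL.2.2.1
  have c1 : IsClosed F1 := isClosed_cthickening
  have c2 : IsClosed F2 := isClosed_cthickening
  have c3 : IsClosed F3 := isClosed_cthickening
  have hLF : L ⊆ F1 ∪ F2 ∪ F3 := by
    intro z hz
    rcases hVW (hL.2.1 hz) with (h | h) | h
    · exact Or.inl (Or.inl (thickening_subset_cthickening _ _ h))
    · exact Or.inl (Or.inr (thickening_subset_cthickening _ _ h))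
    · exact Or.inr (thickening_subset_cthickening _ _ h)
  have hU : L ∩ (F1 ∪ F3) ∪ L ∩ (F2 ∪ F3) = L := by
    refine Subset.antisymm (union_subset inter_subset_left inter_subset_left) fun z hz => ?_
    rcases hLF hz with (h | h) | h
    · exact Or.inl ⟨hz, Or.inl h⟩
    · exact Or.inr ⟨hz, Or.inl h⟩
    · exact Or.inl ⟨hz, Or.inr h⟩
  refine ⟨L ∩ (F1 ∪ F3), L ∩ (F2 ∪ F3), ?_, ?_, NS_X (Ω := V) (cL.inter_right (c1.union c3)) (cL.inter_right (c2.union c3)) (by rwa [hU]) oC ?_⟩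
  · intro z hz
    refine ⟨hKL (Or.inl hz), ?_⟩
    by_cases hzB : z ∈ B
    · exact Or.inr (self_subset_cthickening _ ⟨hz, hzB⟩)
    · exact Or.inl (self_subset_cthickening _ (subset_closure ⟨hz, hzB⟩))
  · intro z hz
    refine ⟨hKL (Or.inr hz), ?_⟩
    by_cases hzA : z ∈ A
    · exact Or.inr (self_subset_cthickening _ ⟨hzA, hz⟩)
    · exact Or.inl (self_subset_cthickening _ (subset_closure ⟨hz, hzA⟩))
  · rintro z ⟨⟨_, h1⟩, _, h2⟩
    rcases h1 with h1 | h1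
    · rcases h2 with h2 | h2
      · exact (Set.disjoint_left.1 hdis h1 h2).elim
      · exact hηC h2
    · exact hηC h1

end final

theorem parametric_cartan_splitting
    (n : ℕ) (hn : 2 ≤ n) (A B : Set (CSp n))
    (hA : IsCompact A) (hB : IsCompact B)
    (hsep : closure (A \ B) ∩ closure (B \ A) = ∅)
    (hSA : HasSteinNbhdBasis A) (hSB : HasSteinNbhdBasis B)
    (hSAB : HasSteinNbhdBasis (A ∪ B)) (hSC : HasSteinNbhdBasis (A ∩ B))
    (P : Type*) [MetricSpace P] [CompactSpace P] :
    ∀ Ct : Set (CSp n), IsOpen Ct → A ∩ B ⊆ Ct →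
      ∃ A' B' C' : Set (CSp n),
        IsOpen A' ∧ IsOpen B' ∧ A ⊆ A' ∧ B ⊆ B' ∧
        A ∩ B ⊆ C' ∧ C' ⊆ A' ∩ B' ∧ A' ∩ B' ⊆ Ct ∧
        ∀ μ > (0:ℝ), ∃ ε > (0:ℝ), ∀ γ : P → CSp n → CSp n,
          (∀ ζ : P, DifferentiableOn ℂ (γ ζ) Ct ∧ Set.InjOn (γ ζ) Ct) →
          ContinuousOn (fun q : P × CSp n => γ q.1 q.2) ((Set.univ : Set P) ×ˢ Ct) →
          (∀ ζ : P, ∀ z ∈ Ct, ‖γ ζ z - z‖ < ε) →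
          ∃ α β : P → CSp n → CSp n,
            (∀ ζ : P, DifferentiableOn ℂ (α ζ) A' ∧ Set.InjOn (α ζ) A') ∧
            (∀ ζ : P, DifferentiableOn ℂ (β ζ) B' ∧ Set.InjOn (β ζ) B') ∧
            ContinuousOn (fun q : P × CSp n => α q.1 q.2) ((Set.univ : Set P) ×ˢ A') ∧
            ContinuousOn (fun q : P × CSp n => β q.1 q.2) ((Set.univ : Set P) ×ˢ B') ∧
            (∀ ζ : P, ∀ z ∈ A', ‖α ζ z - z‖ < μ) ∧
            (∀ ζ : P, ∀ z ∈ B', ‖β ζ z - z‖ < μ) ∧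
            -- γ_ζ = β_ζ ∘ α_ζ⁻¹ on C'
            (∀ ζ : P, C' ⊆ α ζ '' (A' ∩ B')) ∧
            (∀ ζ : P, ∀ z ∈ A' ∩ B', α ζ z ∈ C' → γ ζ (α ζ z) = β ζ z) := by
  intro Ct oC hC
  obtain ⟨A1, B1, hA1, hB1, r, hr, hN1, hN2⟩ := NS_setup (P := P) hA hB hsep hSAB oC hC
  have r8 : r / 4 / 2 ≤ r / 4 := by linarith
  have sA : thickening r A ⊆ thickening r A1 := thickening_subset_of_subset _ hA1
  have sB : thickening r B ⊆ thickening r B1 := thickening_subset_of_subset _ hB1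
  have sA4 : thickening (r / 4) A ⊆ thickening r A := thickening_mono (by linarith) _
  have sB4 : thickening (r / 4) B ⊆ thickening r B := thickening_mono (by linarith) _
  have sA2 : thickening (r / 4) A ⊆ thickening (r / 2) A := thickening_mono (by linarith) _
  have sB2 : thickening (r / 4) B ⊆ thickening (r / 2) B := thickening_mono (by linarith) _
  have sCA : thickening (r / 4) (A ∩ B) ⊆ thickening (r / 4) A := thickening_subset_of_subset _ inter_subset_left
  have sCB : thickening (r / 4) (A ∩ B) ⊆ thickening (r / 4) B := thickening_subset_of_subset _ inter_subset_right
  have sC : thickening (r / 4 / 2) (A ∩ B) ⊆ thickening (r / 4) (A ∩ B) := thickening_mono r8 _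
  refine ⟨thickening (r / 4) A, thickening (r / 4) B, thickening (r / 4 / 2) (A ∩ B), isOpen_thickening, isOpen_thickening,
    self_subset_thickening (by positivity) _, self_subset_thickening (by positivity) _, self_subset_thickening (by positivity) _,
    subset_inter (sC.trans sCA) (sC.trans sCB), (inter_subset_inter (sA4.trans sA) (sB4.trans sB)).trans hN1, fun μ hμ => ?_⟩
  set M := min (μ / 2) (r / 128) with hM
  have M0 : 0 < M := lt_min (by positivity) (by positivity)
  have M1 : M < μ := (min_le_left _ _).trans_lt (by linarith)
  have M2 : M ≤ r / 128 := min_le_right _ _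
  obtain ⟨ε, hε, H⟩ := hN2 M M0
  refine ⟨ε, hε, fun γ hγ hγc hb => ?_⟩
  obtain ⟨α, β, hα, hβ, bα, bβ, E⟩ := H γ ⟨fun ζ => (hγ ζ).1, hγc⟩ fun ζ z hz => (hb ζ z hz).le
  have hα' := hα.mono sA
  have hβ' := hβ.mono sB
  have hαC := hα.mono ((sCA.trans sA4).trans sA)
  obtain ⟨k, -, kb, ke⟩ := HF.inv (S := A ∩ B) (r := r / 4) (M := M) (by positivity) M0.le (by linarith) hαC
    (fun ζ z hz => bα ζ z (sA (sA4 (sCA hz))))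
  refine ⟨α, β, fun ζ => ⟨(hα'.1 ζ).mono sA4, ?_⟩, fun ζ => ⟨(hβ'.1 ζ).mono sB4, ?_⟩, (hα'.mono sA4).2, (hβ'.mono sB4).2,
    fun ζ z hz => (bα ζ z (sA (sA4 hz))).trans_lt M1, fun ζ z hz => (bβ ζ z (sB (sB4 hz))).trans_lt M1, ?_, ?_⟩
  · exact (inj_near hr (by linarith) (hα'.1 ζ) fun z hz => bα ζ z (sA hz)).mono sA2
  · exact (inj_near hr (by linarith) (hβ'.1 ζ) fun z hz => bβ ζ z (sB hz)).mono sB2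
  · intro ζ y hy
    have hk : k ζ y ∈ thickening (r / 4) (A ∩ B) := thick_move hy (kb ζ y hy) (by linarith)
    exact ⟨k ζ y, ⟨sCA hk, sCB hk⟩, ke ζ y hy⟩
  · intro ζ z hz _
    exact (E ζ z ⟨sA (sA4 hz.1), sB (sB4 hz.2)⟩).2
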